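/- There exists an absolute constant c > 0 such that: for each n, if the martingale differences (X_i)_{1≤i≤n} satisfy conditions (A1), (A2) with exponent ρ = 1, and (A4) with ρ = 1, and (x_n) is a sequence with x_n ≥ 0 and x_n γ_n → 0 (i.e. x_n = o(γ_n^{-1})), then for all sufficiently large n, P(W_n ≥ x_n)/(1 − Φ(x_n)) ≥ exp{ −c ( x_n³ ε_n + x_n² δ_n² + (1 + x_n)( x_n γ_n + γ_n |ln γ_n| + δ_n ) ) }. The same lower bound holds with P(W_n ≥ x_n)/(1 − Φ(x_n)) replaced by P(W_n ≤ −x_n)/Φ(−x_n). -/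

import Mathlib

open MeasureTheory Filter
open scoped Topology ENNReal

noncomputable def stdNormalCDF (x : ℝ) : ℝ :=
  (Real.sqrt (2 * Real.pi))⁻¹ * ∫ t in Set.Iic x, Real.exp (-(t ^ 2) / 2)

/-- A finite sequence of square-integrable martingale differences
`X 1, ..., X n` adapted to a filtration `F 0 ⊆ F 1 ⊆ ... ⊆ F n`, with
`F 0` trivial, `E[X i | F (i-1)] = 0` and `0 < E[(X i)^2] < ∞`. -/
structure MDS (Ω : Type) [mΩ : MeasurableSpace Ω] (P : Measure Ω) where
  n : ℕ
  npos : 0 < n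
  F : ℕ → MeasurableSpace Ω
  F_mono : Monotone F
  F_le : ∀ i, F i ≤ mΩ
  F_zero : F 0 = ⊥
  X : ℕ → Ω → ℝ
  meas : ∀ i, 1 ≤ i → i ≤ n → StronglyMeasurable[F i] (X i)
  sq_int : ∀ i, 1 ≤ i → i ≤ n → Integrable (fun ω => (X i ω) ^ 2) P
  mean_zero : ∀ i, 1 ≤ i → i ≤ n → P[X i|F (i - 1)] =ᵐ[P] 0
  var_pos : ∀ i, 1 ≤ i → i ≤ n → 0 < ∫ ω, (X i ω) ^ 2 ∂P

namespace MDS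

variable {Ω : Type} [mΩ : MeasurableSpace Ω] {P : Measure Ω}

/-- `S_n = ∑_{i=1}^n X_i`. -/
noncomputable def S (A : MDS Ω P) : Ω → ℝ := fun ω => ∑ i ∈ Finset.Icc 1 A.n, A.X i ω

/-- `B_n² = ∑_{i=1}^n E[X_i²]`. -/
noncomputable def Bsq (A : MDS Ω P) : ℝ := ∑ i ∈ Finset.Icc 1 A.n, ∫ ω, (A.X i ω) ^ 2 ∂P

/-- `[S]_n = ∑_{i=1}^n X_i²`. -/
noncomputable def QV (A : MDS Ω P) : Ω → ℝ := fun ω => ∑ i ∈ Finset.Icc 1 A.n, (A.X i ω) ^ 2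

/-- `⟨S⟩_n = ∑_{i=1}^n E[X_i² | F_{i-1}]`. -/
noncomputable def CV (A : MDS Ω P) : Ω → ℝ :=
  fun ω => ∑ i ∈ Finset.Icc 1 A.n, (P[fun ω' => (A.X i ω') ^ 2|A.F (i - 1)]) ω

/-- `W_n = S_n / √[S]_n`. -/
noncomputable def W (A : MDS Ω P) : Ω → ℝ := fun ω => A.S ω / Real.sqrt (A.QV ω)

/-- Condition (A1): `|⟨S⟩_n − B_n²| ≤ δ² B_n²` a.s., with `δ ∈ [0, 1/4]`. -/
def CondA1 (A : MDS Ω P) (δ : ℝ) : Prop :=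
  0 ≤ δ ∧ δ ≤ 1 / 4 ∧ ∀ᵐ ω ∂P, |A.CV ω - A.Bsq| ≤ δ ^ 2 * A.Bsq

/-- Condition (A2): `∑_{i=1}^n E[|X_i|^{2+ρ} | F_{i-1}] ≤ ε^ρ B_n^{2+ρ}` a.s.,
with `ε ∈ (0, 1/4]`. -/
def CondA2 (A : MDS Ω P) (ρ ε : ℝ) : Prop :=
  0 < ε ∧ ε ≤ 1 / 4 ∧
    (∀ i, 1 ≤ i → i ≤ A.n → Integrable (fun ω => |A.X i ω| ^ (2 + ρ)) P) ∧
    ∀ᵐ ω ∂P,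
      ∑ i ∈ Finset.Icc 1 A.n, (P[fun ω' => |A.X i ω'| ^ (2 + ρ)|A.F (i - 1)]) ω ≤
        ε ^ ρ * A.Bsq ^ ((2 + ρ) / 2)

/-- Condition (A3): `E[X_i² | F_{i-1}] ≤ κ² B_n²` a.s. for each `i`, with `κ ∈ (0, 1/4]`. -/
def CondA3 (A : MDS Ω P) (κ : ℝ) : Prop :=
  0 < κ ∧ κ ≤ 1 / 4 ∧
    ∀ i, 1 ≤ i → i ≤ A.n →
      ∀ᵐ ω ∂P, (P[fun ω' => (A.X i ω') ^ 2|A.F (i - 1)]) ω ≤ κ ^ 2 * A.Bsq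

/-- Condition (A4): `E[|X_i|^{2+ρ} | F_{i-1}] ≤ (γ B_n)^ρ E[X_i² | F_{i-1}]` a.s.
for each `i`, with `γ ∈ (0, 1/4]`. -/
def CondA4 (A : MDS Ω P) (ρ γ : ℝ) : Prop :=
  0 < γ ∧ γ ≤ 1 / 4 ∧
    (∀ i, 1 ≤ i → i ≤ A.n → Integrable (fun ω => |A.X i ω| ^ (2 + ρ)) P) ∧
    ∀ i, 1 ≤ i → i ≤ A.n →
      ∀ᵐ ω ∂P,
        (P[fun ω' => |A.X i ω'| ^ (2 + ρ)|A.F (i - 1)]) ω ≤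
          (γ * Real.sqrt A.Bsq) ^ ρ * (P[fun ω' => (A.X i ω') ^ 2|A.F (i - 1)]) ω

end MDS


namespace SN

/-- standard normal density -/
noncomputable def phi (t : ℝ) : ℝ := (Real.sqrt (2 * Real.pi))⁻¹ * Real.exp (-(t ^ 2) / 2)

noncomputable abbrev Ph : ℝ → ℝ := stdNormalCDF

lemma phi_pos (t : ℝ) : 0 < phi t := by unfold phi; positivity

lemma phi_eq_pdf (t : ℝ) : ProbabilityTheory.gaussianPDFReal 0 1 t = phi t := by
  simp [ProbabilityTheory.gaussianPDFReal, phi]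

lemma phi_integrable : Integrable phi := by
  have := ProbabilityTheory.integrable_gaussianPDFReal 0 1
  exact this.congr (Eventually.of_forall phi_eq_pdf)

lemma Ph_eq_int (x : ℝ) : Ph x = ∫ t in Set.Iic x, phi t := by
  simp only [Ph, stdNormalCDF, phi]
  rw [integral_const_mul]

lemma Ph_eq_real (x : ℝ) : Ph x = (ProbabilityTheory.gaussianReal 0 1).real (Set.Iic x) := by
  rw [Ph_eq_int, Measure.real, ProbabilityTheory.gaussianReal_apply_eq_integral _ (by simp),
    ENNReal.toReal_ofReal]
  · exact setIntegral_congr_fun measurableSet_Iic (fun t _ => (phi_eq_pdf t).symm)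
  · exact integral_nonneg (fun t => ProbabilityTheory.gaussianPDFReal_nonneg _ _ _)

lemma Ph_eq_cdf : Ph = ProbabilityTheory.cdf (ProbabilityTheory.gaussianReal 0 1) := by
  funext x; rw [Ph_eq_real, ProbabilityTheory.cdf_eq_real]

lemma Ph_nonneg (x : ℝ) : 0 ≤ Ph x := by rw [Ph_eq_real]; exact measureReal_nonneg
lemma Ph_le_one (x : ℝ) : Ph x ≤ 1 := by rw [Ph_eq_real]; exact measureReal_le_one
lemma Ph_mono : Monotone Ph := by rw [Ph_eq_cdf]; exact ProbabilityTheory.monotone_cdf _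
lemma Ph_tendsto : Tendsto Ph atTop (𝓝 1) := by
  rw [Ph_eq_cdf]; exact ProbabilityTheory.tendsto_cdf_atTop _

lemma phi_cont : Continuous phi := by unfold phi; fun_prop

lemma Ph_hasDeriv (x : ℝ) : HasDerivAt Ph (phi x) x := by
  have h : Ph = fun u => Ph 0 + ∫ t in (0:ℝ)..u, phi t := by
    funext u
    rw [Ph_eq_int, Ph_eq_int,
      ← intervalIntegral.integral_Iic_sub_Iic phi_integrable.integrableOn phi_integrable.integrableOn]
    ring
  rw [h]
  have := (intervalIntegral.integral_hasDerivAt_right (phi_cont.intervalIntegrable 0 x)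
    phi_cont.stronglyMeasurable.stronglyMeasurableAtFilter phi_cont.continuousAt)
  exact this.const_add _

lemma phi_neg (t : ℝ) : phi (-t) = phi t := by simp [phi]

lemma phi_integral : ∫ t, phi t = 1 := by
  have := ProbabilityTheory.integral_gaussianPDFReal_eq_one 0 (v := 1) (by simp)
  rw [← this]; exact integral_congr_ae (Eventually.of_forall fun t => (phi_eq_pdf t).symm)

lemma one_sub_Ph (x : ℝ) : 1 - Ph x = ∫ t in Set.Ioi x, phi t := by
  have := integral_add_compl (measurableSet_Iic (a := x)) phi_integrable
  rw [phi_integral, Set.compl_Iic, ← Ph_eq_int] at this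
  linarith

lemma Ph_neg (x : ℝ) : Ph (-x) = 1 - Ph x := by
  rw [one_sub_Ph, Ph_eq_int]
  have := integral_comp_neg_Iic (-x) phi
  simp only [phi_neg, neg_neg] at this
  exact this

lemma Ph_zero : Ph 0 = 1 / 2 := by
  have := Ph_neg 0
  simp only [neg_zero] at this; linarith

lemma phi_hasDeriv (x : ℝ) : HasDerivAt phi (-x * phi x) x := by
  unfold phi
  have h1 : HasDerivAt (fun t : ℝ => -(t ^ 2) / 2) (-x) x := by
    have := ((hasDerivAt_pow 2 x).neg.div_const 2)
    exact this.congr_deriv (by simp; ring)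
  exact (h1.exp.const_mul ((Real.sqrt (2 * Real.pi))⁻¹)).congr_deriv (by ring)

lemma phi1_hasDeriv (x : ℝ) : HasDerivAt (fun x => -x * phi x) ((x ^ 2 - 1) * phi x) x := by
  exact ((hasDerivAt_id x).neg.mul (phi_hasDeriv x)).congr_deriv (by simp; ring)

lemma inv_sqrt_le : (Real.sqrt (2 * Real.pi))⁻¹ ≤ 1 / 2 := by
  rw [inv_le_comm₀ (by positivity) (by norm_num)]
  have : (2:ℝ) ≤ Real.sqrt (2 * Real.pi) := by
    apply Real.le_sqrt_of_sq_le; nlinarith [Real.pi_gt_three]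
  rw [one_div, inv_inv]; exact this

lemma phi_le_exp (x : ℝ) : phi x ≤ Real.exp (-(x ^ 2) / 2) / 2 := by
  unfold phi
  have := Real.exp_pos (-(x ^ 2) / 2)
  nlinarith [inv_sqrt_le]

/-- polynomial decay of the exponential. -/
lemma exp_poly {y : ℝ} (hy : 0 ≤ y) : Real.exp (-y) * (1 + y + y ^ 2 + y ^ 3) ≤ 10 := by
  have h0 := Real.one_le_exp hy
  have h1 := Real.pow_div_factorial_le_exp y hy 1
  have h2 := Real.pow_div_factorial_le_exp y hy 2
  have h3 := Real.pow_div_factorial_le_exp y hy 3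
  simp [Nat.factorial] at h1 h2 h3
  have : 1 + y + y ^ 2 + y ^ 3 ≤ 10 * Real.exp y := by linarith
  calc _ ≤ Real.exp (-y) * (10 * Real.exp y) := by gcongr
    _ = 10 := by rw [mul_left_comm, ← Real.exp_add]; simp

lemma exp_quarter (x : ℝ) : Real.exp (-(x ^ 2) / 4) * ((1 + x ^ 2) * (1 + |x| + x ^ 2 + |x| ^ 3)) ≤ 10000 := by
  have h := exp_poly (y := x ^ 2 / 4) (by positivity)
  have e : -(x ^ 2 / 4) = -(x ^ 2) / 4 := by ring
  rw [e] at h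
  have hp := Real.exp_pos (-(x ^ 2) / 4)
  have hb : (1 + x ^ 2) * (1 + |x| + x ^ 2 + |x| ^ 3) ≤
      1000 * (1 + x ^ 2 / 4 + (x ^ 2 / 4) ^ 2 + (x ^ 2 / 4) ^ 3) := by
    have ha := abs_nonneg x
    rw [← sq_abs x]
    set t := |x|
    nlinarith [sq_nonneg (t - 1), sq_nonneg (t ^ 2 - 1), sq_nonneg (t ^ 3 - t), sq_nonneg (t ^ 2 - t), sq_nonneg (t^3 - t^2), sq_nonneg t, sq_nonneg (t^2), sq_nonneg (t^3)]
  calc _ ≤ Real.exp (-(x ^ 2) / 4) * (1000 * (1 + x ^ 2 / 4 + (x ^ 2 / 4) ^ 2 + (x ^ 2 / 4) ^ 3)) := by gcongr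
    _ ≤ 10000 := by linarith

lemma exp_half_le (x : ℝ) : Real.exp (-(x ^ 2) / 2) ≤ Real.exp (-(x ^ 2) / 4) := by
  apply Real.exp_le_exp.2; nlinarith [sq_nonneg x]

lemma exp_quarter_le (x p : ℝ) (hp : p ≤ 1 + |x| + x ^ 2 + |x| ^ 3) :
    Real.exp (-(x ^ 2) / 4) * p ≤ 10000 / (1 + x ^ 2) := by
  rw [le_div_iff₀ (by positivity)]
  have := exp_quarter x
  have hp' := Real.exp_pos (-(x ^ 2) / 4)
  have : Real.exp (-(x ^ 2) / 4) * p * (1 + x ^ 2) ≤ Real.exp (-(x ^ 2) / 4) * (1 + |x| + x ^ 2 + |x| ^ 3) * (1 + x ^ 2) := by gcongr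
  nlinarith

lemma phi_poly (x p : ℝ) (hp0 : 0 ≤ p) (hp : p ≤ 1 + |x| + x ^ 2 + |x| ^ 3) :
    p * phi x ≤ 10000 / (1 + x ^ 2) := by
  refine le_trans ?_ (exp_quarter_le x p hp)
  have := phi_le_exp x
  have h2 := exp_half_le x
  have := Real.exp_pos (-(x ^ 2) / 2)
  rw [mul_comm]
  gcongr; linarith

lemma abs_mul_phi_le (x : ℝ) : |x| * phi x ≤ 1 := by
  have h := phi_le_exp x
  have h2 : Real.exp (-(x ^ 2) / 2) * (1 + x ^ 2 / 2) ≤ 1 := by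
    have := Real.add_one_le_exp (x ^ 2 / 2)
    calc _ ≤ Real.exp (-(x ^ 2) / 2) * Real.exp (x ^ 2 / 2) := by gcongr; linarith
      _ = 1 := by rw [← Real.exp_add]; ring_nf; simp
  have : |x| ≤ 2 * (1 + x ^ 2 / 2) := by
    rw [← sq_abs x]; nlinarith [sq_nonneg (|x| - 1)]
  calc |x| * phi x ≤ 2 * (1 + x ^ 2 / 2) * (Real.exp (-(x ^ 2) / 2) / 2) := by
        gcongr; exact (phi_pos x).le
    _ ≤ 1 := by linarith

lemma phi_le_half (x : ℝ) : phi x ≤ 1 / 2 := by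
  have := phi_le_exp x
  have : Real.exp (-(x ^ 2) / 2) ≤ 1 := Real.exp_le_one_iff.2 (by nlinarith [sq_nonneg x])
  linarith

lemma Ph_lip (a b : ℝ) : |Ph b - Ph a| ≤ |b - a| := by
  have := Convex.norm_image_sub_le_of_norm_hasDerivWithin_le (f := Ph) (f' := phi) (s := Set.univ)
    (x := a) (y := b) (C := 1) (fun x _ => (Ph_hasDeriv x).hasDerivWithinAt)
    (fun x _ => by rw [Real.norm_eq_abs, abs_of_pos (phi_pos x)]; linarith [phi_le_half x])
    convex_univ trivial trivial
  simpa using this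

/-- third order Taylor bound -/
lemma taylor3 {f f1 f2 f3 : ℝ → ℝ} (h0 : ∀ x, HasDerivAt f (f1 x) x) (h1 : ∀ x, HasDerivAt f1 (f2 x) x)
    (h2 : ∀ x, HasDerivAt f2 (f3 x) x) {z h K : ℝ}
    (hK : ∀ w, |w - z| ≤ |h| → |f3 w| ≤ K) :
    |f (z + h) - f z - f1 z * h - f2 z * h ^ 2 / 2| ≤ K * |h| ^ 3 := by
  set s : Set ℝ := Metric.closedBall z |h|
  have hs : ∀ w, w ∈ s ↔ |w - z| ≤ |h| := fun w => by
    simp only [s, Metric.mem_closedBall, Real.dist_eq]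
  have hconv : Convex ℝ s := convex_closedBall _ _
  have hz : z ∈ s := by rw [hs]; simp
  have hK0 : 0 ≤ K := le_trans (abs_nonneg _) (hK z (by simp))
  have b2 : ∀ w ∈ s, |f2 w - f2 z| ≤ K * |h| := by
    intro w hw
    have := Convex.norm_image_sub_le_of_norm_hasDerivWithin_le (f := f2) (f' := f3) (s := s)
      (fun x _ => (h2 x).hasDerivWithinAt) (fun x hx => hK x ((hs x).1 hx)) hconv hz hw
    simp only [Real.norm_eq_abs] at this
    exact this.trans (by have := (hs w).1 hw; gcongr)
  have b1 : ∀ w ∈ s, |f1 w - f1 z - f2 z * (w - z)| ≤ K * |h| * |h| := by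
    intro w hw
    have := Convex.norm_image_sub_le_of_norm_hasDerivWithin_le
      (f := fun w => f1 w - f2 z * (w - z)) (f' := fun w => f2 w - f2 z) (s := s)
      (fun x _ => by
        have := (h1 x).sub (((hasDerivAt_id x).sub_const z).const_mul (f2 z))
        simp only [mul_one, id] at this
        exact this.hasDerivWithinAt) (fun x hx => b2 x hx) hconv hz hw
    simp only [Real.norm_eq_abs, sub_self, mul_zero, sub_zero] at this
    rw [show f1 w - f1 z - f2 z * (w - z) = f1 w - f2 z * (w - z) - f1 z by ring]
    exact this.trans (by have := (hs w).1 hw; gcongr)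
  have hw : z + h ∈ s := by rw [hs]; simp
  have := Convex.norm_image_sub_le_of_norm_hasDerivWithin_le
      (f := fun w => f w - f1 z * (w - z) - f2 z * (w - z) ^ 2 / 2)
      (f' := fun w => f1 w - f1 z - f2 z * (w - z)) (s := s)
      (fun x _ => by
        have := ((h0 x).sub (((hasDerivAt_id x).sub_const z).const_mul (f1 z))).sub
          ((((hasDerivAt_id x).sub_const z).pow 2).const_mul (f2 z) |>.div_const 2)
        refine HasDerivAt.hasDerivWithinAt ?_
        exact this.congr_deriv (by simp; ring)) (fun x hx => b1 x hx) hconv hz hw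
  simp only [Real.norm_eq_abs] at this
  calc _ = |f (z + h) - f1 z * (z + h - z) - f2 z * (z + h - z) ^ 2 / 2 - (f z - f1 z * (z - z) - f2 z * (z - z) ^ 2 / 2)| := by
        congr 1; ring
    _ ≤ _ := this
    _ = _ := by rw [add_sub_cancel_left]; ring

/-- second order Taylor bound on `[0,r]` -/
lemma taylor2 {f f1 f2 : ℝ → ℝ} {r K : ℝ} (hr : 0 ≤ r) (h0 : ∀ x, 0 ≤ x → HasDerivAt f (f1 x) x)
    (h1 : ∀ x, 0 ≤ x → HasDerivAt f1 (f2 x) x)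
    (hK : ∀ w, 0 ≤ w → w ≤ r → |f2 w| ≤ K) :
    |f r - f 0 - f1 0 * r| ≤ K * r ^ 2 := by
  set s : Set ℝ := Set.Icc 0 r
  have hconv : Convex ℝ s := convex_Icc _ _
  have hz : (0:ℝ) ∈ s := ⟨le_rfl, hr⟩
  have hK0 : 0 ≤ K := le_trans (abs_nonneg _) (hK 0 le_rfl hr)
  have b2 : ∀ w ∈ s, |f1 w - f1 0| ≤ K * r := by
    intro w hw
    have := Convex.norm_image_sub_le_of_norm_hasDerivWithin_le (f := f1) (f' := f2) (s := s)
      (fun x hx => (h1 x hx.1).hasDerivWithinAt) (fun x hx => hK x hx.1 hx.2) hconv hz hw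
    simp only [Real.norm_eq_abs, sub_zero, abs_of_nonneg hw.1] at this
    exact this.trans (by have := hw.2; gcongr)
  have := Convex.norm_image_sub_le_of_norm_hasDerivWithin_le
      (f := fun w => f w - f1 0 * w) (f' := fun w => f1 w - f1 0) (s := s)
      (fun x hx => by
        have := (h0 x hx.1).sub ((hasDerivAt_id x).const_mul (f1 0))
        simp only [mul_one, id] at this
        exact this.hasDerivWithinAt) (fun x hx => b2 x hx) hconv hz ⟨hr, le_rfl⟩
  simp only [Real.norm_eq_abs, mul_zero, sub_zero, abs_of_nonneg hr] at this
  calc _ = |f r - f1 0 * r - f 0| := by congr 1; ring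
    _ ≤ _ := this
    _ = _ := by ring

end SN

namespace SN

lemma phi2_bound (w : ℝ) : |(w ^ 2 - 1) * phi w| ≤ 10000 / (1 + w ^ 2) := by
  rw [abs_mul, abs_of_pos (phi_pos w)]
  refine phi_poly w _ (abs_nonneg _) ?_
  have h1 := abs_nonneg w
  have h3 := pow_nonneg h1 3
  rw [abs_le]; constructor <;> nlinarith [sq_nonneg w]

lemma R1 (z h : ℝ) : |Ph (z + h) - Ph z - phi z * h - (-z * phi z) * h ^ 2 / 2| ≤
    50000 * |h| ^ 3 / (1 + z ^ 2) := by
  have hzz : 0 < 1 + z ^ 2 := by positivity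
  have hh := abs_nonneg h
  by_cases hz : |z| ≤ 2
  · have hz2 : 1 + z ^ 2 ≤ 5 := by rw [← sq_abs]; nlinarith [abs_nonneg z]
    refine (taylor3 Ph_hasDeriv phi_hasDeriv phi1_hasDeriv (K := 10000) ?_).trans ?_
    · intro w _
      refine (phi2_bound w).trans ?_
      rw [div_le_iff₀ (by positivity)]; nlinarith [sq_nonneg w]
    · rw [le_div_iff₀ hzz]; nlinarith [pow_nonneg hh 3]
  push Not at hz
  by_cases hh2 : |h| ≤ |z| / 2
  · refine (taylor3 Ph_hasDeriv phi_hasDeriv phi1_hasDeriv (K := 40000 / (1 + z ^ 2)) ?_).trans ?_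
    · intro w hw
      refine (phi2_bound w).trans ?_
      have hw2 : |z| / 2 ≤ |w| := by
        have := abs_sub_abs_le_abs_sub z w
        rw [abs_sub_comm] at this; linarith
      rw [div_le_div_iff₀ (by positivity) (by positivity)]
      rw [← sq_abs z, ← sq_abs w]; nlinarith [abs_nonneg z]
    · rw [div_mul_eq_mul_div]; gcongr; norm_num
  push Not at hh2
  have hh1 : 1 < |h| := by linarith
  have e1 : |Ph (z + h) - Ph z| ≤ 1 := by
    rw [abs_le]; constructor <;> linarith [Ph_nonneg (z+h), Ph_nonneg z, Ph_le_one (z+h), Ph_le_one z]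
  have e2 : |phi z * h| ≤ 10000 / (1 + z ^ 2) * |h| ^ 3 := by
    rw [abs_mul, abs_of_pos (phi_pos z)]
    have := phi_poly z 1 (by norm_num) (by have := abs_nonneg z; nlinarith [sq_nonneg z, pow_nonneg this 3])
    rw [one_mul] at this
    have h3 : |h| ≤ |h| ^ 3 := by nlinarith [mul_pos (show 0 < |h| by linarith) (show 0 < |h| by linarith)]
    gcongr
  have e3 : |(-z * phi z) * h ^ 2 / 2| ≤ 10000 / (1 + z ^ 2) * |h| ^ 3 := by
    rw [abs_div, abs_mul, abs_mul, abs_neg, abs_of_pos (phi_pos z), abs_pow]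
    have := phi_poly z |z| (abs_nonneg z) (by have := abs_nonneg z; nlinarith [sq_nonneg z, pow_nonneg this 3])
    have h3 : |h| ^ 2 / |2| ≤ |h| ^ 3 := by rw [abs_two]; nlinarith [sq_nonneg |h|]
    rw [mul_div_assoc]
    gcongr
  have e4 : 1 ≤ 8 * |h| ^ 3 / (1 + z ^ 2) := by
    rw [le_div_iff₀ hzz, one_mul, ← sq_abs z]
    have : (|z| / 2) ^ 3 ≤ |h| ^ 3 := by gcongr
    nlinarith [sq_nonneg |z|]
  have e5 : 50000 * |h| ^ 3 / (1 + z ^ 2) = 8 * |h| ^ 3 / (1 + z ^ 2) + 10000 / (1 + z ^ 2) * |h| ^ 3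
     + 10000 / (1 + z ^ 2) * |h| ^ 3 + 29992 / (1 + z ^ 2) * |h| ^ 3 := by ring
  have e6 : 0 ≤ 29992 / (1 + z ^ 2) * |h| ^ 3 := by positivity
  have := abs_sub (Ph (z + h) - Ph z - phi z * h) ((-z * phi z) * h ^ 2 / 2)
  have := abs_sub (Ph (z + h) - Ph z) (phi z * h)
  linarith

lemma w_hasDeriv (z r : ℝ) (hr : 0 ≤ r) : HasDerivAt (fun r => z / Real.sqrt (1 + r))
    (-(z / Real.sqrt (1 + r)) / (2 * (1 + r))) r := by
  have hp : 0 < 1 + r := by linarith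
  have h1 : HasDerivAt (fun r : ℝ => 1 + r) 1 r := (hasDerivAt_id r).const_add 1
  have h2 := (h1.sqrt hp.ne').inv (Real.sqrt_pos.2 hp).ne'
  refine (h2.const_mul z).congr_deriv ?_
  have hq : 0 < Real.sqrt (1 + r) := Real.sqrt_pos.2 hp
  have hs : Real.sqrt (1 + r) ^ 2 = 1 + r := Real.sq_sqrt hp.le
  generalize Real.sqrt (1 + r) = q at *
  rw [← hs]
  field_simp

lemma f_hasDeriv (z r : ℝ) (hr : 0 ≤ r) : HasDerivAt (fun r => Ph (z / Real.sqrt (1 + r)))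
    ((-(z / Real.sqrt (1 + r)) * phi (z / Real.sqrt (1 + r))) / (2 * (1 + r))) r := by
  have := (Ph_hasDeriv (z / Real.sqrt (1 + r))).comp r (w_hasDeriv z r hr)
  exact this.congr_deriv (by ring)

lemma f1_hasDeriv (z r : ℝ) (hr : 0 ≤ r) :
    HasDerivAt (fun r => (-(z / Real.sqrt (1 + r)) * phi (z / Real.sqrt (1 + r))) / (2 * (1 + r)))
    ((3 * (z / Real.sqrt (1 + r)) - (z / Real.sqrt (1 + r)) ^ 3) * phi (z / Real.sqrt (1 + r)) / (4 * (1 + r) ^ 2)) r := by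
  have hp : 0 < 1 + r := by linarith
  have h1 : HasDerivAt (fun r : ℝ => 2 * (1 + r)) (2 * 1) r := ((hasDerivAt_id r).const_add 1).const_mul 2
  have h := ((phi1_hasDeriv (z / Real.sqrt (1 + r))).comp r (w_hasDeriv z r hr)).div h1 (by positivity)
  refine h.congr_deriv ?_
  simp only [Function.comp]
  generalize z / Real.sqrt (1 + r) = w
  field_simp
  ring

lemma R2 (z r : ℝ) (hr : 0 ≤ r) (hr1 : r ≤ 1) :
    |Ph (z / Real.sqrt (1 + r)) - Ph z - (-z * phi z) / 2 * r| ≤ 20000 / (1 + z ^ 2) * r ^ 2 := by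
  have h := taylor2 hr (f_hasDeriv z) (f1_hasDeriv z) (K := 20000 / (1 + z ^ 2)) ?_
  · simpa using h
  intro t ht0 htr
  have hp : 0 < 1 + t := by linarith
  have hw : (z / Real.sqrt (1 + t)) ^ 2 * (1 + t) = z ^ 2 := by
    rw [div_pow, Real.sq_sqrt hp.le]; field_simp
  generalize z / Real.sqrt (1 + t) = w at *
  rw [abs_div, abs_mul, abs_of_pos (phi_pos w), abs_of_pos (show 0 < 4 * (1 + t) ^ 2 by positivity)]
  have h1 : |3 * w - w ^ 3| / 4 ≤ 1 + |w| + w ^ 2 + |w| ^ 3 := by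
    have := abs_sub (3 * w) (w ^ 3)
    rw [abs_mul, abs_pow] at this
    have h0 := abs_nonneg w
    have h3 := pow_nonneg h0 3
    have : |(3:ℝ)| = 3 := by norm_num
    nlinarith [sq_nonneg w]
  have h2 := phi_poly w _ (by positivity) h1
  calc _ ≤ |3 * w - w ^ 3| / 4 * phi w := by
        rw [div_mul_eq_mul_div]
        have := phi_pos w
        gcongr
        nlinarith
    _ ≤ _ := h2
    _ ≤ _ := by
        rw [div_le_div_iff₀ (by positivity) (by positivity)]
        nlinarith [sq_nonneg w]

lemma Ph_scale (z A : ℝ) (hA : 1 ≤ A) : |Ph (z / Real.sqrt A) - Ph z| ≤ A - 1 := by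
  have := Convex.norm_image_sub_le_of_norm_hasDerivWithin_le (s := Set.Ici (0:ℝ)) (x := 0) (y := A - 1) (C := 1)
    (fun r hr => (f_hasDeriv z r hr).hasDerivWithinAt) ?_ (convex_Ici 0) (by simp) (by simp; linarith)
  · simp only [Real.norm_eq_abs, add_sub_cancel, add_zero, Real.sqrt_one, div_one, sub_zero, one_mul] at this
    rwa [abs_of_nonneg (show 0 ≤ A - 1 by linarith)] at this
  intro r hr
  have hr : 0 ≤ r := hr
  have hp : 0 < 1 + r := by linarith
  rw [Real.norm_eq_abs, abs_div, abs_mul, abs_neg, abs_of_pos (phi_pos _), abs_of_pos (show 0 < 2 * (1 + r) by positivity)]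
  rw [div_le_one (by positivity)]
  linarith [abs_mul_phi_le (z / Real.sqrt (1 + r))]

/-- first and second space derivatives of `Ph (y / √s)` -/
noncomputable def G1 (s y : ℝ) : ℝ := phi (y / Real.sqrt s) / Real.sqrt s
noncomputable def H1 (s y : ℝ) : ℝ := -(y / Real.sqrt s) * phi (y / Real.sqrt s) / s

lemma sq_div_sqrt {s : ℝ} (hs : 0 < s) (y : ℝ) : 1 + (y / Real.sqrt s) ^ 2 = (s + y ^ 2) / s := by
  rw [div_pow, Real.sq_sqrt hs.le]; field_simp

lemma H1_bound {s : ℝ} (hs : 0 < s) (y : ℝ) : |H1 s y| ≤ 10000 / (s + y ^ 2) := by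
  unfold H1
  have h := phi_poly (y / Real.sqrt s) |y / Real.sqrt s| (abs_nonneg _)
    (by have := abs_nonneg (y / Real.sqrt s); nlinarith [sq_nonneg (y / Real.sqrt s), pow_nonneg this 3])
  rw [sq_div_sqrt hs] at h
  rw [abs_div, abs_mul, abs_neg, abs_of_pos (phi_pos _), abs_of_pos hs, div_le_iff₀ hs]
  refine h.trans (le_of_eq ?_)
  have : 0 < s + y ^ 2 := by positivity
  field_simp

lemma G1_bound {s : ℝ} (y : ℝ) : |G1 s y| ≤ 1 / Real.sqrt s := by
  unfold G1
  rw [abs_div, abs_of_pos (phi_pos _), abs_of_nonneg (Real.sqrt_nonneg s)]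
  gcongr; linarith [phi_le_half (y / Real.sqrt s)]

lemma step_bound {s v y ξ : ℝ} (hs : 0 < s) (hv : 0 ≤ v) (hvs : v ≤ s) :
    |Ph ((y + ξ) / Real.sqrt s) - Ph (y / Real.sqrt (s + v)) - G1 s y * ξ - H1 s y * (ξ ^ 2 - v) / 2| ≤
      50000 * |ξ| ^ 3 / (Real.sqrt s * (s + y ^ 2)) + 20000 * v ^ 2 / (s * (s + y ^ 2)) := by
  have hq : 0 < Real.sqrt s := Real.sqrt_pos.2 hs
  have hqs : Real.sqrt s ^ 2 = s := Real.sq_sqrt hs.le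
  have hsy : 0 < s + y ^ 2 := by positivity
  have h1 := R1 (y / Real.sqrt s) (ξ / Real.sqrt s)
  have h2 := R2 (y / Real.sqrt s) (v / s) (by positivity) ((div_le_one hs).2 hvs)
  have e : y / Real.sqrt s / Real.sqrt (1 + v / s) = y / Real.sqrt (s + v) := by
    rw [div_div, ← Real.sqrt_mul hs.le]; congr 2; field_simp
  rw [e] at h2
  rw [sq_div_sqrt hs] at h1 h2
  rw [← add_div, abs_div, abs_of_pos hq] at h1
  have e1 : 50000 * (|ξ| / Real.sqrt s) ^ 3 / ((s + y ^ 2) / s) = 50000 * |ξ| ^ 3 / (Real.sqrt s * (s + y ^ 2)) := by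
    generalize Real.sqrt s = q at *
    subst hqs
    field_simp
  have e2 : 20000 / ((s + y ^ 2) / s) * (v / s) ^ 2 = 20000 * v ^ 2 / (s * (s + y ^ 2)) := by
    field_simp
  rw [e1] at h1; rw [e2] at h2
  have e3 : Ph ((y + ξ) / Real.sqrt s) - Ph (y / Real.sqrt (s + v)) - G1 s y * ξ - H1 s y * (ξ ^ 2 - v) / 2 =
    (Ph ((y + ξ) / Real.sqrt s) - Ph (y / Real.sqrt s) - phi (y / Real.sqrt s) * (ξ / Real.sqrt s) -
        -(y / Real.sqrt s) * phi (y / Real.sqrt s) * (ξ / Real.sqrt s) ^ 2 / 2) -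
    (Ph (y / Real.sqrt (s + v)) - Ph (y / Real.sqrt s) - -(y / Real.sqrt s) * phi (y / Real.sqrt s) / 2 * (v / s)) := by
    unfold G1 H1
    rw [div_pow ξ, hqs]
    ring
  rw [e3]
  exact (abs_sub _ _).trans (add_le_add h1 h2)

lemma nonneg_of_antitone {f : ℝ → ℝ} {a : ℝ} (hf : AntitoneOn f (Set.Ici a)) (hl : Tendsto f atTop (𝓝 0)) {x : ℝ}
    (hx : a ≤ x) : 0 ≤ f x := by
  refine le_of_tendsto hl ?_
  filter_upwards [eventually_ge_atTop x] with y hy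
  exact hf hx (hx.trans hy) hy

lemma tail_tendsto : Tendsto (fun x => 1 - Ph x) atTop (𝓝 0) := by
  simpa using (Ph_tendsto.const_sub 1)

lemma phi_div_tendsto (c : ℝ) : Tendsto (fun x => phi x / (x + c)) atTop (𝓝 0) := by
  have h : Tendsto (fun x : ℝ => 1 / (x + c)) atTop (𝓝 0) := by
    have := tendsto_inv_atTop_zero.comp (tendsto_atTop_add_const_right atTop c tendsto_id)
    simpa [Function.comp_def] using this
  refine squeeze_zero' ?_ ?_ h
  · filter_upwards [eventually_gt_atTop (-c)] with x hx
    exact div_nonneg (phi_pos x).le (by linarith)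
  · filter_upwards [eventually_gt_atTop (-c)] with x hx
    have : 0 < x + c := by linarith
    gcongr; linarith [phi_le_half x]

lemma mills_lower {x : ℝ} (hx : 0 ≤ x) : phi x ≤ (x + 1) * (1 - Ph x) := by
  have hd : ∀ y, 0 ≤ y → HasDerivAt (fun y => (1 - Ph y) - phi y / (y + 1)) (-phi y * y / (y + 1) ^ 2) y := by
    intro y hy
    have := ((Ph_hasDeriv y).const_sub 1).sub ((phi_hasDeriv y).div ((hasDerivAt_id y).add_const 1) (by simp; linarith))
    refine this.congr_deriv ?_
    have : y + 1 ≠ 0 := by linarith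
    simp only [id]; field_simp; ring
  have hanti : AntitoneOn (fun y => (1 - Ph y) - phi y / (y + 1)) (Set.Ici 0) := by
    refine antitoneOn_of_deriv_nonpos (convex_Ici 0) (fun y hy => (hd y hy).continuousAt.continuousWithinAt)
      (fun y hy => (hd y (interior_subset hy)).differentiableAt.differentiableWithinAt) ?_
    intro y hy
    have hy : 0 ≤ y := interior_subset hy
    rw [(hd y hy).deriv, neg_mul, neg_div, neg_nonpos]
    have := phi_pos y; positivity
  have := nonneg_of_antitone hanti (by simpa using tail_tendsto.sub (phi_div_tendsto 1)) hx
  have h1 : phi x / (x + 1) ≤ 1 - Ph x := by linarith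
  rw [div_le_iff₀ (by linarith)] at h1; linarith

lemma mills_upper {x : ℝ} (hx : 0 < x) : 1 - Ph x ≤ phi x / x := by
  have hd : ∀ y, 0 < y → HasDerivAt (fun y => phi y / y - (1 - Ph y)) (-phi y / y ^ 2) y := by
    intro y hy
    have := ((phi_hasDeriv y).div (hasDerivAt_id y) (by simp; linarith)).sub ((Ph_hasDeriv y).const_sub 1)
    refine this.congr_deriv ?_
    simp only [id]; field_simp; ring
  have hanti : AntitoneOn (fun y => phi y / y - (1 - Ph y)) (Set.Ici x) := by
    refine antitoneOn_of_deriv_nonpos (convex_Ici x) (fun y hy => (hd y (lt_of_lt_of_le hx hy)).continuousAt.continuousWithinAt)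
      (fun y hy => (hd y (lt_of_lt_of_le hx (interior_subset hy : y ∈ Set.Ici x))).differentiableAt.differentiableWithinAt) ?_
    intro y hy
    have hy : x ≤ y := interior_subset hy
    rw [(hd y (by linarith)).deriv, neg_div, neg_nonpos]
    have := phi_pos y; positivity
  have := nonneg_of_antitone hanti (by simpa using (phi_div_tendsto 0).sub tail_tendsto) (le_refl x)
  linarith

lemma tail_le_sq {t : ℝ} (ht : 0 < t) : Ph (-t) ≤ 1 / t ^ 2 := by
  rw [Ph_neg]
  refine (mills_upper ht).trans ?_
  rw [div_le_div_iff₀ ht (by positivity)]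
  have := abs_mul_phi_le t
  rw [abs_of_pos ht] at this
  nlinarith

lemma tail_pos (x : ℝ) : 0 < 1 - Ph x := by
  rcases le_total 0 x with h | h
  · have := mills_lower h
    have h2 := phi_pos x
    by_contra hc
    push Not at hc
    nlinarith
  · have := Ph_mono h
    rw [Ph_zero] at this; linarith

lemma tail_shift {x h : ℝ} (hx : 0 ≤ x) (hh : 0 ≤ h) :
    (1 - Ph x) * Real.exp (-((x + 1) * h + h ^ 2 / 2)) ≤ 1 - Ph (x + h) := by
  have hd : ∀ t, HasDerivAt (fun t => (1 - Ph (x + t)) * Real.exp ((x + 1) * t + t ^ 2 / 2))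
      (Real.exp ((x + 1) * t + t ^ 2 / 2) * ((x + t + 1) * (1 - Ph (x + t)) - phi (x + t))) t := by
    intro t
    have h1 : HasDerivAt (fun t => 1 - Ph (x + t)) (-(phi (x + t) * 1)) t :=
      ((Ph_hasDeriv (x + t)).comp t ((hasDerivAt_id t).const_add x)).const_sub 1
    have h2 : HasDerivAt (fun t : ℝ => (x + 1) * t + t ^ 2 / 2) ((x + 1) * 1 + (2 * t) / 2) t := by
      have := ((hasDerivAt_id t).const_mul (x + 1)).add ((hasDerivAt_pow 2 t).div_const 2)
      exact this.congr_deriv (by simp)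
    exact (h1.mul h2.exp).congr_deriv (by ring)
  have hm : MonotoneOn (fun t => (1 - Ph (x + t)) * Real.exp ((x + 1) * t + t ^ 2 / 2)) (Set.Ici 0) := by
    refine monotoneOn_of_deriv_nonneg (convex_Ici 0) (fun y hy => (hd y).continuousAt.continuousWithinAt)
      (fun y hy => (hd y).differentiableAt.differentiableWithinAt) ?_
    intro t ht
    have ht : 0 ≤ t := interior_subset ht
    rw [(hd t).deriv]
    have := mills_lower (x := x + t) (by linarith)
    have := Real.exp_pos ((x + 1) * t + t ^ 2 / 2)
    apply mul_nonneg this.le; linarith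
  have := hm (show (0:ℝ) ∈ Set.Ici 0 by simp) hh hh
  simp only [add_zero, mul_zero, ne_eq, OfNat.ofNat_ne_zero, not_false_eq_true, zero_pow, zero_div, Real.exp_zero, mul_one] at this
  rw [Real.exp_neg, ← div_eq_mul_inv, div_le_iff₀ (Real.exp_pos _)]
  exact this

lemma Ph_incr {u : ℝ} (h0 : 0 ≤ u) (h1 : u ≤ 1) : 1 / 2 + u / 10 ≤ Ph u := by
  have hd : ∀ t, HasDerivAt (fun t => Ph t - t / 10) (phi t - 1 / 10) t := fun t =>
    (Ph_hasDeriv t).sub ((hasDerivAt_id t).div_const 10)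
  have hm : MonotoneOn (fun t => Ph t - t / 10) (Set.Icc 0 1) := by
    refine monotoneOn_of_deriv_nonneg (convex_Icc 0 1) (fun y hy => (hd y).continuousAt.continuousWithinAt)
      (fun y hy => (hd y).differentiableAt.differentiableWithinAt) ?_
    intro t ht
    have ht : t ∈ Set.Icc (0:ℝ) 1 := interior_subset ht
    rw [(hd t).deriv]
    unfold phi
    have e1 : 1 / 2 ≤ Real.exp (-(t ^ 2) / 2) := by
      have := Real.add_one_le_exp (-(t ^ 2) / 2)
      nlinarith [ht.1, ht.2]
    have e2 : 1 / 4 ≤ (Real.sqrt (2 * Real.pi))⁻¹ := by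
      rw [one_div, inv_le_inv₀ (by norm_num) (by positivity)]
      rw [Real.sqrt_le_left (by norm_num)]
      nlinarith [Real.pi_lt_four]
    nlinarith
  have := hm (show (0:ℝ) ∈ Set.Icc 0 1 by simp) ⟨h0, h1⟩ h0
  simp [Ph_zero] at this
  linarith

end SN

namespace SN

/-- `D` is a valid two-sided Kolmogorov bound for the law of `Y`. -/
def Valid {Ω : Type} [MeasurableSpace Ω] (Q : Measure Ω) (Y : Ω → ℝ) (D : ℝ) : Prop :=
  ∀ u : ℝ, 1 - Ph u - D ≤ Q.real {ω | u ≤ Y ω} ∧ Ph u - D ≤ Q.real {ω | Y ω ≤ u}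

section conc
variable {Ω : Type} [mΩ : MeasurableSpace Ω] {Q : Measure Ω} [IsProbabilityMeasure Q]

lemma Valid.mono {Y : Ω → ℝ} {D D' : ℝ} (h : Valid Q Y D) (hD : D ≤ D') : Valid Q Y D' :=
  fun u => ⟨by linarith [(h u).1], by linarith [(h u).2]⟩

lemma valid_one (Y : Ω → ℝ) : Valid Q Y 1 := fun u =>
  ⟨by linarith [Ph_nonneg u, measureReal_nonneg (μ := Q) (s := {ω | u ≤ Y ω})],
   by linarith [Ph_le_one u, measureReal_nonneg (μ := Q) (s := {ω | Y ω ≤ u})]⟩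

lemma Valid.interval {Y : Ω → ℝ} (hY : Measurable Y) {D : ℝ} (h : Valid Q Y D) {u w : ℝ} (huw : u ≤ w) :
    Q.real {ω | u < Y ω ∧ Y ω < w} ≤ (w - u) + 2 * D := by
  have m1 : MeasurableSet {ω | w ≤ Y ω} := measurableSet_le measurable_const hY
  have m2 : MeasurableSet {ω | Y ω ≤ u} := measurableSet_le hY measurable_const
  have e : {ω | u < Y ω ∧ Y ω < w} ⊆ ({ω | w ≤ Y ω} ∪ {ω | Y ω ≤ u})ᶜ := by
    intro ω hω
    simp only [Set.mem_compl_iff, Set.mem_union, Set.mem_setOf_eq, not_or, not_le] at *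
    exact ⟨hω.2, hω.1⟩
  have h1 := measureReal_mono (μ := Q) e (by finiteness)
  rw [measureReal_compl (m1.union m2)] at h1
  rcases eq_or_lt_of_le huw with rfl | hlt
  · have : {ω | u < Y ω ∧ Y ω < u} = ∅ := by
      ext ω; simp only [Set.mem_setOf_eq, Set.mem_empty_iff_false, iff_false]; intro h; linarith [h.1, h.2]
    rw [this]; simp
    have h1 := (h u).1; have h2 := (h u).2
    have h3 := h (u - 1)
    by_contra hc
    push Not at hc
    have h5 : ∀ t, 1 - Ph t - D ≤ Q.real {ω | t ≤ Y ω} := fun t => (h t).1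
    have h6 : 1 - Ph (-(1 + -D⁻¹)) - D ≤ 1 := (h5 _).trans measureReal_le_one
    -- use tendsto
    have h7 : ∀ t, Ph t - D ≤ 1 := fun t => ((h t).2).trans measureReal_le_one
    have h8 : 1 - D ≤ 1 := le_of_tendsto (Ph_tendsto.sub_const D) (Eventually.of_forall h7)
    linarith
  rw [measureReal_union (by
    rw [Set.disjoint_left]; intro ω h1 h2; simp only [Set.mem_setOf_eq] at h1 h2; linarith) m2] at h1
  have hl := Ph_lip u w
  rw [abs_of_nonneg (sub_nonneg.2 huw)] at hl
  have := (le_abs_self _).trans hl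
  simp only [probReal_univ] at h1
  linarith [(h w).1, (h u).2]

lemma conc {Y : Ω → ℝ} (hY : Measurable Y) {D : ℝ} (h : Valid Q Y D) (u : ℝ) {R : ℝ} (hR : 0 < R) :
    ∫ ω, R ^ 2 / (R ^ 2 + (Y ω - u) ^ 2) ∂Q ≤ 4 * R + 2 * D := by
  have hD : 0 ≤ D := by
    have h7 : ∀ t, Ph t - D ≤ 1 := fun t => ((h t).2).trans measureReal_le_one
    have h8 : 1 - D ≤ 1 := le_of_tendsto (Ph_tendsto.sub_const D) (Eventually.of_forall h7)
    linarith
  have hm : Measurable fun ω => R ^ 2 / (R ^ 2 + (Y ω - u) ^ 2) := by fun_prop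
  have hle : ∀ ω, R ^ 2 / (R ^ 2 + (Y ω - u) ^ 2) ≤ 1 := fun ω =>
    (div_le_one (by positivity)).2 (by nlinarith [sq_nonneg (Y ω - u)])
  have hInt0 : Integrable (fun ω => R ^ 2 / (R ^ 2 + (Y ω - u) ^ 2)) Q := by
    refine Integrable.of_bound hm.aestronglyMeasurable 1 (Eventually.of_forall fun ω => ?_)
    rw [Real.norm_eq_abs, abs_of_nonneg (by positivity)]; exact hle ω
  rw [hInt0.integral_eq_integral_meas_lt (Eventually.of_forall fun ω => by positivity)]
  set B : ℝ → ℝ := fun t => 2 * R * t ^ (-(1/2) : ℝ) + 2 * D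
  have hB : IntervalIntegrable B volume 0 1 :=
    ((intervalIntegral.intervalIntegrable_rpow' (by norm_num)).const_mul _).add (by simp)
  have hBI : IntegrableOn B (Set.Ioc 0 1) := (intervalIntegrable_iff_integrableOn_Ioc_of_le zero_le_one).1 hB
  have hval : ∫ t in (0:ℝ)..1, B t = 4 * R + 2 * D := by
    rw [intervalIntegral.integral_add ((intervalIntegral.intervalIntegrable_rpow' (by norm_num)).const_mul _) (by simp),
      intervalIntegral.integral_const_mul, integral_rpow (by left; norm_num)]
    simp; norm_num; ring
  rw [← hval, intervalIntegral.integral_of_le zero_le_one, ← integral_indicator measurableSet_Ioi,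
    ← integral_indicator measurableSet_Ioc]
  refine integral_mono_of_nonneg (Eventually.of_forall fun t => ?_) ?_ (Eventually.of_forall fun t => ?_)
  · exact Set.indicator_nonneg (fun _ _ => measureReal_nonneg) t
  · exact (integrable_indicator_iff measurableSet_Ioc).2 hBI
  simp only [Set.indicator]
  by_cases ht0 : 0 < t
  · simp only [Set.mem_Ioi, ht0, if_true, Set.mem_Ioc, true_and]
    by_cases ht1 : t ≤ 1
    · simp only [ht1, if_true]
      have hsub : {a | t < R ^ 2 / (R ^ 2 + (Y a - u) ^ 2)} ⊆
          {a | u - R * t ^ (-(1/2) : ℝ) < Y a ∧ Y a < u + R * t ^ (-(1/2) : ℝ)} := by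
        intro ω hω
        simp only [Set.mem_setOf_eq] at *
        rw [lt_div_iff₀ (by positivity)] at hω
        have hq : (t ^ (-(1/2) : ℝ)) ^ 2 * t = 1 := by
          rw [← Real.rpow_natCast, ← Real.rpow_mul ht0.le]; norm_num
          rw [Real.rpow_neg_one]; field_simp
        have hq0 : 0 < t ^ (-(1/2) : ℝ) := by positivity
        have hsq : (Y ω - u) ^ 2 < (R * t ^ (-(1/2) : ℝ)) ^ 2 := by
          by_contra hc
          push Not at hc
          have : R ^ 2 * ((t ^ (-(1/2) : ℝ)) ^ 2 * t) ≤ t * (Y ω - u) ^ 2 := by nlinarith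
          rw [hq] at this
          nlinarith [mul_pos ht0 (pow_pos hR 2)]
        have := abs_lt_of_sq_lt_sq' hsq (by positivity)
        constructor <;> linarith [this.1, this.2]
      refine (measureReal_mono hsub (by finiteness)).trans ?_
      have hq0 : 0 < R * t ^ (-(1/2) : ℝ) := by positivity
      refine (h.interval hY (by linarith)).trans ?_
      simp only [B]; linarith
    · simp only [ht1, if_false]
      have : {a | t < R ^ 2 / (R ^ 2 + (Y a - u) ^ 2)} = ∅ := by
        ext ω; simp only [Set.mem_setOf_eq, Set.mem_empty_iff_false, iff_false, not_lt]
        exact (hle ω).trans (by linarith)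
      rw [this]; simp
  · simp [ht0]

end conc

section det

/-- deterministic Riemann-sum comparison -/
lemma riemann {f : ℝ → ℝ} (hf0 : ∀ s, 0 < s → 0 ≤ f s) (hanti : AntitoneOn f (Set.Ioi 0))
    (hdbl : ∀ s, 0 < s → f s ≤ 4 * f (2 * s)) (hc : ContinuousOn f (Set.Ioi 0))
    {a2 : ℝ} (ha : 0 < a2) (s v : ℕ → ℝ) (n : ℕ) (hs : ∀ k, k < n → s k = s (k + 1) + v k)
    (hv0 : ∀ k, k < n → 0 ≤ v k) (hva : ∀ k, k < n → v k ≤ a2) (hsa : ∀ k, k ≤ n → a2 ≤ s k) :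
    ∑ k ∈ Finset.range n, v k * f (s (k + 1)) ≤ 4 * ∫ t in a2..(s 0), f t := by
  have hpos : ∀ k, k ≤ n → 0 < s k := fun k hk => ha.trans_le (hsa k hk)
  have hii : ∀ x y, 0 < x → 0 < y → IntervalIntegrable f volume x y := fun x y hx hy =>
    (hc.mono (fun t ht => by
      rw [Set.mem_uIcc] at ht
      rcases ht with ht | ht
      · exact hx.trans_le ht.1
      · exact hy.trans_le ht.1)).intervalIntegrable
  have step : ∀ k, k < n → v k * f (s (k + 1)) ≤ 4 * ∫ t in (s (k+1))..(s k), f t := by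
    intro k hk
    have h1 := hpos (k+1) hk
    have hle : s (k+1) ≤ s k := by linarith [hs k hk, hv0 k hk]
    have : ∫ t in (s (k+1))..(s k), f (2 * s (k+1)) ≤ ∫ t in (s (k+1))..(s k), f t := by
      refine intervalIntegral.integral_mono_on hle (by simp) (hii _ _ h1 (hpos k hk.le)) ?_
      intro t ht
      refine hanti (h1.trans_le ht.1) (by simp; linarith) ?_
      linarith [ht.2, hs k hk, hva k hk, hsa (k+1) hk]
    rw [intervalIntegral.integral_const, smul_eq_mul] at this
    have e : s k - s (k+1) = v k := by linarith [hs k hk]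
    rw [e] at this
    have := hdbl _ h1
    nlinarith [hv0 k hk]
  have tel : ∀ m, m ≤ n → ∑ k ∈ Finset.range m, v k * f (s (k + 1)) ≤ 4 * ∫ t in (s m)..(s 0), f t := by
    intro m
    induction m with
    | zero => intro _; simp
    | succ m ih =>
      intro hm
      rw [Finset.sum_range_succ]
      have := ih (by omega)
      have h2 := step m (by omega)
      rw [← intervalIntegral.integral_add_adjacent_intervals (hii (s (m+1)) (s m) (hpos _ hm) (hpos _ (by omega)))
        (hii (s m) (s 0) (hpos _ (by omega)) (hpos _ (by omega)))]
      linarith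
  refine (tel n le_rfl).trans ?_
  have h0 := hpos 0 (by omega)
  rw [← intervalIntegral.integral_add_adjacent_intervals (hii a2 (s n) ha (hpos n le_rfl))
    (hii (s n) (s 0) (hpos n le_rfl) h0)]
  have : 0 ≤ ∫ t in a2..(s n), f t :=
    intervalIntegral.integral_nonneg (hsa n le_rfl) (fun t ht => hf0 t (ha.trans_le ht.1))
  linarith

lemma riemann1 (y : ℝ) {a2 : ℝ} (ha : 0 < a2) (s v : ℕ → ℝ) (n : ℕ) (hs : ∀ k, k < n → s k = s (k + 1) + v k)
    (hv0 : ∀ k, k < n → 0 ≤ v k) (hva : ∀ k, k < n → v k ≤ a2) (hsa : ∀ k, k ≤ n → a2 ≤ s k) :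
    ∑ k ∈ Finset.range n, v k * (1 / (s (k + 1) + y ^ 2)) ≤ 4 * ∫ t in a2..(s 0), 1 / (t + y ^ 2) := by
  refine riemann (f := fun t => 1 / (t + y ^ 2)) ?_ ?_ ?_ ?_ ha s v n hs hv0 hva hsa
  · intro s hs; positivity
  · intro s hs t ht hst
    have : 0 < s := hs
    show 1 / (t + y ^ 2) ≤ 1 / (s + y ^ 2)
    gcongr
  · intro s hs
    rw [← mul_div_assoc, div_le_div_iff₀ (by positivity) (by positivity)]
    nlinarith [sq_nonneg y]
  · refine ContinuousOn.div continuousOn_const (by fun_prop) ?_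
    intro s hs
    have : 0 < s := hs
    positivity

lemma riemann2 (y : ℝ) {a2 : ℝ} (ha : 0 < a2) (s v : ℕ → ℝ) (n : ℕ) (hs : ∀ k, k < n → s k = s (k + 1) + v k)
    (hv0 : ∀ k, k < n → 0 ≤ v k) (hva : ∀ k, k < n → v k ≤ a2) (hsa : ∀ k, k ≤ n → a2 ≤ s k) :
    ∑ k ∈ Finset.range n, v k * (1 / (Real.sqrt (s (k + 1)) * (s (k + 1) + y ^ 2))) ≤
      4 * ∫ t in a2..(s 0), 1 / (Real.sqrt t * (t + y ^ 2)) := by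
  refine riemann (f := fun t => 1 / (Real.sqrt t * (t + y ^ 2))) ?_ ?_ ?_ ?_ ha s v n hs hv0 hva hsa
  · intro s hs; positivity
  · intro s hs t ht hst
    have : 0 < s := hs
    show 1 / (Real.sqrt t * (t + y ^ 2)) ≤ 1 / (Real.sqrt s * (s + y ^ 2))
    gcongr
  · intro s hs
    have hq : 0 < Real.sqrt s := Real.sqrt_pos.2 hs
    have h2 : Real.sqrt (2 * s) ≤ 2 * Real.sqrt s := by
      rw [Real.sqrt_mul (by norm_num)]
      gcongr
      rw [Real.sqrt_le_left (by norm_num)]; norm_num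
    rw [← mul_div_assoc, div_le_div_iff₀ (by positivity) (by positivity), one_mul]
    calc Real.sqrt (2 * s) * (2 * s + y ^ 2) ≤ (2 * Real.sqrt s) * (2 * (s + y ^ 2)) := by
          gcongr; nlinarith [sq_nonneg y]
      _ = _ := by ring
  · refine ContinuousOn.div continuousOn_const (by fun_prop) ?_
    intro s hs
    have : 0 < s := hs
    positivity

end det

end SN

namespace SN
set_option linter.unusedSectionVars false
set_option linter.deprecated false

section helpers
variable {Ω : Type} [mΩ : MeasurableSpace Ω] {Q : Measure Ω} [IsProbabilityMeasure Q]

lemma pull {m : MeasurableSpace Ω} (hm : m ≤ mΩ) {Z f : Ω → ℝ} (hZ : StronglyMeasurable[m] Z)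
    (hf : Integrable f Q) (hZf : Integrable (fun ω => Z ω * f ω) Q) :
    ∫ ω, Z ω * f ω ∂Q = ∫ ω, Z ω * (Q[f|m]) ω ∂Q := by
  have h := condExp_mul_of_stronglyMeasurable_left (μ := Q) (m := m) hZ (g := f) hZf hf
  rw [← integral_condExp hm (f := fun ω => Z ω * f ω)]
  exact integral_congr_ae h

lemma pull_int {m : MeasurableSpace Ω} {Z f : Ω → ℝ} (hZ : StronglyMeasurable[m] Z)
    (hf : Integrable f Q) (hZf : Integrable (fun ω => Z ω * f ω) Q) :
    Integrable (fun ω => Z ω * (Q[f|m]) ω) Q := by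
  have h := condExp_mul_of_stronglyMeasurable_left (μ := Q) (m := m) hZ (g := f) hZf hf
  exact (integrable_condExp (m := m) (f := fun ω => Z ω * f ω)).congr h

lemma bdd_int {Z f : Ω → ℝ} {K : ℝ} (hZ : AEStronglyMeasurable Z Q) (hK : ∀ᵐ ω ∂Q, |Z ω| ≤ K)
    (hf : Integrable f Q) : Integrable (fun ω => Z ω * f ω) Q :=
  hf.bdd_mul hZ hK

lemma int_of_cube {f : Ω → ℝ} (hf : AEStronglyMeasurable f Q) (h3 : Integrable (fun ω => |f ω| ^ 3) Q) :
    MemLp f 2 Q ∧ Integrable f Q ∧ Integrable (fun ω => f ω ^ 2) Q := by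
  have h2 : Integrable (fun ω => f ω ^ 2) Q := by
    refine ((integrable_const (1:ℝ)).add h3).mono' (by fun_prop) (Eventually.of_forall fun ω => ?_)
    have : f ω ^ 2 = |f ω| ^ 2 := (sq_abs _).symm
    rw [Real.norm_eq_abs, abs_of_nonneg (by positivity), this]
    simp only [Pi.add_apply]
    have h0 := abs_nonneg (f ω)
    nlinarith [mul_nonneg h0 (sq_nonneg (|f ω| - 1)), sq_nonneg (|f ω| - 1)]
  have hL := (memLp_two_iff_integrable_sq hf).2 h2
  exact ⟨hL, hL.integrable (by norm_num), h2⟩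
end helpers

/-- Hypotheses for the martingale Berry-Esseen bound. -/
structure BEH {Ω : Type} [mΩ : MeasurableSpace Ω] (Q : Measure Ω) (F : ℕ → MeasurableSpace Ω)
    (ξ v : ℕ → Ω → ℝ) (n : ℕ) (g θ δ : ℝ) : Prop where
  mono : Monotone F
  le : ∀ i, F i ≤ mΩ
  sm : ∀ i, StronglyMeasurable[F (i+1)] (ξ i)
  vsm : ∀ i, StronglyMeasurable[F i] (v i)
  int3 : ∀ i, Integrable (fun ω => |ξ i ω| ^ 3) Q
  mz : ∀ i, Q[ξ i|F i] =ᵐ[Q] 0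
  v0 : ∀ i, ∀ᵐ ω ∂Q, 0 ≤ v i ω
  vg : ∀ i, ∀ᵐ ω ∂Q, v i ω ≤ g ^ 2
  c2 : ∀ i, ∀ᵐ ω ∂Q, |(Q[fun ω' => ξ i ω' ^ 2|F i]) ω - v i ω| ≤ θ * v i ω
  c3 : ∀ i, ∀ᵐ ω ∂Q, (Q[fun ω' => |ξ i ω'| ^ 3|F i]) ω ≤ g * v i ω
  tot : ∀ᵐ ω ∂Q, |∑ i ∈ Finset.range n, v i ω - 1| ≤ δ ^ 2
  g0 : 0 < g
  g1 : g ≤ 1 / 4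
  θ0 : 0 ≤ θ
  θ1 : θ ≤ 1
  δ0 : 0 ≤ δ
  δ1 : δ ≤ 1 / 4

/-- partial sums -/
def ps {Ω : Type} (ξ : ℕ → Ω → ℝ) (k : ℕ) (ω : Ω) : ℝ := ∑ i ∈ Finset.range k, ξ i ω

lemma ps_succ {Ω : Type} (ξ : ℕ → Ω → ℝ) (k : ℕ) (ω : Ω) : ps ξ (k+1) ω = ps ξ k ω + ξ k ω := by
  simp [ps, Finset.sum_range_succ]

lemma ps_zero {Ω : Type} (ξ : ℕ → Ω → ℝ) (ω : Ω) : ps ξ 0 ω = 0 := by simp [ps]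

namespace BEH
variable {Ω : Type} [mΩ : MeasurableSpace Ω] {Q : Measure Ω} [IsProbabilityMeasure Q]
  {F : ℕ → MeasurableSpace Ω} {ξ v : ℕ → Ω → ℝ} {n : ℕ} {g θ δ : ℝ}

lemma neg (h : BEH Q F ξ v n g θ δ) : BEH Q F (fun i ω => - ξ i ω) v n g θ δ where
  mono := h.mono
  le := h.le
  sm := fun i => (h.sm i).neg
  vsm := h.vsm
  int3 := fun i => by simpa using h.int3 i
  mz := fun i => by
    have := condExp_neg (μ := Q) (ξ i) (F i)
    have h2 := h.mz i
    filter_upwards [this, h2] with ω h1 h2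
    have h3 : (Q[-ξ i|F i]) ω = 0 := by rw [h1]; simp [h2]
    exact h3
  v0 := h.v0
  vg := h.vg
  c2 := fun i => by simpa using h.c2 i
  c3 := fun i => by simpa using h.c3 i
  tot := h.tot
  g0 := h.g0
  g1 := h.g1
  θ0 := h.θ0
  θ1 := h.θ1
  δ0 := h.δ0
  δ1 := h.δ1

lemma ps_sm (h : BEH Q F ξ v n g θ δ) {k m : ℕ} (hkm : k ≤ m) : StronglyMeasurable[F m] (ps ξ k) := by
  have e : ps ξ k = ∑ i ∈ Finset.range k, ξ i := by ext ω; simp [ps]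
  rw [e]
  refine Finset.stronglyMeasurable_sum _ fun i hi => ?_
  exact (h.sm i).mono (h.mono (by simp at hi; omega))

lemma vps_sm (h : BEH Q F ξ v n g θ δ) {k m : ℕ} (hkm : k ≤ m + 1) : StronglyMeasurable[F m] (ps v k) := by
  have e : ps v k = ∑ i ∈ Finset.range k, v i := by ext ω; simp [ps]
  rw [e]
  refine Finset.stronglyMeasurable_sum _ fun i hi => ?_
  exact (h.vsm i).mono (h.mono (by simp at hi; omega))

lemma L2 (h : BEH Q F ξ v n g θ δ) (i : ℕ) : MemLp (ξ i) 2 Q ∧ Integrable (ξ i) Q ∧ Integrable (fun ω => ξ i ω ^ 2) Q :=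
  int_of_cube ((h.sm i).mono (h.le _)).aestronglyMeasurable (h.int3 i)

lemma psL2 (h : BEH Q F ξ v n g θ δ) (k : ℕ) : MemLp (ps ξ k) 2 Q := by
  have e : ps ξ k = ∑ i ∈ Finset.range k, ξ i := by ext ω; simp [ps]
  rw [e]
  exact memLp_finset_sum' _ fun i _ => (h.L2 i).1

lemma vint (h : BEH Q F ξ v n g θ δ) (i : ℕ) : Integrable (v i) Q := by
  refine Integrable.of_bound ((h.vsm i).mono (h.le _)).aestronglyMeasurable (g^2) ?_
  filter_upwards [h.v0 i, h.vg i] with ω h1 h2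
  rw [Real.norm_eq_abs, abs_of_nonneg h1]; exact h2

lemma vpsint (h : BEH Q F ξ v n g θ δ) (k : ℕ) : Integrable (ps v k) Q := by
  have e : ps v k = ∑ i ∈ Finset.range k, v i := by ext ω; simp [ps]
  rw [e]
  exact integrable_finset_sum' _ fun i _ => h.vint i

lemma mz_int (h : BEH Q F ξ v n g θ δ) (i : ℕ) {W : Ω → ℝ} (hW : StronglyMeasurable[F i] W)
    (hWξ : Integrable (fun ω => W ω * ξ i ω) Q) : ∫ ω, W ω * ξ i ω ∂Q = 0 := by
  rw [pull (h.le i) hW (h.L2 i).2.1 hWξ]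
  rw [integral_congr_ae (g := fun _ => (0:ℝ))]
  · simp
  · filter_upwards [h.mz i] with ω h1
    rw [h1]; simp

lemma B2 (h : BEH Q F ξ v n g θ δ) {k : ℕ} {Z : Ω → ℝ} {K : ℝ} (hZ : StronglyMeasurable[F k] Z)
    (hZ0 : ∀ᵐ ω ∂Q, 0 ≤ Z ω) (hZK : ∀ᵐ ω ∂Q, Z ω ≤ K) (m : ℕ) (hkm : k ≤ m) :
    ∫ ω, Z ω * (ps ξ m ω - ps ξ k ω) ^ 2 ∂Q ≤ (1 + θ) * ∫ ω, Z ω * (ps v m ω - ps v k ω) ∂Q := by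
  have hZa : AEStronglyMeasurable Z Q := (hZ.mono (h.le _)).aestronglyMeasurable
  have hZb : ∀ᵐ ω ∂Q, |Z ω| ≤ K := by
    filter_upwards [hZ0, hZK] with ω h1 h2; rw [abs_of_nonneg h1]; exact h2
  induction m, hkm using Nat.le_induction with
  | base => simp
  | succ m hkm ih =>
    have hd : MemLp (fun ω => ps ξ m ω - ps ξ k ω) 2 Q := (h.psL2 m).sub (h.psL2 k)
    have i1 : Integrable (fun ω => Z ω * (ps ξ m ω - ps ξ k ω) ^ 2) Q := bdd_int hZa hZb hd.integrable_sq
    have i2' : Integrable (fun ω => (ps ξ m ω - ps ξ k ω) * ξ m ω) Q := hd.integrable_mul (h.L2 m).1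
    have i2 : Integrable (fun ω => Z ω * ((ps ξ m ω - ps ξ k ω) * ξ m ω)) Q := bdd_int hZa hZb i2'
    have i3 : Integrable (fun ω => Z ω * ξ m ω ^ 2) Q := bdd_int hZa hZb (h.L2 m).2.2
    have z2 : ∫ ω, Z ω * ((ps ξ m ω - ps ξ k ω) * ξ m ω) ∂Q = 0 := by
      have : ∀ ω, Z ω * ((ps ξ m ω - ps ξ k ω) * ξ m ω) = (Z ω * (ps ξ m ω - ps ξ k ω)) * ξ m ω := fun ω => by ring
      simp_rw [this] at i2 ⊢
      refine h.mz_int m ?_ i2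
      exact (hZ.mono (h.mono hkm)).mul ((h.ps_sm le_rfl).sub (h.ps_sm hkm))
    have z3 : ∫ ω, Z ω * ξ m ω ^ 2 ∂Q ≤ (1 + θ) * ∫ ω, Z ω * v m ω ∂Q := by
      rw [pull (h.le m) (hZ.mono (h.mono hkm)) (h.L2 m).2.2 i3, ← integral_const_mul]
      refine integral_mono_ae (pull_int (hZ.mono (h.mono hkm)) (h.L2 m).2.2 i3) ((bdd_int hZa hZb (h.vint m)).const_mul _) ?_
      filter_upwards [hZ0, h.c2 m] with ω h1 h2
      have := (le_abs_self _).trans h2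
      nlinarith
    have e1 : ∀ ω, Z ω * (ps ξ (m+1) ω - ps ξ k ω) ^ 2 = Z ω * (ps ξ m ω - ps ξ k ω) ^ 2
        + 2 * (Z ω * ((ps ξ m ω - ps ξ k ω) * ξ m ω)) + Z ω * ξ m ω ^ 2 := fun ω => by rw [ps_succ]; ring
    have e2 : ∀ ω, Z ω * (ps v (m+1) ω - ps v k ω) = Z ω * (ps v m ω - ps v k ω) + Z ω * v m ω :=
      fun ω => by rw [ps_succ]; ring
    simp_rw [e1, e2]
    rw [integral_add (i1.fun_add (i2.const_mul 2)) i3, integral_add i1 (i2.const_mul 2), integral_const_mul, z2,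
      integral_add (bdd_int hZa hZb (f := fun ω => ps v m ω - ps v k ω) ((h.vpsint m).sub (h.vpsint k))) (bdd_int hZa hZb (h.vint m))]
    linarith

end BEH

lemma shift_ineq {s y d : ℝ} (hs : 0 < s) :
    (1 / (s + y ^ 2)) * (9 - d ^ 2 / s) / 50 ≤ 1 / (s + (y + d) ^ 2) := by
  have hA : 0 < s + y ^ 2 := by positivity
  have hB : 0 < s + (y + d) ^ 2 := by positivity
  have e : (1 / (s + y ^ 2)) * (9 - d ^ 2 / s) / 50 = (9 * s - d ^ 2) / (50 * s * (s + y ^ 2)) := by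
    field_simp
  rw [e, div_le_div_iff₀ (by positivity) hB]
  by_cases hc : 9 * s - d ^ 2 ≤ 0
  · nlinarith [mul_pos hs hA]
  push Not at hc
  have h1 : s * (s + (y + d) ^ 2) ≤ 2 * (s + y ^ 2) * (s + d ^ 2) := by
    nlinarith [sq_nonneg (y - d), mul_nonneg hs.le (sq_nonneg (y-d)), sq_nonneg (y * d), mul_pos hs hs]
  have h2 : (9 * s - d ^ 2) * (s + d ^ 2) ≤ 25 * s ^ 2 := by nlinarith [sq_nonneg (d ^ 2 - 4 * s)]
  have h3 : s * ((9 * s - d ^ 2) * (s + (y + d) ^ 2)) ≤ s * (1 * (50 * s * (s + y ^ 2))) := by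
    calc s * ((9 * s - d ^ 2) * (s + (y + d) ^ 2)) = (9 * s - d ^ 2) * (s * (s + (y + d) ^ 2)) := by ring
      _ ≤ (9 * s - d ^ 2) * (2 * (s + y ^ 2) * (s + d ^ 2)) := by gcongr
      _ = 2 * (s + y ^ 2) * ((9 * s - d ^ 2) * (s + d ^ 2)) := by ring
      _ ≤ 2 * (s + y ^ 2) * (25 * s ^ 2) := by gcongr
      _ = _ := by ring
  exact le_of_mul_le_mul_left h3 hs

end SN

namespace SN
set_option linter.unusedSectionVars false
set_option linter.deprecated false

namespace BEH
variable {Ω : Type} [mΩ : MeasurableSpace Ω] {Q : Measure Ω} [IsProbabilityMeasure Q]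
  {F : ℕ → MeasurableSpace Ω} {ξ v : ℕ → Ω → ℝ} {n : ℕ} {g θ δ : ℝ}

/-- the regularised remaining variance -/
def sv (v : ℕ → Ω → ℝ) (δ a : ℝ) (k : ℕ) (ω : Ω) : ℝ := 1 + δ ^ 2 + a ^ 2 - ps v k ω

lemma good (h : BEH Q F ξ v n g θ δ) (a : ℝ) : ∀ᵐ ω ∂Q, (∀ k, 0 ≤ v k ω ∧ v k ω ≤ g ^ 2) ∧
    (∀ k, k ≤ n → a ^ 2 ≤ sv v δ a k ω ∧ sv v δ a k ω ≤ 1 + δ ^ 2 + a ^ 2) ∧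
    (∀ k, sv v δ a k ω = sv v δ a (k+1) ω + v k ω) ∧
    sv v δ a n ω ≤ a ^ 2 + 2 * δ ^ 2 ∧ (∀ k, k < n → ps v n ω - ps v k ω ≤ sv v δ a (k+1) ω - a ^ 2 + g ^ 2) := by
  have h1 := ae_all_iff.2 h.v0
  have h2 := ae_all_iff.2 h.vg
  filter_upwards [h1, h2, h.tot] with ω h1 h2 h3
  have hV : |ps v n ω - 1| ≤ δ ^ 2 := h3
  rw [abs_le] at hV
  have hm : ∀ k, k ≤ n → ps v k ω ≤ ps v n ω := by
    intro k hk
    unfold ps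
    exact Finset.sum_le_sum_of_subset_of_nonneg (by intro i; simp; omega) (fun i _ _ => h1 i)
  have h0 : ∀ k, 0 ≤ ps v k ω := fun k => Finset.sum_nonneg fun i _ => h1 i
  refine ⟨fun k => ⟨h1 k, h2 k⟩, fun k hk => ⟨?_, ?_⟩, fun k => ?_, ?_, fun k hk => ?_⟩
  · unfold sv; linarith [hm k hk]
  · unfold sv; linarith [h0 k]
  · unfold sv; rw [ps_succ]; ring
  · unfold sv; linarith
  · unfold sv; rw [ps_succ]; linarith [h2 k]

lemma sv_sm (h : BEH Q F ξ v n g θ δ) (a : ℝ) (k : ℕ) : Measurable[F k] (sv v δ a (k+1)) :=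
  (h.vps_sm (k := k+1) (m := k) le_rfl).measurable.const_sub _

lemma sv_m (h : BEH Q F ξ v n g θ δ) (a : ℝ) (k : ℕ) : Measurable (sv v δ a k) :=
  ((h.vps_sm (k := k) (m := k) (by omega)).measurable.const_sub _).mono (h.le k) le_rfl

lemma psm (h : BEH Q F ξ v n g θ δ) (k : ℕ) : Measurable (ps ξ k) :=
  (h.ps_sm (le_refl k)).measurable.mono (h.le k) le_rfl

lemma bound_int {f : Ω → ℝ} {K : ℝ} (hf : Measurable f) (hK : ∀ᵐ ω ∂Q, |f ω| ≤ K) : Integrable f Q :=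
  Integrable.of_bound hf.aestronglyMeasurable K hK

lemma abs_int_le {f g : Ω → ℝ} (hg : Integrable g Q) (h : ∀ᵐ ω ∂Q, |f ω| ≤ g ω) : |∫ ω, f ω ∂Q| ≤ ∫ ω, g ω ∂Q :=
  by
  rw [← Real.norm_eq_abs]
  exact norm_integral_le_of_norm_le hg (by simpa using h)

lemma isub {f g : Ω → ℝ} (hf : Integrable f Q) (hg : Integrable g Q) : Integrable (fun ω => f ω - g ω) Q := hf.sub hg

lemma B3 (h : BEH Q F ξ v n g θ δ) {a : ℝ} (hga : g ≤ a) (u : ℝ) {k : ℕ} (hk : k < n) {Z : Ω → ℝ} {K : ℝ}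
    (hZ : Measurable[F k] Z) (hZ0 : ∀ᵐ ω ∂Q, 0 ≤ Z ω) (hZK : ∀ᵐ ω ∂Q, Z ω ≤ K) :
    ∫ ω, Z ω / (sv v δ a (k+1) ω + (ps ξ k ω - u) ^ 2) ∂Q ≤
      8 * ∫ ω, Z ω / (sv v δ a (k+1) ω + (ps ξ n ω - u) ^ 2) ∂Q := by
  have ha : 0 < a := h.g0.trans_le hga
  have hZm : Measurable Z := hZ.mono (h.le k) le_rfl
  have hG := h.good a
  set s := sv v δ a (k+1) with hs
  have hsm : Measurable s := h.sv_m a (k+1)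
  have bd : ∀ y : Ω → ℝ, ∀ᵐ ω ∂Q, 0 ≤ Z ω / (s ω + y ω ^ 2) ∧ Z ω / (s ω + y ω ^ 2) ≤ K / a ^ 2 := by
    intro y
    filter_upwards [hZ0, hZK, hG] with ω h1 h2 h3
    have := (h3.2.1 (k+1) hk).1
    have : a ^ 2 ≤ s ω + y ω ^ 2 := by nlinarith [sq_nonneg (y ω)]
    constructor
    · have : 0 < s ω + y ω ^ 2 := by nlinarith
      positivity
    · have hK : 0 ≤ K := h1.trans h2
      gcongr
  have bd' : ∀ y : Ω → ℝ, ∀ᵐ ω ∂Q, |Z ω / (s ω + y ω ^ 2)| ≤ K / a ^ 2 := fun y => by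
    filter_upwards [bd y] with ω h1; rw [abs_of_nonneg h1.1]; exact h1.2
  set Z' : Ω → ℝ := fun ω => Z ω / (s ω + (ps ξ k ω - u) ^ 2) with hZ'
  have pk := h.psm k
  have pn := h.psm n
  have iZ' : Integrable Z' Q := bound_int (K := K / a ^ 2) (by simp only [hZ']; fun_prop) (bd' _)
  have iN : Integrable (fun ω => Z ω / (s ω + (ps ξ n ω - u) ^ 2)) Q := bound_int (K := K / a ^ 2) (by fun_prop) (bd' _)
  have hZ's : Measurable[F k] (fun ω => Z' ω / s ω) :=
    (hZ.div ((h.sv_sm a k).add (((h.ps_sm (le_refl k)).measurable.sub_const u).pow_const 2))).div (h.sv_sm a k)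
  have hb2 : ∀ᵐ ω ∂Q, 0 ≤ Z' ω / s ω ∧ Z' ω / s ω ≤ K / a ^ 2 / a ^ 2 := by
    filter_upwards [bd (fun ω => ps ξ k ω - u), hG] with ω h1 h3
    have h4 := (h3.2.1 (k+1) hk).1
    have : 0 < s ω := by have := pow_pos ha 2; linarith
    exact ⟨div_nonneg h1.1 this.le, by have := h1.1.trans h1.2; exact div_le_div₀ this h1.2 (by positivity) h4⟩
  have b2 := h.B2 (K := K / a ^ 2 / a ^ 2) hZ's.stronglyMeasurable (hb2.mono fun ω h => h.1) (hb2.mono fun ω h => h.2) n hk.le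
  have hb2' : ∀ᵐ ω ∂Q, |Z' ω / s ω| ≤ K / a ^ 2 / a ^ 2 := by
    filter_upwards [hb2] with ω h1; rw [abs_of_nonneg h1.1]; exact h1.2
  have hm2 : AEStronglyMeasurable (fun ω => Z' ω / s ω) Q := (hZ's.mono (h.le k) le_rfl).aestronglyMeasurable
  have b3 : ∫ ω, Z' ω / s ω * (ps v n ω - ps v k ω) ∂Q ≤ ∫ ω, Z' ω ∂Q := by
    refine integral_mono_ae (bdd_int hm2 hb2' ((h.vpsint n).sub (h.vpsint k))) iZ' ?_
    filter_upwards [hb2, hG] with ω h1 h3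
    have h4 := (h3.2.1 (k+1) hk).1
    have hs0 : 0 < s ω := by have := pow_pos ha 2; linarith
    have h5 := h3.2.2.2.2 k hk
    have : ps v n ω - ps v k ω ≤ s ω := by
      have := h.g0
      have : g ^ 2 ≤ a ^ 2 := by gcongr
      linarith
    calc Z' ω / s ω * (ps v n ω - ps v k ω) ≤ Z' ω / s ω * s ω := by
          have := h1.1; gcongr
      _ = Z' ω := by field_simp
  have iZ0 : 0 ≤ ∫ ω, Z' ω ∂Q := integral_nonneg_of_ae ((bd (fun ω => ps ξ k ω - u)).mono fun ω h => h.1)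
  have b4 : ∫ ω, Z' ω / s ω * (ps ξ n ω - ps ξ k ω) ^ 2 ∂Q ≤ 2 * ∫ ω, Z' ω ∂Q := by
    refine b2.trans ?_
    have := h.θ0; have := h.θ1
    nlinarith
  have i4 : Integrable (fun ω => Z' ω / s ω * (ps ξ n ω - ps ξ k ω) ^ 2) Q :=
    bdd_int hm2 hb2' (((h.psL2 n).sub (h.psL2 k)).integrable_sq)
  have b5 : ∫ ω, (9 / 50 * Z' ω - 1 / 50 * (Z' ω / s ω * (ps ξ n ω - ps ξ k ω) ^ 2)) ∂Q ≤
      ∫ ω, Z ω / (s ω + (ps ξ n ω - u) ^ 2) ∂Q := by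
    refine integral_mono_ae ((iZ'.const_mul _).sub (i4.const_mul _)) iN ?_
    filter_upwards [hZ0, hG] with ω h1 h3
    have h4 := (h3.2.1 (k+1) hk).1
    have hs0 : 0 < s ω := by have := pow_pos ha 2; linarith
    have h5 := shift_ineq (y := ps ξ k ω - u) (d := ps ξ n ω - ps ξ k ω) hs0
    have e : ps ξ k ω - u + (ps ξ n ω - ps ξ k ω) = ps ξ n ω - u := by ring
    rw [e] at h5
    have h6 := mul_le_mul_of_nonneg_left h5 h1
    have hp : 0 < s ω + (ps ξ k ω - u) ^ 2 := by positivity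
    calc 9 / 50 * Z' ω - 1 / 50 * (Z' ω / s ω * (ps ξ n ω - ps ξ k ω) ^ 2)
        = Z ω * (1 / (s ω + (ps ξ k ω - u) ^ 2) * (9 - (ps ξ n ω - ps ξ k ω) ^ 2 / s ω) / 50) := by
          simp only [hZ']; field_simp
      _ ≤ _ := h6
      _ = _ := by ring
  rw [integral_sub (iZ'.const_mul _) (i4.const_mul _), integral_const_mul, integral_const_mul] at b5
  linarith

/-- One Lindeberg step. -/
lemma lind_step (h : BEH Q F ξ v n g θ δ) {a : ℝ} (hga : g ≤ a) (u : ℝ) {k : ℕ} (hk : k < n) :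
    |∫ ω, Ph ((ps ξ (k+1) ω - u) / Real.sqrt (sv v δ a (k+1) ω)) ∂Q -
      ∫ ω, Ph ((ps ξ k ω - u) / Real.sqrt (sv v δ a k ω)) ∂Q| ≤
    ∫ ω, v k ω * (5000 * θ + 70000 * g / Real.sqrt (sv v δ a (k+1) ω)) / (sv v δ a (k+1) ω + (ps ξ k ω - u) ^ 2) ∂Q := by
  have ha : 0 < a := h.g0.trans_le hga
  have hG := h.good a
  set s := sv v δ a (k+1) with hs
  have hsm : Measurable s := h.sv_m a (k+1)
  have hsF : Measurable[F k] s := h.sv_sm a k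
  have pk := h.psm k
  have pn := h.psm (k+1)
  have Phm : Measurable Ph := Ph_mono.measurable
  have hξm : Measurable (ξ k) := (h.sm k).measurable.mono (h.le _) le_rfl
  have hvm : Measurable (v k) := (h.vsm k).measurable.mono (h.le _) le_rfl
  have hyF : Measurable[F k] (fun ω => ps ξ k ω - u) := (h.ps_sm (le_refl k)).measurable.sub_const u
  set y : Ω → ℝ := fun ω => ps ξ k ω - u with hy
  have hym : Measurable y := hyF.mono (h.le k) le_rfl
  have phim : Measurable phi := phi_cont.measurable
  have hGF : Measurable[F k] (fun ω => G1 (s ω) (y ω)) := by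
    unfold G1
    exact (phim.comp (hyF.div hsF.sqrt)).div hsF.sqrt
  have hHF : Measurable[F k] (fun ω => H1 (s ω) (y ω)) := by
    unfold H1
    exact (((hyF.div hsF.sqrt).neg).mul (phim.comp (hyF.div hsF.sqrt))).div hsF
  have hgood : ∀ᵐ ω ∂Q, 0 < s ω ∧ a ^ 2 ≤ s ω ∧ 0 ≤ v k ω ∧ v k ω ≤ s ω ∧ v k ω ≤ g ^ 2 ∧ sv v δ a k ω = s ω + v k ω ∧ a ≤ Real.sqrt (s ω) := by
    filter_upwards [hG] with ω h3
    have h4 := (h3.2.1 (k+1) hk).1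
    have h5 := h3.1 k
    have := h.g0
    have : g ^ 2 ≤ a ^ 2 := by gcongr
    have hp := pow_pos ha 2
    refine ⟨by linarith, h4, h5.1, by linarith [h5.2], h5.2, h3.2.2.1 k, ?_⟩
    exact Real.le_sqrt_of_sq_le h4
  have hGb : ∀ᵐ ω ∂Q, |G1 (s ω) (y ω)| ≤ 1 / a := by
    filter_upwards [hgood] with ω h1
    refine (G1_bound _).trans ?_
    exact one_div_le_one_div_of_le ha h1.2.2.2.2.2.2
  have hHb : ∀ᵐ ω ∂Q, |H1 (s ω) (y ω)| ≤ 10000 / a ^ 2 := by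
    filter_upwards [hgood] with ω h1
    refine (H1_bound h1.1 _).trans ?_
    have := h1.2.1
    have := pow_pos ha 2
    gcongr
    nlinarith [sq_nonneg (y ω)]
  have hGa : AEStronglyMeasurable (fun ω => G1 (s ω) (y ω)) Q := (hGF.mono (h.le k) le_rfl).aestronglyMeasurable
  have hHa : AEStronglyMeasurable (fun ω => H1 (s ω) (y ω)) Q := (hHF.mono (h.le k) le_rfl).aestronglyMeasurable
  -- integrability
  have iA : Integrable (fun ω => Ph ((ps ξ (k+1) ω - u) / Real.sqrt (s ω))) Q :=
    bound_int (K := 1) (by fun_prop) (Eventually.of_forall fun ω => by rw [abs_of_nonneg (Ph_nonneg _)]; exact Ph_le_one _)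
  have hskm := h.sv_m a k
  have iB : Integrable (fun ω => Ph ((ps ξ k ω - u) / Real.sqrt (sv v δ a k ω))) Q :=
    bound_int (K := 1) (by fun_prop) (Eventually.of_forall fun ω => by rw [abs_of_nonneg (Ph_nonneg _)]; exact Ph_le_one _)
  have iG : Integrable (fun ω => G1 (s ω) (y ω) * ξ k ω) Q := bdd_int hGa hGb (h.L2 k).2.1
  have zG : ∫ ω, G1 (s ω) (y ω) * ξ k ω ∂Q = 0 := h.mz_int k hGF.stronglyMeasurable iG
  have iH1 : Integrable (fun ω => H1 (s ω) (y ω) * ξ k ω ^ 2) Q := bdd_int hHa hHb (h.L2 k).2.2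
  have iH2 : Integrable (fun ω => H1 (s ω) (y ω) * v k ω) Q := bdd_int hHa hHb (h.vint k)
  have iH : Integrable (fun ω => H1 (s ω) (y ω) * (ξ k ω ^ 2 - v k ω) / 2) Q := by
    refine ((iH1.sub iH2).div_const 2).congr (Eventually.of_forall fun ω => ?_)
    simp only [Pi.sub_apply]; ring
  have iT : Integrable (fun ω => v k ω * θ / (s ω + y ω ^ 2)) Q := by
    refine bound_int (K := g ^ 2 * 1 / a ^ 2) (by fun_prop) ?_
    filter_upwards [hgood] with ω h1
    have h2 := h1.2.2.1; have h3 := h.θ0; have h4 := h.θ1; have h5 := h1.1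
    rw [abs_of_nonneg (by positivity)]
    have := h1.2.2.2.2.1; have h6 := h1.2.1
    gcongr
    nlinarith [sq_nonneg (y ω)]
  have zH : |∫ ω, H1 (s ω) (y ω) * (ξ k ω ^ 2 - v k ω) / 2 ∂Q| ≤ ∫ ω, 5000 * (v k ω * θ / (s ω + y ω ^ 2)) ∂Q := by
    have e : ∫ ω, H1 (s ω) (y ω) * (ξ k ω ^ 2 - v k ω) / 2 ∂Q =
        ∫ ω, H1 (s ω) (y ω) * ((Q[fun ω' => ξ k ω' ^ 2|F k]) ω - v k ω) / 2 ∂Q := by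
      have e1 : ∀ ω, H1 (s ω) (y ω) * (ξ k ω ^ 2 - v k ω) / 2 = (H1 (s ω) (y ω) * ξ k ω ^ 2 - H1 (s ω) (y ω) * v k ω) / 2 :=
        fun ω => by ring
      have e2 : ∀ ω, H1 (s ω) (y ω) * ((Q[fun ω' => ξ k ω' ^ 2|F k]) ω - v k ω) / 2 =
        (H1 (s ω) (y ω) * (Q[fun ω' => ξ k ω' ^ 2|F k]) ω - H1 (s ω) (y ω) * v k ω) / 2 :=
        fun ω => by ring
      simp_rw [e1, e2]
      rw [integral_div, integral_div, integral_sub iH1 iH2, integral_sub (pull_int hHF.stronglyMeasurable (h.L2 k).2.2 iH1) iH2,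
        pull (h.le k) hHF.stronglyMeasurable (h.L2 k).2.2 iH1]
    rw [e]
    refine abs_int_le (iT.const_mul _) ?_
    filter_upwards [hgood, h.c2 k] with ω h1 h2
    rw [abs_div, abs_mul]
    have h3 := H1_bound h1.1 (y ω)
    have h5 := h1.1
    calc _ ≤ (10000 / (s ω + y ω ^ 2)) * (θ * v k ω) / |(2:ℝ)| := by gcongr
      _ = _ := by rw [abs_of_pos (by norm_num : (0:ℝ) < 2)]; ring
  -- remainder
  set c : Ω → ℝ := fun ω => 50000 / (Real.sqrt (s ω) * (s ω + y ω ^ 2)) with hc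
  have hcF : Measurable[F k] c := measurable_const.div (hsF.sqrt.mul (hsF.add (hyF.pow_const 2)))
  have hcb : ∀ᵐ ω ∂Q, 0 ≤ c ω ∧ c ω ≤ 50000 / (a * a ^ 2) := by
    filter_upwards [hgood] with ω h1
    have h5 := h1.1; have h6 := h1.2.1; have h7 := h1.2.2.2.2.2.2
    refine ⟨by positivity, ?_⟩
    simp only [hc]
    gcongr
    nlinarith [sq_nonneg (y ω)]
  have hcb' : ∀ᵐ ω ∂Q, |c ω| ≤ 50000 / (a * a ^ 2) := by
    filter_upwards [hcb] with ω h1; rw [abs_of_nonneg h1.1]; exact h1.2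
  have hca : AEStronglyMeasurable c Q := (hcF.mono (h.le k) le_rfl).aestronglyMeasurable
  have iC : Integrable (fun ω => c ω * |ξ k ω| ^ 3) Q := bdd_int hca hcb' (h.int3 k)
  have iCv : Integrable (fun ω => c ω * (g * v k ω)) Q := bdd_int hca hcb' ((h.vint k).const_mul g)
  have zC : ∫ ω, c ω * |ξ k ω| ^ 3 ∂Q ≤ ∫ ω, c ω * (g * v k ω) ∂Q := by
    rw [pull (h.le k) hcF.stronglyMeasurable (h.int3 k) iC]
    refine integral_mono_ae (pull_int hcF.stronglyMeasurable (h.int3 k) iC) iCv ?_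
    filter_upwards [hcb, h.c3 k] with ω h1 h2
    exact mul_le_mul_of_nonneg_left h2 h1.1
  have hvc : ∀ᵐ ω ∂Q, 20000 * v k ω ^ 2 / (s ω * (s ω + y ω ^ 2)) ≤ 2 / 5 * (c ω * (g * v k ω)) := by
    filter_upwards [hgood] with ω h1
    have h5 := h1.1; have h6 := h1.2.1; have h7 := h1.2.2.2.2.2.2
    have h8 := h1.2.2.1; have h9 := h1.2.2.2.2.1
    have hq : 0 < Real.sqrt (s ω) := Real.sqrt_pos.2 h5
    have hg0 := h.g0
    have e1 : 2 / 5 * (c ω * (g * v k ω)) = 20000 * (v k ω * (g * Real.sqrt (s ω))) / (s ω * (s ω + y ω ^ 2)) := by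
      simp only [hc]
      have : s ω = Real.sqrt (s ω) * Real.sqrt (s ω) := (Real.mul_self_sqrt h5.le).symm
      have hA : 0 < s ω + y ω ^ 2 := by positivity
      rw [div_mul_eq_mul_div (50000:ℝ), ← mul_div_assoc, div_eq_div_iff (by positivity) (by positivity)]
      generalize s ω + y ω ^ 2 = A at *
      generalize Real.sqrt (s ω) = q at *
      rw [this]
      ring
    rw [e1]
    gcongr
    rw [sq]
    gcongr
    calc v k ω ≤ g * g := by nlinarith
      _ ≤ _ := by gcongr; linarith
  have hrem : |∫ ω, (Ph ((ps ξ (k+1) ω - u) / Real.sqrt (s ω)) - Ph ((ps ξ k ω - u) / Real.sqrt (sv v δ a k ω))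
      - G1 (s ω) (y ω) * ξ k ω - H1 (s ω) (y ω) * (ξ k ω ^ 2 - v k ω) / 2) ∂Q| ≤
      ∫ ω, (c ω * |ξ k ω| ^ 3 + 2 / 5 * (c ω * (g * v k ω))) ∂Q := by
    refine abs_int_le (iC.fun_add (iCv.const_mul _)) ?_
    filter_upwards [hgood, hvc] with ω h1 h2
    have h3 := step_bound (y := y ω) (ξ := ξ k ω) h1.1 h1.2.2.1 h1.2.2.2.1
    have e : y ω + ξ k ω = ps ξ (k+1) ω - u := by rw [ps_succ]; simp only [hy]; ring
    rw [e] at h3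
    rw [h1.2.2.2.2.2.1]
    refine h3.trans ?_
    have e3 : 50000 * |ξ k ω| ^ 3 / (Real.sqrt (s ω) * (s ω + y ω ^ 2)) = c ω * |ξ k ω| ^ 3 := by
      simp only [hc]; ring
    rw [e3]; linarith
  rw [integral_sub (isub (isub iA iB) iG) iH, integral_sub (isub iA iB) iG, integral_sub iA iB, zG,
    integral_add iC (iCv.const_mul _), integral_const_mul] at hrem
  have fin : ∫ ω, v k ω * (5000 * θ + 70000 * g / Real.sqrt (s ω)) / (s ω + (ps ξ k ω - u) ^ 2) ∂Q =
      ∫ ω, 5000 * (v k ω * θ / (s ω + y ω ^ 2)) ∂Q + 7 / 5 * ∫ ω, c ω * (g * v k ω) ∂Q := by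
    rw [← integral_const_mul, ← integral_add (iT.const_mul _) (iCv.const_mul _)]
    refine integral_congr_ae ?_
    filter_upwards [hgood] with ω h1
    have h5 := h1.1
    have hq : 0 < Real.sqrt (s ω) := Real.sqrt_pos.2 h5
    have hA : 0 < s ω + y ω ^ 2 := by positivity
    have : ps ξ k ω - u = y ω := rfl
    rw [this]
    simp only [hc]
    field_simp
    ring
  rw [fin]
  rw [abs_le] at *
  constructor <;> linarith [hrem.1, hrem.2, zH.1, zH.2]

end BEH
end SN

namespace SN
set_option linter.unusedSectionVars false
set_option linter.deprecated false

lemma detI1 {p q D : ℝ} (hp : 0 < p) (hpq : p ≤ q) :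
    ∫ t in p..q, 1 * (4 * Real.sqrt t + 2 * D) / t = 8 * Real.sqrt q - 8 * Real.sqrt p + 2 * D * Real.log (q / p) := by
  have hq : 0 < q := hp.trans_le hpq
  have hpos : ∀ t ∈ Set.uIcc p q, 0 < t := fun t ht => by
    rw [Set.uIcc_of_le hpq] at ht; exact hp.trans_le ht.1
  have := intervalIntegral.integral_eq_sub_of_hasDerivAt (a := p) (b := q)
    (f := fun t => 8 * Real.sqrt t + 2 * D * Real.log t) (f' := fun t => 1 * (4 * Real.sqrt t + 2 * D) / t) ?_ ?_
  · rw [this, Real.log_div hq.ne' hp.ne']; ring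
  · intro t ht
    have ht := hpos t ht
    have h1 := ((Real.hasDerivAt_sqrt ht.ne').const_mul 8).add ((Real.hasDerivAt_log ht.ne').const_mul (2 * D))
    refine h1.congr_deriv ?_
    have hs : 0 < Real.sqrt t := Real.sqrt_pos.2 ht
    have e : t = Real.sqrt t * Real.sqrt t := (Real.mul_self_sqrt ht.le).symm
    generalize Real.sqrt t = r at *
    rw [e]; field_simp; ring
  · refine ContinuousOn.intervalIntegrable ?_
    refine ContinuousOn.div (by fun_prop) (by fun_prop) fun t ht => (hpos t ht).ne'

lemma detI2 {p q D : ℝ} (hp : 0 < p) (hpq : p ≤ q) :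
    ∫ t in p..q, (1 / Real.sqrt t) * (4 * Real.sqrt t + 2 * D) / t =
      4 * Real.log (q / p) - 4 * D / Real.sqrt q + 4 * D / Real.sqrt p := by
  have hq : 0 < q := hp.trans_le hpq
  have hpos : ∀ t ∈ Set.uIcc p q, 0 < t := fun t ht => by
    rw [Set.uIcc_of_le hpq] at ht; exact hp.trans_le ht.1
  have := intervalIntegral.integral_eq_sub_of_hasDerivAt (a := p) (b := q)
    (f := fun t => 4 * Real.log t - 4 * D * (Real.sqrt t)⁻¹) (f' := fun t => (1 / Real.sqrt t) * (4 * Real.sqrt t + 2 * D) / t) ?_ ?_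
  · rw [this, Real.log_div hq.ne' hp.ne']; ring
  · intro t ht
    have ht := hpos t ht
    have hs : 0 < Real.sqrt t := Real.sqrt_pos.2 ht
    have h1 := ((Real.hasDerivAt_log ht.ne').const_mul 4).sub (((Real.hasDerivAt_sqrt ht.ne').inv hs.ne').const_mul (4 * D))
    refine h1.congr_deriv ?_
    have e : t = Real.sqrt t * Real.sqrt t := (Real.mul_self_sqrt ht.le).symm
    generalize Real.sqrt t = r at *
    rw [e]; field_simp; ring
  · refine ContinuousOn.intervalIntegrable ?_
    refine ContinuousOn.div (ContinuousOn.mul (ContinuousOn.div (by fun_prop) (by fun_prop) fun t ht => (Real.sqrt_pos.2 (hpos t ht)).ne') (by fun_prop)) (by fun_prop) fun t ht => (hpos t ht).ne'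

section
variable {Ω : Type} [mΩ : MeasurableSpace Ω] {Q : Measure Ω} [IsProbabilityMeasure Q]

lemma fub {Y : Ω → ℝ} (hY : Measurable Y) {D : ℝ} (h : Valid Q Y D) (u : ℝ) {p q M : ℝ} (hp : 0 < p) (hpq : p ≤ q)
    {w : ℝ → ℝ} (hw : Measurable w) (hw0 : ∀ t, p ≤ t → 0 ≤ w t) (hwM : ∀ t, p ≤ t → w t ≤ M)
    (hwc : ContinuousOn w (Set.Icc p q)) :
    Integrable (fun ω => ∫ t in p..q, w t * (1 / (t + (Y ω - u) ^ 2))) Q ∧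
    ∫ ω, (∫ t in p..q, w t * (1 / (t + (Y ω - u) ^ 2))) ∂Q ≤ ∫ t in p..q, w t * (4 * Real.sqrt t + 2 * D) / t := by
  have hI : Set.uIoc p q = Set.Ioc p q := Set.uIoc_of_le hpq
  haveI : IsFiniteMeasure (volume.restrict (Set.uIoc p q)) := ⟨by rw [hI]; simp⟩
  have hInt0 : Integrable (Function.uncurry fun t ω => w t * (1 / (t + (Y ω - u) ^ 2)))
      ((volume.restrict (Set.uIoc p q)).prod Q) := by
    refine Integrable.of_bound (C := M * (1 / p)) ?_ ?_
    · refine Measurable.aestronglyMeasurable ?_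
      simp only [Function.uncurry_def]
      fun_prop
    · have : ∀ᵐ z ∂((volume.restrict (Set.uIoc p q)).prod Q), p ≤ z.1 := by
        have h1 : ∀ᵐ t ∂(volume.restrict (Set.uIoc p q)), p ≤ t := by
          rw [hI]
          filter_upwards [ae_restrict_mem measurableSet_Ioc] with t ht using ht.1.le
        exact Measure.quasiMeasurePreserving_fst.ae h1
      filter_upwards [this] with z hz
      simp only [Function.uncurry_def]
      have h1 := hw0 _ hz; have h2 := hwM _ hz
      have hz0 : 0 < z.1 := hp.trans_le hz
      rw [Real.norm_eq_abs, abs_of_nonneg (by positivity)]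
      have : 0 ≤ M := h1.trans h2
      gcongr
      nlinarith [sq_nonneg (Y z.2 - u)]
  have hInt2 := hInt0.integral_prod_right
  refine ⟨?_, ?_⟩
  · refine hInt2.congr (Eventually.of_forall fun ω => ?_)
    simp only [Function.uncurry_def]
    rw [intervalIntegral.integral_of_le hpq, hI]
  rw [← intervalIntegral_integral_swap hInt0]
  refine intervalIntegral.integral_mono_on hpq ?_ ?_ ?_
  · have := hInt0.integral_prod_left
    rw [intervalIntegrable_iff]
    exact this
  · refine ContinuousOn.intervalIntegrable ?_
    rw [Set.uIcc_of_le hpq]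
    exact (hwc.mul (by fun_prop)).div (by fun_prop) fun t ht => (hp.trans_le ht.1).ne'
  · intro t ht
    have ht0 : 0 < t := hp.trans_le ht.1
    have hc := conc hY h u (R := Real.sqrt t) (Real.sqrt_pos.2 ht0)
    rw [Real.sq_sqrt ht0.le] at hc
    rw [integral_const_mul, mul_div_assoc]
    refine mul_le_mul_of_nonneg_left ?_ (hw0 t ht.1)
    rw [le_div_iff₀ ht0, mul_comm, ← integral_const_mul]
    refine le_trans (le_of_eq ?_) hc
    congr 1; ext ω; ring
end

namespace BEH
variable {Ω : Type} [mΩ : MeasurableSpace Ω] {Q : Measure Ω} [IsProbabilityMeasure Q]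
  {F : ℕ → MeasurableSpace Ω} {ξ v : ℕ → Ω → ℝ} {n : ℕ} {g θ δ : ℝ}

lemma lind (h : BEH Q F ξ v n g θ δ) {a : ℝ} (hga : g ≤ a) (u : ℝ) {D : ℝ} (hV : Valid Q (ps ξ n) D) (hD : 0 ≤ D) :
    |∫ ω, Ph ((ps ξ n ω - u) / Real.sqrt (sv v δ a n ω)) ∂Q - Ph (-u / Real.sqrt (1 + δ ^ 2 + a ^ 2))| ≤
    32 * (5000 * θ * (8 * Real.sqrt (1 + δ ^ 2 + a ^ 2) + 2 * D * Real.log ((1 + δ ^ 2 + a ^ 2) / a ^ 2)) +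
      70000 * g * (4 * Real.log ((1 + δ ^ 2 + a ^ 2) / a ^ 2) + 4 * D / a)) := by
  have ha : 0 < a := h.g0.trans_le hga
  have hG := h.good a
  have pn := h.psm n
  set A := 1 + δ ^ 2 + a ^ 2 with hA
  have ha2 : 0 < a ^ 2 := by positivity
  have hg0 := h.g0
  have hg2 : g ^ 2 ≤ a ^ 2 := by gcongr
  have haA : a ^ 2 ≤ A := by rw [hA]; nlinarith [sq_nonneg δ]
  set f : ℕ → ℝ := fun k => ∫ ω, Ph ((ps ξ k ω - u) / Real.sqrt (sv v δ a k ω)) ∂Q with hf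
  have hf0 : f 0 = Ph (-u / Real.sqrt A) := by
    simp [hf, ps_zero, sv, hA]
  set e : ℕ → Ω → ℝ := fun k ω => v k ω * (5000 * θ + 70000 * g / Real.sqrt (sv v δ a (k+1) ω)) / (sv v δ a (k+1) ω + (ps ξ n ω - u) ^ 2) with he
  have hZ : ∀ k, k < n → ∀ᵐ ω ∂Q, 0 ≤ v k ω * (5000 * θ + 70000 * g / Real.sqrt (sv v δ a (k+1) ω)) ∧
      v k ω * (5000 * θ + 70000 * g / Real.sqrt (sv v δ a (k+1) ω)) ≤ g ^ 2 * (5000 * 1 + 70000 * g / a) := by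
    intro k hk
    filter_upwards [hG] with ω h3
    have h4 := (h3.2.1 (k+1) hk).1
    have h5 := h3.1 k
    have h6 : a ≤ Real.sqrt (sv v δ a (k+1) ω) := Real.le_sqrt_of_sq_le h4
    have h7 := h5.1; have h8 := h5.2; have h9 := h.θ0; have h10 := h.θ1
    refine ⟨by positivity, by gcongr⟩
  have hsm : ∀ k, Measurable (sv v δ a k) := fun k => h.sv_m a k
  have hvm : ∀ k, Measurable (v k) := fun k => (h.vsm k).measurable.mono (h.le _) le_rfl
  have ei : ∀ k, k < n → Integrable (e k) Q := by
    intro k hk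
    have := hsm (k+1); have := hvm k
    refine bound_int (K := g ^ 2 * (5000 * 1 + 70000 * g / a) / a ^ 2) (by simp only [he]; fun_prop) ?_
    filter_upwards [hZ k hk, hG] with ω h1 h3
    have h4 := (h3.2.1 (k+1) hk).1
    have h5 : a ^ 2 ≤ sv v δ a (k+1) ω + (ps ξ n ω - u) ^ 2 := by nlinarith [sq_nonneg (ps ξ n ω - u)]
    rw [abs_of_nonneg (div_nonneg h1.1 (by linarith))]
    exact div_le_div₀ (h1.1.trans h1.2) h1.2 ha2 h5
  have hstep : ∀ k, k < n → |f (k+1) - f k| ≤ 8 * ∫ ω, e k ω ∂Q := by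
    intro k hk
    refine (h.lind_step hga u hk).trans ?_
    refine h.B3 (K := g ^ 2 * (5000 * 1 + 70000 * g / a)) hga u hk ?_ ((hZ k hk).mono fun _ h => h.1) ((hZ k hk).mono fun _ h => h.2)
    exact (h.vsm k).measurable.mul ((measurable_const.div (h.sv_sm a k).sqrt).const_add _)
  have htel : |f n - f 0| ≤ 8 * ∫ ω, ∑ k ∈ Finset.range n, e k ω ∂Q := by
    rw [integral_finset_sum _ (fun k hk => ei k (by simpa using hk)), Finset.mul_sum, ← Finset.sum_range_sub f n]
    refine (Finset.abs_sum_le_sum_abs _ _).trans (Finset.sum_le_sum fun k hk => hstep k (by simpa using hk))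
  obtain ⟨j1, b1⟩ := fub pn hV u (M := 1) ha2 haA (w := fun _ => 1) measurable_const (fun _ _ => zero_le_one) (fun _ _ => le_rfl) continuousOn_const
  obtain ⟨j2, b2⟩ := fub pn hV u (M := 1 / a) ha2 haA (w := fun t => 1 / Real.sqrt t) (by fun_prop) (fun t ht => by positivity)
    (fun t ht => by
      have : a ≤ Real.sqrt t := Real.le_sqrt_of_sq_le ht
      gcongr)
    (ContinuousOn.div (by fun_prop) (by fun_prop) fun t ht => (Real.sqrt_pos.2 (ha2.trans_le ht.1)).ne')
  rw [detI1 ha2 haA] at b1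
  rw [detI2 ha2 haA] at b2
  rw [Real.sqrt_sq ha.le] at b1 b2
  have hsum : ∫ ω, ∑ k ∈ Finset.range n, e k ω ∂Q ≤ ∫ ω, (4 * (5000 * θ) * (∫ t in (a^2)..A, 1 * (1 / (t + (ps ξ n ω - u) ^ 2))) +
      4 * (70000 * g) * ∫ t in (a^2)..A, 1 / Real.sqrt t * (1 / (t + (ps ξ n ω - u) ^ 2))) ∂Q := by
    refine integral_mono_ae (integrable_finset_sum _ fun k hk => ei k (by simpa using hk)) ((j1.const_mul _).add (j2.const_mul _)) ?_
    filter_upwards [hG] with ω h3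
    have s0 : sv v δ a 0 ω = A := by simp [sv, ps_zero, hA]
    have r1 := riemann1 (ps ξ n ω - u) ha2 (fun k => sv v δ a k ω) (fun k => v k ω) n (fun k _ => h3.2.2.1 k)
      (fun k _ => (h3.1 k).1) (fun k _ => (h3.1 k).2.trans hg2) (fun k hk => (h3.2.1 k hk).1)
    have r2 := riemann2 (ps ξ n ω - u) ha2 (fun k => sv v δ a k ω) (fun k => v k ω) n (fun k _ => h3.2.2.1 k)
      (fun k _ => (h3.1 k).1) (fun k _ => (h3.1 k).2.trans hg2) (fun k hk => (h3.2.1 k hk).1)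
    rw [s0] at r1 r2
    have e1 : ∑ k ∈ Finset.range n, e k ω = 5000 * θ * (∑ k ∈ Finset.range n, v k ω * (1 / (sv v δ a (k + 1) ω + (ps ξ n ω - u) ^ 2)))
      + 70000 * g * ∑ k ∈ Finset.range n, v k ω * (1 / (Real.sqrt (sv v δ a (k + 1) ω) * (sv v δ a (k + 1) ω + (ps ξ n ω - u) ^ 2))) := by
      rw [Finset.mul_sum, Finset.mul_sum, ← Finset.sum_add_distrib]
      refine Finset.sum_congr rfl fun k hk => ?_
      have h4 := (h3.2.1 (k+1) (by simp at hk; omega)).1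
      have h5 : 0 < sv v δ a (k+1) ω := by linarith
      have h6 := Real.sqrt_pos.2 h5
      have h7 : 0 < sv v δ a (k+1) ω + (ps ξ n ω - u) ^ 2 := by positivity
      simp only [he]
      field_simp
    have e2 : ∀ t : ℝ, 1 * (1 / (t + (ps ξ n ω - u) ^ 2)) = 1 / (t + (ps ξ n ω - u) ^ 2) := fun t => by ring
    have e3 : ∀ t : ℝ, 1 / Real.sqrt t * (1 / (t + (ps ξ n ω - u) ^ 2)) = 1 / (Real.sqrt t * (t + (ps ξ n ω - u) ^ 2)) :=
      fun t => by rw [one_div_mul_one_div]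
    simp only [e1, e2, e3]
    have := h.θ0
    have q1 := mul_le_mul_of_nonneg_left r1 (show 0 ≤ 5000 * θ by positivity)
    have q2 := mul_le_mul_of_nonneg_left r2 (show 0 ≤ 70000 * g by positivity)
    linarith
  rw [integral_add (j1.const_mul _) (j2.const_mul _), integral_const_mul, integral_const_mul] at hsum
  rw [hf0] at htel
  refine htel.trans ?_
  have q0 : 0 ≤ 4 * D / Real.sqrt A := by positivity
  have := h.θ0
  have q1 := mul_le_mul_of_nonneg_left b1 (show 0 ≤ 4 * (5000 * θ) by positivity)
  have q2 := mul_le_mul_of_nonneg_left b2 (show 0 ≤ 4 * (70000 * g) by positivity)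
  have q3 : 0 ≤ 4 * (70000 * g) * (4 * D / Real.sqrt A) := by positivity
  have q4 : 0 ≤ 4 * (5000 * θ) * (8 * a) := by positivity
  linarith

end BEH
end SN

namespace SN
set_option linter.unusedSectionVars false
set_option linter.deprecated false

namespace BEH
variable {Ω : Type} [mΩ : MeasurableSpace Ω] {Q : Measure Ω} [IsProbabilityMeasure Q]
  {F : ℕ → MeasurableSpace Ω} {ξ v : ℕ → Ω → ℝ} {n : ℕ} {g θ δ : ℝ}

lemma log_g {g : ℝ} (hg : 0 < g) (hg1 : g ≤ 1 / 4) : |Real.log g| = Real.log (1 / g) ∧ 1 ≤ |Real.log g| := by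
  have h1 : Real.log g ≤ -1 := by
    have := Real.exp_one_lt_d9
    rw [Real.log_le_iff_le_exp hg, Real.exp_neg]
    refine hg1.trans ?_
    rw [one_div]
    gcongr
    linarith
  rw [abs_of_nonpos (by linarith), one_div, Real.log_inv]
  exact ⟨rfl, by linarith⟩

lemma arith {g θ δ D a : ℝ} (hg : 0 < g) (hg1 : g ≤ 1 / 4) (hθ : 0 ≤ θ) (hδ : 0 ≤ δ) (hδ1 : δ ≤ 1 / 4)
    (hD : 0 ≤ D) (hD1 : D ≤ 1) (ha : a = g + D / 100) :
    5 * (a + 2 * δ) + (δ ^ 2 + a ^ 2) + D / 8 +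
    32 * (5000 * θ * (8 * Real.sqrt (1 + δ ^ 2 + a ^ 2) + 2 * D * Real.log ((1 + δ ^ 2 + a ^ 2) / a ^ 2)) +
      70000 * g * (4 * Real.log ((1 + δ ^ 2 + a ^ 2) / a ^ 2) + 4 * D / a)) ≤ D / 2 + 2 * 10 ^ 9 * (g * |Real.log g| + θ + δ) := by
  obtain ⟨hl, hl1⟩ := log_g hg hg1
  have ha0 : 0 < a := by rw [ha]; positivity
  have hga : g ≤ a := by rw [ha]; linarith
  have ha1 : a ≤ 13 / 50 := by rw [ha]; linarith
  have hDa : D ≤ 100 * a := by rw [ha]; linarith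
  have hA2 : 1 + δ ^ 2 + a ^ 2 ≤ 2 := by nlinarith
  have hs : Real.sqrt (1 + δ ^ 2 + a ^ 2) ≤ 2 := by
    rw [Real.sqrt_le_left (by norm_num)]; linarith
  have hL : Real.log ((1 + δ ^ 2 + a ^ 2) / a ^ 2) ≤ 1 + 2 * Real.log (1 / a) := by
    have e : Real.log (2 / a ^ 2) = Real.log 2 + 2 * Real.log (1 / a) := by
      rw [Real.log_div (by norm_num) (by positivity), Real.log_pow, one_div, Real.log_inv]; push_cast; ring
    have : Real.log ((1 + δ ^ 2 + a ^ 2) / a ^ 2) ≤ Real.log (2 / a ^ 2) := by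
      apply Real.log_le_log (by positivity); gcongr
    have := Real.log_two_lt_d9
    linarith
  have hla : Real.log (1 / a) ≤ 1 / a - 1 := Real.log_le_sub_one_of_pos (by positivity)
  have hla0 : 0 ≤ Real.log (1 / a) := Real.log_nonneg (by rw [le_div_iff₀ ha0]; linarith)
  have hlg : Real.log (1 / a) ≤ |Real.log g| := by
    rw [hl]; apply Real.log_le_log (by positivity); gcongr
  set L := Real.log ((1 + δ ^ 2 + a ^ 2) / a ^ 2)
  have hDL : D * L ≤ 201 := by
    have h1 : D * Real.log (1 / a) ≤ 100 := by
      calc D * Real.log (1 / a) ≤ (100 * a) * (1 / a) := by gcongr; linarith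
        _ = 100 := by field_simp
    nlinarith
  have hgL : g * L ≤ 3 * (g * |Real.log g|) := by nlinarith
  have hgg : g ≤ g * |Real.log g| := by nlinarith
  have hgD : g * (4 * D / a) ≤ 400 * g := by
    have : D / a ≤ 100 := by rw [div_le_iff₀ ha0]; linarith
    have : 4 * D / a = 4 * (D / a) := by ring
    rw [this]; nlinarith
  have hth : θ * (8 * Real.sqrt (1 + δ ^ 2 + a ^ 2) + 2 * D * L) ≤ 418 * θ := by
    rw [mul_comm]; gcongr; linarith
  have hth2 : g * (4 * L + 4 * D / a) ≤ 412 * (g * |Real.log g|) := by nlinarith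
  have ha2 : a ^ 2 ≤ 13 / 50 * a := by nlinarith
  have hd2 : δ ^ 2 ≤ δ := by nlinarith
  generalize g * |Real.log g| = G at *
  nlinarith

lemma improve1 (h : BEH Q F ξ v n g θ δ) {D : ℝ} (hV : Valid Q (ps ξ n) D) (hD : 0 ≤ D) (hD1 : D ≤ 1) (u : ℝ) :
    1 - Ph u - (D / 2 + 2 * 10 ^ 9 * (g * |Real.log g| + θ + δ)) ≤ Q.real {ω | u ≤ ps ξ n ω} := by
  set a := g + D / 100 with ha
  have hga : g ≤ a := by rw [ha]; linarith
  have ha0 : 0 < a := h.g0.trans_le hga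
  have har := arith h.g0 h.g1 h.θ0 h.δ0 h.δ1 hD hD1 ha
  set r := a + 2 * δ with hr
  have hδ := h.δ0
  have hr0 : 0 < r := by positivity
  set b := 4 * r with hb
  have hb0 : 0 < b := by positivity
  have hl := h.lind hga (u + b) hV hD
  have hG := h.good a
  have pn := h.psm n
  have hc := conc pn hV u hb0
  have hm : MeasurableSet {ω | u ≤ ps ξ n ω} := measurableSet_le measurable_const pn
  have key : ∫ ω, Ph ((ps ξ n ω - (u + b)) / Real.sqrt (sv v δ a n ω)) ∂Q ≤
      ∫ ω, (Set.indicator {ω | u ≤ ps ξ n ω} (fun _ => (1:ℝ)) ω + 1 / 16 * (b ^ 2 / (b ^ 2 + (ps ξ n ω - u) ^ 2))) ∂Q := by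
    have hsm := h.sv_m a n
    have Phm : Measurable Ph := Ph_mono.measurable
    have i1 : Integrable (fun ω => b ^ 2 / (b ^ 2 + (ps ξ n ω - u) ^ 2)) Q := by
      refine bound_int (K := 1) (by fun_prop) (Eventually.of_forall fun ω => ?_)
      rw [abs_of_nonneg (by positivity)]
      exact (div_le_one (by positivity)).2 (by nlinarith [sq_nonneg (ps ξ n ω - u)])
    refine integral_mono_ae ?_ (((integrable_const (1:ℝ)).indicator hm).add (i1.const_mul _)) ?_
    · exact bound_int (K := 1) (by fun_prop) (Eventually.of_forall fun ω => by rw [abs_of_nonneg (Ph_nonneg _)]; exact Ph_le_one _)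
    filter_upwards [hG] with ω h3
    have h4 := (h3.2.1 n le_rfl).1
    have h5 := h3.2.2.2.1
    have hs0 : 0 < sv v δ a n ω := by have := pow_pos ha0 2; linarith
    have hq0 := Real.sqrt_pos.2 hs0
    have hqr : Real.sqrt (sv v δ a n ω) ≤ r := by
      rw [Real.sqrt_le_left hr0.le]; rw [hr]; nlinarith [mul_nonneg ha0.le hδ]
    by_cases hu : u ≤ ps ξ n ω
    · rw [Set.indicator_of_mem (by exact hu)]
      have : 0 ≤ 1 / 16 * (b ^ 2 / (b ^ 2 + (ps ξ n ω - u) ^ 2)) := by positivity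
      linarith [Ph_le_one ((ps ξ n ω - (u + b)) / Real.sqrt (sv v δ a n ω))]
    · rw [Set.indicator_of_notMem (by exact hu), zero_add]
      push Not at hu
      have hd : 0 < u - ps ξ n ω := by linarith
      have e : (ps ξ n ω - (u + b)) / Real.sqrt (sv v δ a n ω) ≤ -((u - ps ξ n ω + b) / r) := by
        have : (ps ξ n ω - (u + b)) / Real.sqrt (sv v δ a n ω) = -((u - ps ξ n ω + b) / Real.sqrt (sv v δ a n ω)) := by ring
        rw [this]
        gcongr
      refine (Ph_mono e).trans ((tail_le_sq (by positivity)).trans ?_)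
      rw [div_pow, one_div_div, div_le_iff₀ (by positivity), hb, ← mul_div_assoc, div_mul_eq_mul_div, le_div_iff₀ (by positivity)]
      nlinarith [mul_pos hd hr0, pow_pos hr0 2, mul_pos (mul_pos hd hr0) (pow_pos hr0 2)]
  rw [integral_add ((integrable_const (1:ℝ)).indicator hm) (by
      refine bound_int (K := 1) (by fun_prop) (Eventually.of_forall fun ω => ?_)
      rw [abs_of_nonneg (by positivity)]
      have := (div_le_one (show 0 < b ^ 2 + (ps ξ n ω - u) ^ 2 by positivity)).2 (show b ^ 2 ≤ _ by nlinarith [sq_nonneg (ps ξ n ω - u)])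
      linarith), integral_const_mul, integral_indicator_const _ hm, smul_eq_mul, mul_one] at key
  have hsc := Ph_scale (-(u+b)) (1 + δ ^ 2 + a ^ 2) (by nlinarith [sq_nonneg δ, sq_nonneg a])
  have hlip := Ph_lip (-u) (-(u + b))
  have e2 : |-(u + b) - -u| = b := by rw [show -(u + b) - -u = -b by ring, abs_neg, abs_of_pos hb0]
  rw [e2] at hlip
  rw [abs_le] at hl hsc hlip
  have := Ph_neg u
  linarith [hl.1, hsc.1, hlip.1]

lemma ps_neg (k : ℕ) (ω : Ω) : ps (fun i ω => - ξ i ω) k ω = - ps ξ k ω := by simp [ps]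

lemma improve (h : BEH Q F ξ v n g θ δ) {D : ℝ} (hV : Valid Q (ps ξ n) D) (hD : 0 ≤ D) (hD1 : D ≤ 1) :
    Valid Q (ps ξ n) (D / 2 + 2 * 10 ^ 9 * (g * |Real.log g| + θ + δ)) := by
  intro u
  refine ⟨h.improve1 hV hD hD1 u, ?_⟩
  have hV' : Valid Q (ps (fun i ω => - ξ i ω) n) D := by
    intro w
    have e1 : {ω | w ≤ ps (fun i ω => - ξ i ω) n ω} = {ω | ps ξ n ω ≤ -w} := by
      ext ω; simp only [Set.mem_setOf_eq, ps_neg]; constructor <;> intro h <;> linarith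
    have e2 : {ω | ps (fun i ω => - ξ i ω) n ω ≤ w} = {ω | -w ≤ ps ξ n ω} := by
      ext ω; simp only [Set.mem_setOf_eq, ps_neg]; constructor <;> intro h <;> linarith
    rw [e1, e2]
    have := hV (-w)
    rw [Ph_neg] at this
    exact ⟨this.2, by linarith [this.1]⟩
  have := h.neg.improve1 hV' hD hD1 (-u)
  have e1 : {ω | -u ≤ ps (fun i ω => - ξ i ω) n ω} = {ω | ps ξ n ω ≤ u} := by
    ext ω; simp only [Set.mem_setOf_eq, ps_neg]; constructor <;> intro h <;> linarith
  rw [e1, Ph_neg] at this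
  linarith

/-- Martingale Berry-Esseen bound. -/
theorem berry_esseen (h : BEH Q F ξ v n g θ δ) : Valid Q (ps ξ n) (4 * 10 ^ 9 * (g * |Real.log g| + θ + δ)) := by
  set τ := 2 * 10 ^ 9 * (g * |Real.log g| + θ + δ) with hτ
  have e : 4 * 10 ^ 9 * (g * |Real.log g| + θ + δ) = 2 * τ := by rw [hτ]; ring
  rw [e]
  have := h.g0; have := h.θ0; have := h.δ0
  have hτ0 : 0 ≤ τ := by positivity
  by_cases h1 : 1 ≤ 2 * τ
  · exact (valid_one _).mono h1
  push Not at h1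
  have hj : ∀ j : ℕ, Valid Q (ps ξ n) (2 * τ + (1 / 2) ^ j * (1 - 2 * τ)) := by
    intro j
    induction j with
    | zero => simpa using valid_one _
    | succ j ih =>
      have hp : (1 / 2 : ℝ) ^ j ≤ 1 := pow_le_one₀ (by norm_num) (by norm_num)
      have hp0 : 0 < (1 / 2 : ℝ) ^ j := by positivity
      have := h.improve ih (by nlinarith) (by nlinarith)
      refine this.mono (le_of_eq ?_)
      rw [← hτ, pow_succ]; ring
  have ht : Tendsto (fun j : ℕ => 2 * τ + (1 / 2 : ℝ) ^ j * (1 - 2 * τ)) atTop (𝓝 (2 * τ)) := by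
    have := ((tendsto_pow_atTop_nhds_zero_of_lt_one (r := (1/2:ℝ)) (by norm_num) (by norm_num)).mul_const (1 - 2 * τ)).const_add (2 * τ)
    simpa using this
  intro u
  constructor
  · exact le_of_tendsto (ht.const_sub (1 - Ph u)) (Eventually.of_forall fun j => (hj j u).1)
  · exact le_of_tendsto (ht.const_sub (Ph u)) (Eventually.of_forall fun j => (hj j u).2)

end BEH
end SN

namespace SN
set_option linter.unusedSectionVars false
set_option linter.deprecated false

lemma expo_le (t : ℝ) : Real.exp (t - t ^ 2 / 2) ≤ 2 := by
  have h1 : t - t ^ 2 / 2 ≤ 1 / 2 := by nlinarith [sq_nonneg (t - 1)]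
  have h2 : Real.exp (t - t ^ 2 / 2) ≤ Real.exp (1 / 2) := Real.exp_le_exp.2 h1
  have h3 : Real.exp (1 / 2) ^ 2 ≤ 4 := by
    rw [← Real.exp_nat_mul]; norm_num; linarith [Real.exp_one_lt_d9]
  nlinarith [Real.exp_pos (1 / 2)]

/-- polynomial decay of the weight -/
lemma expo_poly (t : ℝ) : Real.exp (t - t ^ 2 / 2) * (1 + |1 - t / 2| + |1 - t / 2| ^ 2 + |1 - t / 2| ^ 3) ≤ 100 := by
  have e : t - t ^ 2 / 2 = 1 / 2 - (t - 1) ^ 2 / 2 := by ring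
  have h3 : Real.exp (1 / 2) ≤ 2 := by
    have := expo_le 1; norm_num at this; exact this
  have hq := Real.quadratic_le_exp_of_nonneg (x := (t - 1) ^ 2 / 2) (by positivity)
  rw [e, Real.exp_sub, div_mul_eq_mul_div, div_le_iff₀ (Real.exp_pos _)]
  set s := |t - 1| with hs
  have hs0 : 0 ≤ s := abs_nonneg _
  have hs2 : (t - 1) ^ 2 = s ^ 2 := (sq_abs _).symm
  have hu : |1 - t / 2| ≤ (1 + s) / 2 := by
    rw [abs_le]; rcases abs_le.1 (le_of_eq hs.symm) with ⟨h1, h2⟩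
    constructor <;> linarith
  rw [hs2] at hq ⊢
  have h0 : 0 ≤ |1 - t / 2| := abs_nonneg _
  have h5 : 1 + |1 - t / 2| + |1 - t / 2| ^ 2 + |1 - t / 2| ^ 3 ≤ 1 + (1 + s) / 2 + ((1 + s) / 2) ^ 2 + ((1 + s) / 2) ^ 3 := by gcongr
  have h6 : 1 + (1 + s) / 2 + ((1 + s) / 2) ^ 2 + ((1 + s) / 2) ^ 3 ≤ 50 * (1 + s ^ 2 / 2 + (s ^ 2 / 2) ^ 2 / 2) := by
    nlinarith [sq_nonneg (s ^ 2 - s), sq_nonneg (s - 1), sq_nonneg s, sq_nonneg (s^2)]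
  calc _ ≤ 2 * (50 * (1 + s ^ 2 / 2 + (s ^ 2 / 2) ^ 2 / 2)) := by gcongr; exact h5.trans h6
    _ ≤ _ := by linarith

lemma exp3 {z : ℝ} (hz : |z| ≤ 1) : |Real.exp z - (1 + z + z ^ 2 / 2)| ≤ |z| ^ 3 := by
  have := Real.exp_bound hz (n := 3) (by norm_num)
  simp [Finset.sum_range_succ, Nat.factorial] at this
  refine this.trans ?_
  have h0 : 0 ≤ |z| ^ 3 := by positivity
  nlinarith

lemma expo_e {j : ℝ} (hj1 : 0 ≤ j) (hj4 : j ≤ 4) (t : ℝ) :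
    |Real.exp (j * (t - t ^ 2 / 2)) - (1 + j * t + j * (j - 1) / 2 * t ^ 2)| ≤ 100000 * |t| ^ 3 := by
  have ht0 := abs_nonneg t
  have ht2 : t ^ 2 = |t| ^ 2 := (sq_abs t).symm
  by_cases ht : |t| ≤ 1 / 8
  · set z := j * (t - t ^ 2 / 2) with hz
    have hzt : |z| ≤ 5 * |t| := by
      rw [hz, abs_mul, abs_of_nonneg hj1]
      have : |t - t ^ 2 / 2| ≤ 5 / 4 * |t| := by
        refine (abs_sub _ _).trans ?_
        rw [abs_of_nonneg (by positivity : 0 ≤ t ^ 2 / 2), ht2]; nlinarith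
      nlinarith [abs_nonneg (t - t ^ 2 / 2)]
    have h1 := exp3 (z := z) (by linarith)
    have e : 1 + z + z ^ 2 / 2 - (1 + j * t + j * (j - 1) / 2 * t ^ 2) = -(j ^ 2 / 2) * (t ^ 3) + j ^ 2 / 8 * (t ^ 4) := by rw [hz]; ring
    have h2 : |1 + z + z ^ 2 / 2 - (1 + j * t + j * (j - 1) / 2 * t ^ 2)| ≤ 10 * |t| ^ 3 := by
      rw [e]
      refine (abs_add_le _ _).trans ?_
      rw [abs_mul, abs_mul, abs_neg, abs_pow, abs_pow, abs_of_nonneg (by positivity : 0 ≤ j ^ 2 / 2), abs_of_nonneg (by positivity : 0 ≤ j ^ 2 / 8)]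
      have hj2 : j ^ 2 ≤ 16 := by nlinarith
      have h3 : 0 ≤ |t| ^ 3 := by positivity
      have h4 : |t| ^ 4 ≤ |t| ^ 3 := by
        have : |t| ^ 4 = |t| * |t| ^ 3 := by ring
        rw [this]; nlinarith
      have : 0 ≤ |t| ^ 4 := by positivity
      nlinarith
    have h5 : |z| ^ 3 ≤ 125 * |t| ^ 3 := by
      calc |z| ^ 3 ≤ (5 * |t|) ^ 3 := by gcongr
        _ = _ := by ring
    calc _ = |(Real.exp z - (1 + z + z ^ 2 / 2)) + (1 + z + z ^ 2 / 2 - (1 + j * t + j * (j - 1) / 2 * t ^ 2))| := by congr 1; ring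
      _ ≤ _ := abs_add_le _ _
      _ ≤ _ := by have : 0 ≤ |t| ^ 3 := by positivity
                  linarith
  · push Not at ht
    have hb : Real.exp (j * (t - t ^ 2 / 2)) ≤ 16 := by
      by_cases hc : t - t ^ 2 / 2 ≤ 0
      · have : Real.exp (j * (t - t ^ 2 / 2)) ≤ 1 := Real.exp_le_one_iff.2 (by nlinarith)
        linarith
      · push Not at hc
        calc Real.exp (j * (t - t ^ 2 / 2)) ≤ Real.exp ((4 : ℕ) * (t - t ^ 2 / 2)) := by
              gcongr; exact_mod_cast hj4
          _ = Real.exp (t - t ^ 2 / 2) ^ 4 := Real.exp_nat_mul _ _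
          _ ≤ 2 ^ 4 := by gcongr; exact expo_le t
          _ = 16 := by norm_num
    have h1 : |Real.exp (j * (t - t ^ 2 / 2))| ≤ 16 := by rw [abs_of_pos (Real.exp_pos _)]; exact hb
    have h2 : |j * t| ≤ 4 * |t| := by rw [abs_mul, abs_of_nonneg hj1]; gcongr
    have h3 : |j * (j - 1) / 2 * t ^ 2| ≤ 8 * |t| ^ 2 := by
      rw [abs_mul, ht2, abs_of_nonneg (by positivity : 0 ≤ |t| ^ 2)]
      gcongr
      rw [abs_le]; constructor <;> nlinarith
    have h8 : 1 ≤ 512 * |t| ^ 3 := by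
      have : (1/8 : ℝ) ^ 3 ≤ |t| ^ 3 := by gcongr
      linarith
    have h9 : |t| ≤ 64 * |t| ^ 3 := by
      have : (1/8 : ℝ) ^ 2 ≤ |t| ^ 2 := by gcongr
      nlinarith
    have h10 : |t| ^ 2 ≤ 8 * |t| ^ 3 := by nlinarith [sq_nonneg |t|]
    rw [abs_le] at h1 h2 h3 ⊢
    constructor <;> linarith [h1.1, h1.2, h2.1, h2.2, h3.1, h3.2]

lemma expo_b (t : ℝ) : |Real.exp (t - t ^ 2 / 2) * (1 - t / 2) - (1 + t / 2)| ≤ 100000 * t ^ 2 := by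
  have ht0 := abs_nonneg t
  have ht2 : t ^ 2 = |t| ^ 2 := (sq_abs t).symm
  by_cases ht : |t| ≤ 1 / 8
  · have h1 := expo_e (j := 1) (by norm_num) (by norm_num) t
    norm_num at h1
    have e : Real.exp (t - t ^ 2 / 2) * (1 - t / 2) - (1 + t / 2) =
      (Real.exp (t - t ^ 2 / 2) - (1 + t)) * (1 - t / 2) + (-(t ^ 2 / 2)) := by ring
    rw [e]
    refine (abs_add_le _ _).trans ?_
    rw [abs_mul, abs_neg, abs_of_nonneg (by positivity : 0 ≤ t ^ 2 / 2)]
    have h2 : |1 - t / 2| ≤ 2 := by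
      rcases abs_le.1 ht with ⟨h1, h2⟩
      rw [abs_le]; constructor <;> linarith
    have h3 : |t| ^ 3 ≤ 1 / 8 * |t| ^ 2 := by nlinarith [sq_nonneg |t|]
    rw [ht2] at *
    nlinarith [abs_nonneg (Real.exp (t - |t| ^ 2 / 2) - (1 + t)), abs_nonneg (1 - t / 2)]
  · push Not at ht
    have hp := expo_poly t
    have h0 := Real.exp_pos (t - t ^ 2 / 2)
    have ha := abs_nonneg (1 - t / 2)
    have h1 : |Real.exp (t - t ^ 2 / 2) * (1 - t / 2)| ≤ 100 := by
      rw [abs_mul, abs_of_pos h0]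
      nlinarith [mul_nonneg h0.le (by positivity : 0 ≤ 1 + |1 - t / 2| ^ 2 + |1 - t / 2| ^ 3)]
    have h8 : 1 ≤ 64 * |t| ^ 2 := by nlinarith
    have h9 : |t| ≤ 8 * |t| ^ 2 := by nlinarith
    rw [ht2] at *
    have h2 := abs_le.1 (le_refl |t|)
    rw [abs_le] at *
    constructor <;> linarith [h1.1, h1.2, h2.1, h2.2]

lemma expo_c (t : ℝ) : |Real.exp (t - t ^ 2 / 2) * (1 - t / 2) ^ 2 - 1| ≤ 100000 * |t| := by
  have ht0 := abs_nonneg t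
  have ht2 : t ^ 2 = |t| ^ 2 := (sq_abs t).symm
  by_cases ht : |t| ≤ 1 / 8
  · have h1 := expo_b t
    have e : Real.exp (t - t ^ 2 / 2) * (1 - t / 2) ^ 2 - 1 =
      (Real.exp (t - t ^ 2 / 2) * (1 - t / 2) - (1 + t / 2)) * (1 - t / 2) + (-(t ^ 2 / 4)) := by ring
    rw [e]
    refine (abs_add_le _ _).trans ?_
    rw [abs_mul, abs_neg, abs_of_nonneg (by positivity : 0 ≤ t ^ 2 / 4)]
    have h2 : |1 - t / 2| ≤ 2 := by
      rcases abs_le.1 ht with ⟨h1, h2⟩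
      rw [abs_le]; constructor <;> linarith
    have h3 : |t| ^ 2 ≤ 1 / 8 * |t| := by nlinarith [sq_nonneg |t|]
    rw [ht2] at *
    nlinarith [abs_nonneg (Real.exp (t - |t| ^ 2 / 2) * (1 - t / 2) - (1 + t / 2)), abs_nonneg (1 - t / 2)]
  · push Not at ht
    have hp := expo_poly t
    have h0 := Real.exp_pos (t - t ^ 2 / 2)
    have ha := abs_nonneg (1 - t / 2)
    have h1 : |Real.exp (t - t ^ 2 / 2) * (1 - t / 2) ^ 2| ≤ 100 := by
      rw [abs_mul, abs_of_pos h0, abs_pow]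
      nlinarith [mul_nonneg h0.le (by positivity : 0 ≤ 1 + |1 - t / 2| + |1 - t / 2| ^ 3)]
    rw [abs_le] at *
    constructor <;> linarith [h1.1, h1.2]

lemma expo_d (t : ℝ) : Real.exp (t - t ^ 2 / 2) * |1 - t / 2| ^ 3 ≤ 100000 := by
  have hp := expo_poly t
  have h0 := Real.exp_pos (t - t ^ 2 / 2)
  have ha := abs_nonneg (1 - t / 2)
  nlinarith [mul_nonneg h0.le (by positivity : 0 ≤ 1 + |1 - t / 2| + |1 - t / 2| ^ 2)]

end SN

namespace SN
set_option linter.unusedSectionVars false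
set_option linter.deprecated false

/-- Hypotheses for a product change of measure. -/
structure Tilt {Ω : Type} [mΩ : MeasurableSpace Ω] (P : Measure Ω) (F : ℕ → MeasurableSpace Ω)
    (w : ℕ → Ω → ℝ) (K : ℝ) : Prop where
  mono : Monotone F
  le : ∀ i, F i ≤ mΩ
  sm : ∀ i, StronglyMeasurable[F (i+1)] (w i)
  pos : ∀ i ω, 0 < w i ω
  bd : ∀ i ω, w i ω ≤ K
  hq : ∀ i, ∀ᵐ ω ∂P, 1 / 2 ≤ (P[w i|F i]) ω

/-- conditional normalisation -/
noncomputable def tq {Ω : Type} [mΩ : MeasurableSpace Ω] (P : Measure Ω) (F : ℕ → MeasurableSpace Ω)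
    (w : ℕ → Ω → ℝ) (i : ℕ) (ω : Ω) : ℝ := max ((P[w i|F i]) ω) (1 / 2)

/-- density martingale -/
noncomputable def tM {Ω : Type} [mΩ : MeasurableSpace Ω] (P : Measure Ω) (F : ℕ → MeasurableSpace Ω)
    (w : ℕ → Ω → ℝ) (k : ℕ) (ω : Ω) : ℝ := ∏ i ∈ Finset.range k, (w i ω / tq P F w i ω)

/-- tilted measure -/
noncomputable def tQ {Ω : Type} [mΩ : MeasurableSpace Ω] (P : Measure Ω) (F : ℕ → MeasurableSpace Ω)
    (w : ℕ → Ω → ℝ) (n : ℕ) : Measure Ω := P.withDensity (fun ω => ENNReal.ofReal (tM P F w n ω))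

namespace Tilt
variable {Ω : Type} [mΩ : MeasurableSpace Ω] {P : Measure Ω} [IsProbabilityMeasure P]
  {F : ℕ → MeasurableSpace Ω} {w : ℕ → Ω → ℝ} {K : ℝ}

lemma q_ge (i : ℕ) (ω : Ω) : 1 / 2 ≤ tq P F w i ω := le_max_right _ _
lemma q_pos (i : ℕ) (ω : Ω) : 0 < tq P F w i ω := lt_of_lt_of_le (by norm_num) (q_ge i ω)

lemma q_eq (h : Tilt P F w K) (i : ℕ) : ∀ᵐ ω ∂P, tq P F w i ω = (P[w i|F i]) ω := by
  filter_upwards [h.hq i] with ω hω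
  exact max_eq_left hω

lemma q_sm (i : ℕ) : StronglyMeasurable[F i] (tq P F w i) :=
  (stronglyMeasurable_condExp.measurable.max measurable_const).stronglyMeasurable

lemma M_succ (k : ℕ) (ω : Ω) : tM P F w (k+1) ω = tM P F w k ω * (w k ω / tq P F w k ω) := by
  unfold tM; exact Finset.prod_range_succ _ _

lemma M_zero (ω : Ω) : tM P F w 0 ω = 1 := by simp [tM]

lemma M_pos (h : Tilt P F w K) (k : ℕ) (ω : Ω) : 0 < tM P F w k ω :=
  Finset.prod_pos fun i _ => div_pos (h.pos i ω) (q_pos i ω)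

lemma Kpos (h : Tilt P F w K) : 0 ≤ K := by
  obtain ⟨ω⟩ : Nonempty Ω := nonempty_of_isProbabilityMeasure P
  exact (h.pos 0 ω).le.trans (h.bd 0 ω)

lemma wq_le (h : Tilt P F w K) (i : ℕ) (ω : Ω) : w i ω / tq P F w i ω ≤ 2 * K := by
  rw [div_le_iff₀ (q_pos i ω)]
  have := h.bd i ω
  have := q_ge (P := P) (F := F) (w := w) i ω
  nlinarith [h.Kpos]

lemma M_le (h : Tilt P F w K) (k : ℕ) (ω : Ω) : tM P F w k ω ≤ (2 * K) ^ k := by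
  unfold tM
  calc _ ≤ ∏ i ∈ Finset.range k, (2 * K) := Finset.prod_le_prod
          (fun i _ => (div_pos (h.pos i ω) (q_pos i ω)).le) (fun i _ => h.wq_le i ω)
    _ = _ := by simp

lemma M_abs (h : Tilt P F w K) (k : ℕ) (ω : Ω) : |tM P F w k ω| ≤ (2 * K) ^ k := by
  rw [abs_of_pos (h.M_pos k ω)]; exact h.M_le k ω

lemma M_sm (h : Tilt P F w K) (k : ℕ) : StronglyMeasurable[F k] (tM P F w k) := by
  induction k with
  | zero =>
    have : tM P F w 0 = fun _ => 1 := by funext ω; simp [tM]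
    rw [this]; exact stronglyMeasurable_const
  | succ k ih =>
    have : tM P F w (k+1) = fun ω => tM P F w k ω * (w k ω / tq P F w k ω) := by
      funext ω; exact M_succ k ω
    rw [this]
    have h1 : Measurable[F (k+1)] (tM P F w k) := ih.measurable.mono (h.mono (Nat.le_succ k)) le_rfl
    have h2 : Measurable[F (k+1)] (tq P F w k) := (q_sm k).measurable.mono (h.mono (Nat.le_succ k)) le_rfl
    exact (h1.mul ((h.sm k).measurable.div h2)).stronglyMeasurable

lemma w_aesm (h : Tilt P F w K) (i : ℕ) : AEStronglyMeasurable (w i) P :=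
  ((h.sm i).mono (h.le _)).aestronglyMeasurable

lemma w_int (h : Tilt P F w K) (i : ℕ) : Integrable (w i) P := by
  refine (integrable_const K).mono' (h.w_aesm i) (Eventually.of_forall fun ω => ?_)
  rw [Real.norm_eq_abs, abs_of_pos (h.pos i ω)]; exact h.bd i ω

lemma T1_step (h : Tilt P F w K) {k : ℕ} {Z : Ω → ℝ} (hZ : StronglyMeasurable[F k] Z)
    (hi : Integrable (fun ω => tM P F w k ω * Z ω) P) :
    Integrable (fun ω => tM P F w (k+1) ω * Z ω) P ∧
      ∫ ω, tM P F w (k+1) ω * Z ω ∂P = ∫ ω, tM P F w k ω * Z ω ∂P := by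
  set Y : Ω → ℝ := fun ω => (tM P F w k ω * Z ω) / tq P F w k ω with hY
  have hYm : StronglyMeasurable[F k] Y :=
    (((h.M_sm k).measurable.mul hZ.measurable).div (q_sm k).measurable).stronglyMeasurable
  have e : (fun ω => tM P F w (k+1) ω * Z ω) = fun ω => Y ω * w k ω := by
    funext ω; rw [M_succ, hY]; ring
  have hqi : Integrable (fun ω => w k ω / tq P F w k ω * (tM P F w k ω * Z ω)) P := by
    refine bdd_int (K := 2 * K) ?_ (Eventually.of_forall fun ω => ?_) hi
    · exact ((h.w_aesm k).aemeasurable.div ((q_sm k).mono (h.le k)).aestronglyMeasurable.aemeasurable).aestronglyMeasurable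
    · rw [abs_of_pos (div_pos (h.pos k ω) (q_pos k ω))]; exact h.wq_le k ω
  have hYw : Integrable (fun ω => Y ω * w k ω) P := by
    refine hqi.congr (Eventually.of_forall fun ω => ?_)
    simp only [hY]; ring
  rw [e]
  refine ⟨hYw, ?_⟩
  rw [pull (h.le k) hYm (h.w_int k) hYw]
  refine integral_congr_ae ?_
  filter_upwards [h.q_eq k] with ω hω
  rw [← hω, hY]
  exact div_mul_cancel₀ _ (q_pos k ω).ne'

lemma T1 (h : Tilt P F w K) {k m : ℕ} (hkm : k ≤ m) {Z : Ω → ℝ} (hZ : StronglyMeasurable[F k] Z)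
    (hi : Integrable (fun ω => tM P F w k ω * Z ω) P) :
    Integrable (fun ω => tM P F w m ω * Z ω) P ∧
      ∫ ω, tM P F w m ω * Z ω ∂P = ∫ ω, tM P F w k ω * Z ω ∂P := by
  induction m, hkm using Nat.le_induction with
  | base => exact ⟨hi, rfl⟩
  | succ m hm ih =>
    have h1 := h.T1_step (hZ.mono (h.mono hm)) ih.1
    exact ⟨h1.1, h1.2.trans ih.2⟩

lemma M_meas (h : Tilt P F w K) (k : ℕ) : Measurable (tM P F w k) := ((h.M_sm k).mono (h.le k)).measurable

lemma M_int (h : Tilt P F w K) (k : ℕ) : Integrable (tM P F w k) P := by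
  refine (integrable_const ((2 * K) ^ k)).mono' (h.M_meas k).aestronglyMeasurable (Eventually.of_forall fun ω => ?_)
  exact h.M_abs k ω

lemma M_one (h : Tilt P F w K) (k : ℕ) : ∫ ω, tM P F w k ω ∂P = 1 := by
  have := (h.T1 (Nat.zero_le k) (Z := fun _ => 1) stronglyMeasurable_const (by simpa using h.M_int 0)).2
  simpa [M_zero] using this

lemma Q_prob (h : Tilt P F w K) (n : ℕ) : IsProbabilityMeasure (tQ P F w n) := by
  constructor
  unfold tQ
  rw [withDensity_apply _ MeasurableSet.univ, Measure.restrict_univ,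
    ← ofReal_integral_eq_lintegral_ofReal (h.M_int n) (Eventually.of_forall fun ω => (h.M_pos n ω).le), h.M_one]
  simp

lemma Q_ac (n : ℕ) : tQ P F w n ≪ P := withDensity_absolutelyContinuous _ _

lemma Q_integral (h : Tilt P F w K) (n : ℕ) (f : Ω → ℝ) :
    ∫ ω, f ω ∂(tQ P F w n) = ∫ ω, tM P F w n ω * f ω ∂P := by
  unfold tQ
  rw [integral_withDensity_eq_integral_toReal_smul (by have := h.M_meas n; fun_prop) (by simp)]
  refine integral_congr_ae (Eventually.of_forall fun ω => ?_)
  simp [ENNReal.toReal_ofReal (h.M_pos n ω).le]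

lemma Q_integrable (h : Tilt P F w K) (n : ℕ) {f : Ω → ℝ}
    (hf : Integrable (fun ω => tM P F w n ω * f ω) P) : Integrable f (tQ P F w n) := by
  unfold tQ
  rw [integrable_withDensity_iff_integrable_smul' (by have := h.M_meas n; fun_prop) (by simp)]
  refine hf.congr (Eventually.of_forall fun ω => ?_)
  simp [ENNReal.toReal_ofReal (h.M_pos n ω).le]

lemma bdd_mul_int (h : Tilt P F w K) (k : ℕ) {f : Ω → ℝ} (hf : Integrable f P) :
    Integrable (fun ω => tM P F w k ω * f ω) P :=
  bdd_int (h.M_meas k).aestronglyMeasurable (Eventually.of_forall fun ω => h.M_abs k ω) hf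

lemma inv_q_int {i : ℕ} (hle : ∀ i, F i ≤ mΩ) {f : Ω → ℝ} (hf : Integrable f P) :
    Integrable (fun ω => (tq P F w i ω)⁻¹ * f ω) P := by
  refine bdd_int (K := 2) ((q_sm i).measurable.inv.mono (hle i) le_rfl).aestronglyMeasurable (Eventually.of_forall fun ω => ?_) hf
  rw [abs_of_pos (inv_pos.2 (q_pos i ω))]
  have := inv_anti₀ (by norm_num) (q_ge (P := P) (F := F) (w := w) i ω)
  simpa using this

lemma T2 (h : Tilt P F w K) {i n : ℕ} (hin : i < n) {f : Ω → ℝ} (hf : StronglyMeasurable[F (i+1)] f)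
    (hwf : Integrable (fun ω => w i ω * f ω) P) :
    Integrable f (tQ P F w n) ∧
      ∀ᵐ ω ∂(tQ P F w n), ((tQ P F w n)[f|F i]) ω = (P[fun ω' => w i ω' * f ω'|F i]) ω / tq P F w i ω := by
  have hQ := h.Q_prob n
  have hMf : Integrable (fun ω => tM P F w (i+1) ω * f ω) P := by
    refine (h.bdd_mul_int i (inv_q_int (i := i) (w := w) h.le hwf)).congr (Eventually.of_forall fun ω => ?_)
    simp only [M_succ]; ring
  have hfn := h.T1 (show i + 1 ≤ n from hin) hf hMf
  have hfQ := h.Q_integrable n hfn.1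
  refine ⟨hfQ, ?_⟩
  set D : Ω → ℝ := fun ω => (P[fun ω' => w i ω' * f ω'|F i]) ω / tq P F w i ω with hD
  have hDm : StronglyMeasurable[F i] D :=
    (stronglyMeasurable_condExp.measurable.div (q_sm i).measurable).stronglyMeasurable
  have hDP : Integrable D P := by
    refine (inv_q_int (i := i) (w := w) h.le (integrable_condExp (m := F i) (f := fun ω' => w i ω' * f ω'))).congr (Eventually.of_forall fun ω => ?_)
    simp only [hD]; ring
  have hDn := h.T1 hin.le hDm (h.bdd_mul_int i hDP)
  have hDQ := h.Q_integrable n hDn.1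
  have key := ae_eq_condExp_of_forall_setIntegral_eq (μ := tQ P F w n) (h.le i) (f := f) (g := D) hfQ
    (fun s _ _ => hDQ.integrableOn) ?_ hDm.aestronglyMeasurable
  · exact key.symm
  · intro s hs _
    have hs' := h.le i s hs
    have hs1 : MeasurableSet[F (i+1)] s := h.mono (Nat.le_succ i) s hs
    rw [← integral_indicator hs', ← integral_indicator hs', h.Q_integral, h.Q_integral]
    have e1 := (h.T1 hin.le (hDm.indicator hs) (h.bdd_mul_int i (hDP.indicator hs'))).2
    have hMf' : Integrable (fun ω => tM P F w (i+1) ω * s.indicator f ω) P := by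
      refine (hMf.indicator hs').congr (Eventually.of_forall fun ω => ?_)
      by_cases hω : ω ∈ s <;> simp [hω]
    have e2 := (h.T1 (show i + 1 ≤ n from hin) (hf.indicator hs1) hMf').2
    rw [e1, e2]
    set Y : Ω → ℝ := fun ω => s.indicator (fun ω => tM P F w i ω / tq P F w i ω) ω with hY
    have hYm : StronglyMeasurable[F i] Y :=
      (((h.M_sm i).measurable.div (q_sm i).measurable).stronglyMeasurable).indicator hs
    have e3 : (fun ω => tM P F w (i+1) ω * s.indicator f ω) = fun ω => Y ω * (w i ω * f ω) := by
      funext ω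
      by_cases hω : ω ∈ s
      · simp only [hY, hω, Set.indicator_of_mem, M_succ]; ring
      · simp [hY, hω]
    rw [e3] at hMf' ⊢
    rw [pull (h.le i) hYm hwf hMf']
    refine integral_congr_ae (Eventually.of_forall fun ω => ?_)
    by_cases hω : ω ∈ s
    · simp only [hY, hω, Set.indicator_of_mem, hD]; ring
    · simp [hY, hω]

end Tilt
end SN

namespace SN
set_option linter.unusedSectionVars false
set_option linter.deprecated false

/-- Normalised martingale differences. -/
structure NH {Ω : Type} [mΩ : MeasurableSpace Ω] (P : Measure Ω) (F : ℕ → MeasurableSpace Ω)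
    (X : ℕ → Ω → ℝ) (n : ℕ) (γ ε δ : ℝ) : Prop where
  mono : Monotone F
  le : ∀ i, F i ≤ mΩ
  sm : ∀ i, StronglyMeasurable[F (i+1)] (X i)
  zero : ∀ i, n ≤ i → X i = 0
  int3 : ∀ i, Integrable (fun ω => |X i ω| ^ 3) P
  mz : ∀ i, P[X i|F i] =ᵐ[P] 0
  A1 : ∀ᵐ ω ∂P, |∑ i ∈ Finset.range n, (P[fun ω' => X i ω' ^ 2|F i]) ω - 1| ≤ δ ^ 2
  A2 : ∀ᵐ ω ∂P, ∑ i ∈ Finset.range n, (P[fun ω' => |X i ω'| ^ 3|F i]) ω ≤ ε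
  A4 : ∀ i, ∀ᵐ ω ∂P, (P[fun ω' => |X i ω'| ^ 3|F i]) ω ≤ γ * (P[fun ω' => X i ω' ^ 2|F i]) ω
  γ0 : 0 < γ
  γ1 : γ ≤ 1 / 4
  ε0 : 0 ≤ ε
  εγ : ε ≤ 2 * γ
  δ0 : 0 ≤ δ
  δ1 : δ ≤ 1 / 4

/-- conditional second moment -/
noncomputable def sg {Ω : Type} [mΩ : MeasurableSpace Ω] (P : Measure Ω) (F : ℕ → MeasurableSpace Ω)
    (X : ℕ → Ω → ℝ) (i : ℕ) : Ω → ℝ := P[fun ω' => X i ω' ^ 2|F i]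

/-- conditional third moment -/
noncomputable def bt {Ω : Type} [mΩ : MeasurableSpace Ω] (P : Measure Ω) (F : ℕ → MeasurableSpace Ω)
    (X : ℕ → Ω → ℝ) (i : ℕ) : Ω → ℝ := P[fun ω' => |X i ω'| ^ 3|F i]

/-- exponential weight -/
noncomputable def wt {Ω : Type} (X : ℕ → Ω → ℝ) (l j : ℝ) (i : ℕ) (ω : Ω) : ℝ :=
  Real.exp (j * (l * X i ω - (l * X i ω) ^ 2 / 2))

lemma expo_le16 {j : ℝ} (hj1 : 0 ≤ j) (hj4 : j ≤ 4) (t : ℝ) : Real.exp (j * (t - t ^ 2 / 2)) ≤ 16 := by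
  by_cases hc : t - t ^ 2 / 2 ≤ 0
  · have : Real.exp (j * (t - t ^ 2 / 2)) ≤ 1 := Real.exp_le_one_iff.2 (by nlinarith)
    linarith
  · push Not at hc
    calc Real.exp (j * (t - t ^ 2 / 2)) ≤ Real.exp ((4 : ℕ) * (t - t ^ 2 / 2)) := by
          gcongr; exact_mod_cast hj4
      _ = Real.exp (t - t ^ 2 / 2) ^ 4 := Real.exp_nat_mul _ _
      _ ≤ 2 ^ 4 := by gcongr; exact expo_le t
      _ = 16 := by norm_num

namespace NH
variable {Ω : Type} [mΩ : MeasurableSpace Ω] {P : Measure Ω} [IsProbabilityMeasure P]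
  {F : ℕ → MeasurableSpace Ω} {X : ℕ → Ω → ℝ} {n : ℕ} {γ ε δ l j : ℝ}

lemma X_meas (h : NH P F X n γ ε δ) (i : ℕ) : Measurable (X i) := ((h.sm i).mono (h.le _)).measurable

lemma cube (h : NH P F X n γ ε δ) (i : ℕ) :
    MemLp (X i) 2 P ∧ Integrable (X i) P ∧ Integrable (fun ω => X i ω ^ 2) P :=
  int_of_cube (h.X_meas i).aestronglyMeasurable (h.int3 i)

lemma approx (h : NH P F X n γ ε δ) (i : ℕ) {f : Ω → ℝ} (hf : Measurable f) {c0 c1 c2 c3 : ℝ}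
    (hb : ∀ ω, |f ω - (c0 + c1 * X i ω + c2 * X i ω ^ 2)| ≤ c3 * |X i ω| ^ 3) :
    Integrable f P ∧ ∀ᵐ ω ∂P, |(P[f|F i]) ω - (c0 + c2 * sg P F X i ω)| ≤ c3 * bt P F X i ω := by
  obtain ⟨-, h1, h2⟩ := h.cube i
  have h3 := h.int3 i
  have hX := h.X_meas i
  set p : Ω → ℝ := (fun _ => c0) + (c1 • X i + c2 • (fun ω => X i ω ^ 2)) with hp
  have hpe : ∀ ω, p ω = c0 + c1 * X i ω + c2 * X i ω ^ 2 := by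
    intro ω; simp [hp]; ring
  have hpi : Integrable p P := (integrable_const _).add ((h1.smul c1).add (h2.smul c2))
  have hr : Integrable (f - p) P := by
    refine (h3.const_mul c3).mono' ?_ (Eventually.of_forall fun ω => ?_)
    · exact hf.aestronglyMeasurable.sub hpi.1
    · rw [Real.norm_eq_abs, Pi.sub_apply, hpe]; exact hb ω
  have hfi : Integrable f P := by
    have := hr.add hpi
    simpa using this
  refine ⟨hfi, ?_⟩
  have ep : P[p|F i] =ᵐ[P] fun ω => c0 + c2 * sg P F X i ω := by
    have a1 := condExp_add (m := F i) (integrable_const c0 (μ := P)) ((h1.smul c1).add (h2.smul c2))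
    have a2 := condExp_add (m := F i) (h1.smul c1) (h2.smul c2)
    have a3 := condExp_smul (μ := P) (m := F i) c1 (X i)
    have a4 := condExp_smul (μ := P) (m := F i) c2 (fun ω => X i ω ^ 2)
    filter_upwards [a1, a2, a3, a4, h.mz i] with ω b1 b2 b3 b4 b5
    rw [hp, b1, Pi.add_apply, b2, Pi.add_apply, b3, b4, condExp_const (h.le i)]
    simp [b5, sg]
  have er := condExp_sub (m := F i) hfi hpi
  have hi3 := h3.smul c3
  have e3 := condExp_smul (μ := P) (m := F i) c3 (fun ω => |X i ω| ^ 3)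
  have u := condExp_mono (m := F i) hr hi3 (Eventually.of_forall fun ω => by
    have := (abs_le.1 (hb ω)).2
    simp only [Pi.sub_apply, hpe, Pi.smul_apply, smul_eq_mul]; exact this)
  have hn3 := h3.smul (-c3)
  have en3 := condExp_smul (μ := P) (m := F i) (-c3) (fun ω => |X i ω| ^ 3)
  have v := condExp_mono (m := F i) hn3 hr (Eventually.of_forall fun ω => by
    have := (abs_le.1 (hb ω)).1
    simp only [Pi.sub_apply, hpe, Pi.smul_apply, smul_eq_mul]; linarith)
  filter_upwards [ep, er, e3, u, en3, v] with ω b1 b2 b3 b4 b5 b6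
  rw [b2, b3, Pi.sub_apply, b1] at b4
  rw [b2, b5, Pi.sub_apply, b1] at b6
  simp only [Pi.smul_apply, smul_eq_mul] at b4 b6
  rw [abs_le]
  unfold bt
  constructor <;> linarith

lemma basic (h : NH P F X n γ ε δ) (i : ℕ) :
    ∀ᵐ ω ∂P, 0 ≤ sg P F X i ω ∧ 0 ≤ bt P F X i ω ∧ bt P F X i ω ≤ γ * sg P F X i ω ∧ sg P F X i ω ≤ γ ^ 2 := by
  have s0 : 0 ≤ᵐ[P] sg P F X i := condExp_nonneg (Eventually.of_forall fun ω => by positivity)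
  have b0 : 0 ≤ᵐ[P] bt P F X i := condExp_nonneg (Eventually.of_forall fun ω => by positivity)
  have hX := h.X_meas i
  have hg := h.γ0
  have ha := (h.approx i (f := fun ω => 3 * γ * X i ω ^ 2 - 2 * |X i ω| ^ 3) (by fun_prop)
    (c0 := 0) (c1 := 0) (c2 := 3 * γ) (c3 := 2) (fun ω => by
      rw [show 3 * γ * X i ω ^ 2 - 2 * |X i ω| ^ 3 - (0 + 0 * X i ω + 3 * γ * X i ω ^ 2) = -(2 * |X i ω| ^ 3) by ring, abs_neg, abs_of_nonneg (by positivity)]))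
  have hm := condExp_mono (m := F i) ha.1 (integrable_const (γ ^ 3)) (Eventually.of_forall fun ω => by
    have h0 := abs_nonneg (X i ω)
    have : X i ω ^ 2 = |X i ω| ^ 2 := (sq_abs _).symm
    simp only [this]
    nlinarith [mul_nonneg (by positivity : 0 ≤ 2 * |X i ω| + γ) (sq_nonneg (|X i ω| - γ))])
  rw [condExp_const (h.le i)] at hm
  filter_upwards [s0, b0, h.A4 i, ha.2, hm] with ω a1 a2 a3 a4 a5
  refine ⟨a1, a2, a3, ?_⟩
  have := (abs_le.1 a4).1
  have a3' : bt P F X i ω ≤ γ * sg P F X i ω := a3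
  have : γ * sg P F X i ω ≤ γ * γ ^ 2 := by linarith [show γ * γ ^ 2 = γ ^ 3 by ring]
  exact le_of_mul_le_mul_left this hg

lemma wt_sm (h : NH P F X n γ ε δ) (l j : ℝ) (i : ℕ) : StronglyMeasurable[F (i+1)] (wt X l j i) := by
  have hX := (h.sm i).measurable
  have hX2 := hX.const_mul l
  exact (Real.measurable_exp.comp ((hX2.sub ((hX2.pow_const 2).div_const 2)).const_mul j)).stronglyMeasurable

lemma wt_cond (h : NH P F X n γ ε δ) (hl : 0 ≤ l) (hj1 : 0 ≤ j) (hj4 : j ≤ 4) (i : ℕ) :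
    ∀ᵐ ω ∂P, |(P[wt X l j i|F i]) ω - (1 + j * (j - 1) / 2 * l ^ 2 * sg P F X i ω)| ≤ 100000 * l ^ 3 * bt P F X i ω := by
  refine (h.approx i ((h.wt_sm l j i).mono (h.le _)).measurable (c1 := j * l) (fun ω => ?_)).2
  have := expo_e hj1 hj4 (l * X i ω)
  rw [abs_mul, abs_of_nonneg hl] at this
  unfold wt
  calc _ = _ := by congr 1; ring
    _ ≤ _ := this
    _ = _ := by ring

/-- elementary numeric consequences of smallness -/
lemma small {s b : ℝ} (hg : 0 < γ) (hl : 0 ≤ l) (hlg : l * γ ≤ 1 / 10 ^ 6) (hs : 0 ≤ s) (hb : 0 ≤ b) (hbs : b ≤ γ * s) (hsg : s ≤ γ ^ 2) :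
    l ^ 2 * s ≤ 1 / 10 ^ 12 ∧ 100000 * l ^ 3 * b ≤ 1 / 10 * (l ^ 2 * s) ∧ 0 ≤ l ^ 2 * s ∧ 0 ≤ l ^ 3 * b := by
  have h0 : 0 ≤ l * γ := by positivity
  refine ⟨?_, ?_, by positivity, by positivity⟩
  · calc l ^ 2 * s ≤ l ^ 2 * γ ^ 2 := by gcongr
      _ = (l * γ) ^ 2 := by ring
      _ ≤ (1 / 10 ^ 6) ^ 2 := by gcongr
      _ = _ := by norm_num
  · calc 100000 * l ^ 3 * b ≤ 100000 * l ^ 3 * (γ * s) := by gcongr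
      _ = 100000 * (l * γ) * (l ^ 2 * s) := by ring
      _ ≤ 100000 * (1 / 10 ^ 6) * (l ^ 2 * s) := by gcongr
      _ = _ := by norm_num

lemma tilt (h : NH P F X n γ ε δ) (hl : 0 ≤ l) (hlg : l * γ ≤ 1 / 10 ^ 6) (hj1 : 1 ≤ j) (hj4 : j ≤ 4) :
    Tilt P F (wt X l j) 16 where
  mono := h.mono
  le := h.le
  sm := h.wt_sm l j
  pos := fun i ω => Real.exp_pos _
  bd := fun i ω => expo_le16 (by linarith) hj4 _
  hq := fun i => by
    filter_upwards [h.wt_cond hl (by linarith) hj4 i, h.basic i] with ω h1 ⟨h2, h3, h4, h5⟩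
    obtain ⟨a1, a2, a3, a4⟩ := small h.γ0 hl hlg h2 h3 h4 h5
    have := (abs_le.1 h1).1
    have hjj : 0 ≤ j * (j - 1) / 2 := by have : 0 ≤ j - 1 := by linarith
                                         positivity
    have : 0 ≤ j * (j - 1) / 2 * (l ^ 2 * sg P F X i ω) := mul_nonneg hjj a3
    norm_num at a1
    linarith

lemma tq_cond (h : NH P F X n γ ε δ) (hl : 0 ≤ l) (hlg : l * γ ≤ 1 / 10 ^ 6) (hj1 : 1 ≤ j) (hj4 : j ≤ 4) (i : ℕ) :
    ∀ᵐ ω ∂P, |tq P F (wt X l j) i ω - (1 + j * (j - 1) / 2 * l ^ 2 * sg P F X i ω)| ≤ 100000 * l ^ 3 * bt P F X i ω := by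
  filter_upwards [h.wt_cond hl (by linarith) hj4 i, (h.tilt hl hlg hj1 hj4).q_eq i] with ω h1 h2
  rw [h2]; exact h1

/-- upper bound of the product of normalisations -/
lemma prod_le (h : NH P F X n γ ε δ) (hl : 0 ≤ l) (hlg : l * γ ≤ 1 / 10 ^ 6) (hj1 : 1 ≤ j) (hj4 : j ≤ 4) :
    ∀ᵐ ω ∂P, ∏ i ∈ Finset.range n, tq P F (wt X l j) i ω ≤
      Real.exp (j * (j - 1) / 2 * l ^ 2 * (1 + δ ^ 2) + 100000 * l ^ 3 * ε) := by
  have hq : ∀ᵐ ω ∂P, ∀ i, |tq P F (wt X l j) i ω - (1 + j * (j - 1) / 2 * l ^ 2 * sg P F X i ω)| ≤ 100000 * l ^ 3 * bt P F X i ω :=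
    ae_all_iff.2 fun i => h.tq_cond hl hlg hj1 hj4 i
  filter_upwards [hq, h.A1, h.A2] with ω h1 h2 h3
  have hjj : 0 ≤ j * (j - 1) / 2 := by have : 0 ≤ j - 1 := by linarith
                                       positivity
  calc _ ≤ ∏ i ∈ Finset.range n, Real.exp (j * (j - 1) / 2 * l ^ 2 * sg P F X i ω + 100000 * l ^ 3 * bt P F X i ω) := by
        refine Finset.prod_le_prod (fun i _ => (Tilt.q_pos i ω).le) fun i _ => ?_
        have a := (abs_le.1 (h1 i)).2
        have b := Real.add_one_le_exp (j * (j - 1) / 2 * l ^ 2 * sg P F X i ω + 100000 * l ^ 3 * bt P F X i ω)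
        linarith
    _ = Real.exp (j * (j - 1) / 2 * l ^ 2 * ∑ i ∈ Finset.range n, sg P F X i ω + 100000 * l ^ 3 * ∑ i ∈ Finset.range n, bt P F X i ω) := by
        rw [← Real.exp_sum, Finset.sum_add_distrib, Finset.mul_sum, Finset.mul_sum]
    _ ≤ _ := by
        have h4 : ∑ i ∈ Finset.range n, sg P F X i ω ≤ 1 + δ ^ 2 := by
          have := (abs_le.1 h2).2; unfold sg; linarith
        have h5 : ∑ i ∈ Finset.range n, bt P F X i ω ≤ ε := h3
        gcongr

lemma exp_low {a : ℝ} (h1 : -(1 / 2) ≤ a) (h2 : a ≤ 1 / 2) : Real.exp (a - 2 * a ^ 2) ≤ 1 + a := by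
  have h : 0 < 1 + a := by linarith
  rw [← Real.le_log_iff_exp_le h]
  have h3 := Real.one_sub_inv_le_log_of_pos (x := (1 + a)) h
  by_cases ha : 0 ≤ a
  · refine le_trans ?_ h3
    have : 1 - (1 + a)⁻¹ = a / (1 + a) := by field_simp; ring
    rw [this, le_div_iff₀ h]
    nlinarith [mul_nonneg ha (sq_nonneg a)]
  · push Not at ha
    have hx : |a| < 1 := by rw [abs_lt]; constructor <;> linarith
    have h4 := Real.abs_log_sub_add_sum_range_le (x := -a) (by rw [abs_neg]; exact hx) 1
    simp at h4
    have h5 := (abs_le.1 h4).1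
    rw [abs_of_neg ha] at h5
    have h6 : a ^ 2 / (1 - -a) ≤ 2 * a ^ 2 := by
      rw [div_le_iff₀ (by linarith)]; nlinarith [sq_nonneg a]
    linarith

/-- lower bound of the product, j = 1 -/
lemma prod_ge1 (h : NH P F X n γ ε δ) (hl : 0 ≤ l) (hlg : l * γ ≤ 1 / 10 ^ 6) :
    ∀ᵐ ω ∂P, Real.exp (-(200000 * l ^ 3 * ε)) ≤ ∏ i ∈ Finset.range n, tq P F (wt X l 1) i ω := by
  have hq : ∀ᵐ ω ∂P, ∀ i, |tq P F (wt X l 1) i ω - (1 + 1 * (1 - 1) / 2 * l ^ 2 * sg P F X i ω)| ≤ 100000 * l ^ 3 * bt P F X i ω :=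
    ae_all_iff.2 fun i => h.tq_cond hl hlg (by norm_num) (by norm_num) i
  have hb := ae_all_iff.2 h.basic
  filter_upwards [hq, hb, h.A2] with ω h1 hb h3
  calc _ ≤ Real.exp (-(200000 * l ^ 3 * ∑ i ∈ Finset.range n, bt P F X i ω)) := by
        have h5 : ∑ i ∈ Finset.range n, bt P F X i ω ≤ ε := h3
        gcongr
    _ = ∏ i ∈ Finset.range n, Real.exp (-(200000 * l ^ 3 * bt P F X i ω)) := by
        rw [← Real.exp_sum, Finset.sum_neg_distrib, Finset.mul_sum]
    _ ≤ _ := by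
        refine Finset.prod_le_prod (fun i _ => (Real.exp_pos _).le) fun i _ => ?_
        obtain ⟨h2, h3, h4, h5⟩ := hb i
        obtain ⟨a1, a2, a3, a4⟩ := small h.γ0 hl hlg h2 h3 h4 h5
        have a := (abs_le.1 (h1 i)).1
        set u := 100000 * l ^ 3 * bt P F X i ω with hu
        have hu0 : 0 ≤ u := by rw [hu]; nlinarith
        norm_num at a1
        have b := exp_low (a := -u) (by linarith) (by linarith)
        have c : Real.exp (-(200000 * l ^ 3 * bt P F X i ω)) ≤ Real.exp (-u - 2 * (-u) ^ 2) := by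
          apply Real.exp_le_exp.2
          have : 200000 * l ^ 3 * bt P F X i ω = 2 * u := by rw [hu]; ring
          rw [this]; nlinarith
        linarith

/-- lower bound of the product, j = 2 -/
lemma prod_ge2 (h : NH P F X n γ ε δ) (hl : 0 ≤ l) (hlg : l * γ ≤ 1 / 10 ^ 6) :
    ∀ᵐ ω ∂P, Real.exp (7 / 10 * l ^ 2) ≤ ∏ i ∈ Finset.range n, tq P F (wt X l 2) i ω := by
  have hq : ∀ᵐ ω ∂P, ∀ i, |tq P F (wt X l 2) i ω - (1 + 2 * (2 - 1) / 2 * l ^ 2 * sg P F X i ω)| ≤ 100000 * l ^ 3 * bt P F X i ω :=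
    ae_all_iff.2 fun i => h.tq_cond hl hlg (by norm_num) (by norm_num) i
  have hb := ae_all_iff.2 h.basic
  filter_upwards [hq, hb, h.A1] with ω h1 hb h3
  calc _ ≤ Real.exp (8 / 10 * l ^ 2 * ∑ i ∈ Finset.range n, sg P F X i ω) := by
        have h4 : 15 / 16 ≤ ∑ i ∈ Finset.range n, sg P F X i ω := by
          have := (abs_le.1 h3).1
          have h5 : δ ^ 2 ≤ (1 / 4) ^ 2 := by have := h.δ0; have := h.δ1; gcongr
          unfold sg; linarith
        apply Real.exp_le_exp.2
        nlinarith [sq_nonneg l]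
    _ = ∏ i ∈ Finset.range n, Real.exp (8 / 10 * l ^ 2 * sg P F X i ω) := by
        rw [← Real.exp_sum, Finset.mul_sum]
    _ ≤ _ := by
        refine Finset.prod_le_prod (fun i _ => (Real.exp_pos _).le) fun i _ => ?_
        obtain ⟨h2, h3, h4, h5⟩ := hb i
        obtain ⟨a1, a2, a3, a4⟩ := small h.γ0 hl hlg h2 h3 h4 h5
        have a := (abs_le.1 (h1 i)).1
        set u := l ^ 2 * sg P F X i ω with hu
        norm_num at a1
        have b := exp_low (a := 9 / 10 * u) (by linarith) (by linarith)
        have c : Real.exp (8 / 10 * l ^ 2 * sg P F X i ω) ≤ Real.exp (9 / 10 * u - 2 * (9 / 10 * u) ^ 2) := by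
          apply Real.exp_le_exp.2
          have : 8 / 10 * l ^ 2 * sg P F X i ω = 8 / 10 * u := by rw [hu]; ring
          rw [this]; nlinarith
        have d : 2 * (2 - 1) / 2 * l ^ 2 * sg P F X i ω = u := by rw [hu]; ring
        linarith

end NH
end SN

namespace SN
set_option linter.unusedSectionVars false
set_option linter.deprecated false

/-- self-normalised increment -/
noncomputable def et {Ω : Type} (X : ℕ → Ω → ℝ) (l : ℝ) (i : ℕ) (ω : Ω) : ℝ := X i ω * (1 - l * X i ω / 2)

/-- tilted drift -/
noncomputable def tm {Ω : Type} [mΩ : MeasurableSpace Ω] (P : Measure Ω) (F : ℕ → MeasurableSpace Ω)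
    (X : ℕ → Ω → ℝ) (l : ℝ) (i : ℕ) (ω : Ω) : ℝ :=
  (P[fun ω' => wt X l 1 i ω' * et X l i ω'|F i]) ω / tq P F (wt X l 1) i ω

lemma num_m {p q s b l K : ℝ} (hK : 0 ≤ K) (hl : 0 ≤ l) (hb : 0 ≤ b) (hs : 0 ≤ s) (hq : 1 / 2 ≤ q)
    (h1 : |q - 1| ≤ K * l ^ 3 * b) (h2 : |p - l / 2 * s| ≤ K * l ^ 2 * b) (h3 : l ^ 2 * s ≤ 1 / 2) :
    |p / q - l * s / 2| ≤ 3 * K * l ^ 2 * b := by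
  have hq0 : 0 < q := by linarith
  have e : p / q - l * s / 2 = (p - l / 2 * s - (q - 1) * (l * s / 2)) / q := by field_simp; ring
  rw [e, abs_div, abs_of_pos hq0, div_le_iff₀ hq0]
  have h4 : |(q - 1) * (l * s / 2)| ≤ K * l ^ 2 * b / 4 := by
    rw [abs_mul, abs_of_nonneg (by positivity : 0 ≤ l * s / 2)]
    calc _ ≤ K * l ^ 3 * b * (l * s / 2) := by gcongr
      _ = K * l ^ 2 * b / 2 * (l ^ 2 * s) := by ring
      _ ≤ K * l ^ 2 * b / 2 * (1 / 2) := by gcongr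
      _ = _ := by ring
  have h5 : 0 ≤ K * l ^ 2 * b := by positivity
  have h6 : K * l ^ 2 * b * (1 / 2) ≤ K * l ^ 2 * b * q := by gcongr
  have h7 := abs_sub (p - l / 2 * s) ((q - 1) * (l * s / 2))
  linarith

lemma num_s {p q s b l K : ℝ} (hK : 0 ≤ K) (hl : 0 ≤ l) (hb : 0 ≤ b) (hs : 0 ≤ s) (hq : 1 / 2 ≤ q)
    (h1 : |q - 1| ≤ K * l ^ 3 * b) (h2 : |p - s| ≤ K * l * b) (h3 : l ^ 2 * s ≤ 1 / 2) :
    |p / q - s| ≤ 3 * K * l * b := by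
  have hq0 : 0 < q := by linarith
  have e : p / q - s = (p - s - (q - 1) * s) / q := by field_simp; ring
  rw [e, abs_div, abs_of_pos hq0, div_le_iff₀ hq0]
  have h4 : |(q - 1) * s| ≤ K * l * b / 2 := by
    rw [abs_mul, abs_of_nonneg hs]
    calc _ ≤ K * l ^ 3 * b * s := by gcongr
      _ = K * l * b * (l ^ 2 * s) := by ring
      _ ≤ K * l * b * (1 / 2) := by gcongr
      _ = _ := by ring
  have h5 : 0 ≤ K * l * b := by positivity
  have h6 : K * l * b * (1 / 2) ≤ K * l * b * q := by gcongr
  have h7 := abs_sub (p - s) ((q - 1) * s)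
  linarith

namespace NH
variable {Ω : Type} [mΩ : MeasurableSpace Ω] {P : Measure Ω} [IsProbabilityMeasure P]
  {F : ℕ → MeasurableSpace Ω} {X : ℕ → Ω → ℝ} {n : ℕ} {γ ε δ l j : ℝ}

lemma et_sm (h : NH P F X n γ ε δ) (l : ℝ) (i : ℕ) : StronglyMeasurable[F (i+1)] (et X l i) := by
  have hX := (h.sm i).measurable
  exact (hX.mul (((hX.const_mul l).div_const 2).const_sub 1)).stronglyMeasurable

lemma et_meas (h : NH P F X n γ ε δ) (l : ℝ) (i : ℕ) : Measurable (et X l i) :=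
  ((h.et_sm l i).mono (h.le _)).measurable

lemma wt_meas (h : NH P F X n γ ε δ) (l j : ℝ) (i : ℕ) : Measurable (wt X l j i) :=
  ((h.wt_sm l j i).mono (h.le _)).measurable

lemma et1 (h : NH P F X n γ ε δ) (hl : 0 ≤ l) (i : ℕ) :
    Integrable (fun ω => wt X l 1 i ω * et X l i ω) P ∧
    ∀ᵐ ω ∂P, |(P[fun ω' => wt X l 1 i ω' * et X l i ω'|F i]) ω - (0 + l / 2 * sg P F X i ω)| ≤ 100000 * l ^ 2 * bt P F X i ω := by
  refine h.approx i (f := fun ω => wt X l 1 i ω * et X l i ω) ((h.wt_meas l 1 i).mul (h.et_meas l i)) (c1 := 1) (fun ω => ?_)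
  have := expo_b (l * X i ω)
  simp only [wt, et, one_mul]
  calc _ = |X i ω * (Real.exp (l * X i ω - (l * X i ω) ^ 2 / 2) * (1 - l * X i ω / 2) - (1 + l * X i ω / 2))| := by congr 1; ring
    _ ≤ |X i ω| * (100000 * (l * X i ω) ^ 2) := by rw [abs_mul]; gcongr
    _ = 100000 * l ^ 2 * (|X i ω| * X i ω ^ 2) := by ring
    _ = _ := by rw [← sq_abs (X i ω)]; ring

lemma et2 (h : NH P F X n γ ε δ) (hl : 0 ≤ l) (i : ℕ) :
    Integrable (fun ω => wt X l 1 i ω * et X l i ω ^ 2) P ∧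
    ∀ᵐ ω ∂P, |(P[fun ω' => wt X l 1 i ω' * et X l i ω' ^ 2|F i]) ω - (0 + 1 * sg P F X i ω)| ≤ 100000 * l * bt P F X i ω := by
  refine h.approx i (f := fun ω => wt X l 1 i ω * et X l i ω ^ 2) ((h.wt_meas l 1 i).mul ((h.et_meas l i).pow_const 2)) (c1 := 0) (fun ω => ?_)
  have := expo_c (l * X i ω)
  simp only [wt, et, one_mul]
  calc _ = |X i ω ^ 2 * (Real.exp (l * X i ω - (l * X i ω) ^ 2 / 2) * (1 - l * X i ω / 2) ^ 2 - 1)| := by congr 1; ring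
    _ ≤ X i ω ^ 2 * (100000 * |l * X i ω|) := by rw [abs_mul, abs_of_nonneg (sq_nonneg _)]; gcongr
    _ = 100000 * l * (|X i ω| * X i ω ^ 2) := by rw [abs_mul, abs_of_nonneg hl]; ring
    _ = _ := by rw [← sq_abs (X i ω)]; ring

lemma et3 (h : NH P F X n γ ε δ) (i : ℕ) :
    Integrable (fun ω => wt X l 1 i ω * |et X l i ω| ^ 3) P ∧
    ∀ᵐ ω ∂P, |(P[fun ω' => wt X l 1 i ω' * |et X l i ω'| ^ 3|F i]) ω - (0 + 0 * sg P F X i ω)| ≤ 100000 * bt P F X i ω := by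
  refine h.approx i (f := fun ω => wt X l 1 i ω * |et X l i ω| ^ 3) ((h.wt_meas l 1 i).mul ((measurable_abs.comp (h.et_meas l i)).pow_const 3)) (c1 := 0) (fun ω => ?_)
  have := expo_d (l * X i ω)
  simp only [wt, et, one_mul]
  have h0 := Real.exp_pos (l * X i ω - (l * X i ω) ^ 2 / 2)
  calc _ = |X i ω| ^ 3 * (Real.exp (l * X i ω - (l * X i ω) ^ 2 / 2) * |1 - l * X i ω / 2| ^ 3) := by
        rw [abs_of_nonneg]
        · rw [abs_mul]; ring
        · have : 0 ≤ Real.exp (l * X i ω - (l * X i ω) ^ 2 / 2) * |X i ω * (1 - l * X i ω / 2)| ^ 3 := by positivity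
          linarith
    _ ≤ |X i ω| ^ 3 * 100000 := by gcongr
    _ = _ := by ring

lemma tq1 (h : NH P F X n γ ε δ) (hl : 0 ≤ l) (hlg : l * γ ≤ 1 / 10 ^ 6) (i : ℕ) :
    ∀ᵐ ω ∂P, |tq P F (wt X l 1) i ω - 1| ≤ 100000 * l ^ 3 * bt P F X i ω := by
  filter_upwards [h.tq_cond hl hlg (j := 1) (by norm_num) (by norm_num) i] with ω h1
  simpa using h1

lemma tm_sm (i : ℕ) : StronglyMeasurable[F i] (tm P F X l i) :=
  (stronglyMeasurable_condExp.measurable.div (Tilt.q_sm i).measurable).stronglyMeasurable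

lemma tm_bd (h : NH P F X n γ ε δ) (hl : 0 ≤ l) (hlg : l * γ ≤ 1 / 10 ^ 6) (i : ℕ) :
    ∀ᵐ ω ∂P, |tm P F X l i ω - l * sg P F X i ω / 2| ≤ 300000 * l ^ 2 * bt P F X i ω ∧
      |tm P F X l i ω| ≤ l * sg P F X i ω := by
  filter_upwards [h.tq1 hl hlg i, (h.et1 hl i).2, h.basic i] with ω h1 h2 ⟨b1, b2, b3, b4⟩
  obtain ⟨a1, a2, a3, a4⟩ := small h.γ0 hl hlg b1 b2 b3 b4
  rw [zero_add] at h2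
  have h3 := num_m (by norm_num) hl b2 b1 (Tilt.q_ge i ω) h1 h2 (by norm_num at a1 ⊢; linarith)
  have h4 : |tm P F X l i ω - l * sg P F X i ω / 2| ≤ 300000 * l ^ 2 * bt P F X i ω := by
    refine h3.trans (le_of_eq (by ring))
  refine ⟨h4, ?_⟩
  have h5 : 300000 * l ^ 2 * bt P F X i ω ≤ 3 / 10 * (l * sg P F X i ω) := by
    calc _ ≤ 300000 * l ^ 2 * (γ * sg P F X i ω) := by gcongr
      _ = 300000 * (l * γ) * (l * sg P F X i ω) := by ring
      _ ≤ 300000 * (1 / 10 ^ 6) * (l * sg P F X i ω) := by gcongr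
      _ = _ := by norm_num
  have h6 := abs_sub_abs_le_abs_sub (tm P F X l i ω) (l * sg P F X i ω / 2)
  have h7 : 0 ≤ l * sg P F X i ω := by positivity
  rw [abs_of_nonneg (by linarith : 0 ≤ l * sg P F X i ω / 2)] at h6
  linarith

lemma cube_sub (a b : ℝ) : |a - b| ^ 3 ≤ 4 * |a| ^ 3 + 4 * |b| ^ 3 := by
  have h := abs_sub a b
  have ha := abs_nonneg a
  have hb := abs_nonneg b
  calc |a - b| ^ 3 ≤ (|a| + |b|) ^ 3 := by gcongr
    _ ≤ _ := by nlinarith [mul_nonneg (add_nonneg ha hb) (sq_nonneg (|a| - |b|))]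

lemma beh_aux (h : NH P F X n γ ε δ) (hl : 0 ≤ l) (hlg : l * γ ≤ 1 / 10 ^ 6) {i : ℕ} (hin : i < n) :
    Integrable (fun ω => |et X l i ω - tm P F X l i ω| ^ 3) (tQ P F (wt X l 1) n) ∧
    ((tQ P F (wt X l 1) n)[fun ω => et X l i ω - tm P F X l i ω|F i] =ᵐ[tQ P F (wt X l 1) n] 0) ∧
    (∀ᵐ ω ∂(tQ P F (wt X l 1) n),
      |((tQ P F (wt X l 1) n)[fun ω' => (et X l i ω' - tm P F X l i ω') ^ 2|F i]) ω - sg P F X i ω| ≤ 500000 * (l * γ) * sg P F X i ω) ∧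
    (∀ᵐ ω ∂(tQ P F (wt X l 1) n),
      ((tQ P F (wt X l 1) n)[fun ω' => |et X l i ω' - tm P F X l i ω'| ^ 3|F i]) ω ≤ 900000 * γ * sg P F X i ω) := by
  have ht := h.tilt hl hlg (j := 1) (by norm_num) (by norm_num)
  have hQ := ht.Q_prob n
  have hac := Tilt.Q_ac (P := P) (F := F) (w := wt X l 1) n
  set Q := tQ P F (wt X l 1) n with hQd
  set η := et X l i with hη
  set m := tm P F X l i with hm
  have hms : StronglyMeasurable[F i] m := tm_sm i
  have hmm : Measurable m := (hms.mono (h.le i)).measurable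
  have hηm : Measurable η := h.et_meas l i
  obtain ⟨i1, e1⟩ := ht.T2 hin (h.et_sm l i) (h.et1 hl i).1
  obtain ⟨i2, e2⟩ := ht.T2 hin (((h.et_sm l i).measurable.pow_const 2).stronglyMeasurable) (h.et2 hl i).1
  obtain ⟨i3, e3⟩ := ht.T2 hin ((measurable_abs.comp (h.et_sm l i).measurable).pow_const 3).stronglyMeasurable (h.et3 (l := l) i).1
  simp only [Function.comp_apply] at i3 e3
  rw [← hQd] at i1 i2 i3 e1 e2 e3
  have hmb := hac.ae_le (h.tm_bd hl hlg i)
  have hbas := hac.ae_le (h.basic i)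
  have hmK : ∀ᵐ ω ∂Q, |m ω| ≤ l * γ ^ 2 := by
    filter_upwards [hmb, hbas] with ω h1 h2
    exact h1.2.trans (by have := h2.2.2.2; gcongr)
  have hmi : Integrable m Q := (integrable_const (l * γ ^ 2)).mono' hmm.aestronglyMeasurable hmK
  have hmηi : Integrable (fun ω => m ω * η ω) Q := bdd_int hmm.aestronglyMeasurable hmK i1
  have hm2i : Integrable (fun ω => m ω * m ω) Q := bdd_int hmm.aestronglyMeasurable hmK hmi
  have hm3i : Integrable (fun ω => |m ω| ^ 3) Q := by
    refine (integrable_const ((l * γ ^ 2) ^ 3)).mono' (by fun_prop) ?_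
    filter_upwards [hmK] with ω h1
    rw [Real.norm_eq_abs, abs_of_nonneg (by positivity)]
    gcongr
  have hm3s : StronglyMeasurable[F i] (fun ω => |m ω| ^ 3) := ((measurable_abs.comp hms.measurable).pow_const 3).stronglyMeasurable
  have hub : Integrable (fun ω => 4 * |η ω| ^ 3 + 4 * |m ω| ^ 3) Q := (i3.const_mul 4).add (hm3i.const_mul 4)
  have h3i : Integrable (fun ω => |η ω - m ω| ^ 3) Q := by
    refine hub.mono' (by fun_prop) (Eventually.of_forall fun ω => ?_)
    rw [Real.norm_eq_abs, abs_of_nonneg (by positivity)]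
    exact cube_sub _ _
  refine ⟨h3i, ?_, ?_, ?_⟩
  · have a1 := condExp_sub (m := F i) i1 hmi
    have a2 := condExp_of_stronglyMeasurable (h.le i) hms hmi
    filter_upwards [a1, e1] with ω b1 b2
    have : (Q[fun ω => η ω - m ω|F i]) ω = (Q[η|F i]) ω - (Q[m|F i]) ω := b1
    rw [this, a2, b2]
    simp [hm, tm, hη]
  · have a0 : (fun ω => (η ω - m ω) ^ 2) = ((fun ω => η ω ^ 2) - ((2:ℝ) • (fun ω => m ω * η ω))) + fun ω => m ω * m ω := by
      funext ω; simp; ring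
    have a1 := condExp_add (m := F i) (i2.sub (hmηi.smul (2:ℝ))) hm2i
    have a2 := condExp_sub (m := F i) i2 (hmηi.smul (2:ℝ))
    have a3 := condExp_smul (μ := Q) (m := F i) (2:ℝ) (fun ω => m ω * η ω)
    have a4 := condExp_mul_of_stronglyMeasurable_left (μ := Q) hms hmηi i1
    have a5 := condExp_of_stronglyMeasurable (h.le i) (hms.mul hms) hm2i
    have t1 := hac.ae_le (h.tq1 hl hlg i)
    have t2 := hac.ae_le (h.et2 hl i).2
    filter_upwards [a1, a2, a3, a4, e1, e2, t1, t2, hmb, hbas] with ω b1 b2 b3 b4 b5 b6 h1 h2 h3 ⟨c1, c2, c3, c4⟩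
    have hkey : (Q[fun ω => (η ω - m ω) ^ 2|F i]) ω = (P[fun ω' => wt X l 1 i ω' * η ω' ^ 2|F i]) ω / tq P F (wt X l 1) i ω - m ω ^ 2 := by
      have b4' : (Q[fun ω => m ω * η ω|F i]) ω = m ω * (Q[η|F i]) ω := b4
      have b5' : (Q[η|F i]) ω = m ω := by rw [b5]; rfl
      have a5' : (Q[fun ω => m ω * m ω|F i]) ω = m ω * m ω := congrFun a5 ω
      rw [a0, b1, Pi.add_apply, b2, Pi.sub_apply, b3, Pi.smul_apply, b4', b5', a5', b6, smul_eq_mul]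
      ring
    rw [hkey]
    rw [zero_add, one_mul] at h2
    obtain ⟨a1, a2, a3, a4⟩ := small h.γ0 hl hlg c1 c2 c3 c4
    have h5 := num_s (by norm_num) hl c2 c1 (Tilt.q_ge i ω) h1 h2 (by norm_num at a1 ⊢; linarith)
    have hγ := h.γ0
    have h6 : 3 * 100000 * l * bt P F X i ω ≤ 300000 * (l * γ) * sg P F X i ω := by
      calc _ ≤ 3 * 100000 * l * (γ * sg P F X i ω) := by gcongr
        _ = _ := by ring
    have h7 : m ω ^ 2 ≤ (l * γ) * sg P F X i ω := by
      calc m ω ^ 2 = |m ω| ^ 2 := (sq_abs _).symm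
        _ ≤ (l * sg P F X i ω) ^ 2 := by have := h3.2; gcongr
        _ = l ^ 2 * sg P F X i ω * sg P F X i ω := by ring
        _ ≤ l ^ 2 * γ ^ 2 * sg P F X i ω := by gcongr
        _ = (l * γ) * (l * γ) * sg P F X i ω := by ring
        _ ≤ (l * γ) * 1 * sg P F X i ω := by
            have : l * γ ≤ 1 := hlg.trans (by norm_num)
            gcongr
        _ = _ := by ring
    have h8 := sq_nonneg (m ω)
    rw [abs_le] at h5 ⊢
    constructor <;> nlinarith [h5.1, h5.2, mul_nonneg (mul_nonneg hl hγ.le) c1]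
  · have a1 := condExp_mono (m := F i) h3i hub (Eventually.of_forall fun ω => cube_sub _ _)
    have a2 := condExp_add (m := F i) (i3.smul (4:ℝ)) (hm3i.smul (4:ℝ))
    have a3 := condExp_smul (μ := Q) (m := F i) (4:ℝ) (fun ω => |η ω| ^ 3)
    have a4 := condExp_smul (μ := Q) (m := F i) (4:ℝ) (fun ω => |m ω| ^ 3)
    have a5 := condExp_of_stronglyMeasurable (h.le i) hm3s hm3i
    have t3 := hac.ae_le (h.et3 (l := l) i).2
    filter_upwards [a1, a2, a3, a4, e3, t3, hmb, hbas] with ω b1 b2 b3 b4 b6 h2 h3 ⟨c1, c2, c3, c4⟩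
    have hγ := h.γ0
    have b2' : (Q[fun ω => 4 * |η ω| ^ 3 + 4 * |m ω| ^ 3|F i]) ω = 4 * (Q[fun ω => |η ω| ^ 3|F i]) ω + 4 * |m ω| ^ 3 := by
      have : (fun ω => 4 * |η ω| ^ 3 + 4 * |m ω| ^ 3) = ((4:ℝ) • (fun ω => |η ω| ^ 3)) + ((4:ℝ) • (fun ω => |m ω| ^ 3)) := by
        funext ω; simp
      rw [this, b2, Pi.add_apply, b3, b4, Pi.smul_apply, Pi.smul_apply, congrFun a5 ω]; simp
    rw [b2'] at b1
    refine b1.trans ?_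
    rw [zero_mul, zero_add, sub_zero] at h2
    have b6' : (Q[fun ω => |η ω| ^ 3|F i]) ω = (P[fun ω' => wt X l 1 i ω' * |η ω'| ^ 3|F i]) ω / tq P F (wt X l 1) i ω := b6
    have h4 : (Q[fun ω => |η ω| ^ 3|F i]) ω ≤ 200000 * γ * sg P F X i ω := by
      rw [b6', div_le_iff₀ (Tilt.q_pos i ω)]
      have q := Tilt.q_ge (P := P) (F := F) (w := wt X l 1) i ω
      calc _ ≤ 100000 * bt P F X i ω := (le_abs_self _).trans h2
        _ ≤ 100000 * (γ * sg P F X i ω) := by gcongr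
        _ = 200000 * γ * sg P F X i ω * (1 / 2) := by ring
        _ ≤ _ := by gcongr
    have h7 : |m ω| ^ 3 ≤ γ * sg P F X i ω := by
      have h9 : l * sg P F X i ω ≤ γ := by
        calc l * sg P F X i ω ≤ l * γ ^ 2 := by gcongr
          _ = (l * γ) * γ := by ring
          _ ≤ 1 * γ := by have : l * γ ≤ 1 := hlg.trans (by norm_num)
                          gcongr
          _ = γ := one_mul _
      have h10 : l ^ 2 * sg P F X i ω ≤ 1 := (small h.γ0 hl hlg c1 c2 c3 c4).1.trans (by norm_num)
      calc |m ω| ^ 3 ≤ (l * sg P F X i ω) ^ 3 := by have := h3.2; gcongr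
        _ = (l * sg P F X i ω) * (l ^ 2 * sg P F X i ω) * sg P F X i ω := by ring
        _ ≤ γ * 1 * sg P F X i ω := by gcongr
        _ = _ := by ring
    nlinarith [mul_nonneg hγ.le c1]

lemma beh (h : NH P F X n γ ε δ) (hl : 0 ≤ l) (hlg : l * γ ≤ 1 / 10 ^ 6) (hg : 900000 * γ ≤ 1 / 4) :
    BEH (tQ P F (wt X l 1) n) F (fun i ω => et X l i ω - tm P F X l i ω) (sg P F X) n (900000 * γ) (500000 * (l * γ)) δ := by
  have ht := h.tilt hl hlg (j := 1) (by norm_num) (by norm_num)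
  have hQ := ht.Q_prob n
  have hac := Tilt.Q_ac (P := P) (F := F) (w := wt X l 1) n
  have hγ := h.γ0
  have hz : ∀ i, n ≤ i → (fun ω => et X l i ω - tm P F X l i ω) = 0 ∧ sg P F X i = 0 := by
    intro i hi
    have h0 := h.zero i hi
    have he : ∀ ω, et X l i ω = 0 := fun ω => by simp [et, h0]
    constructor
    · funext ω
      have : (fun ω' => wt X l 1 i ω' * et X l i ω') = 0 := by funext ω'; simp [he]
      simp only [he, tm, this, condExp_zero]; simp
    · unfold sg
      have : (fun ω' => X i ω' ^ 2) = 0 := by funext ω'; simp [h0]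
      rw [this, condExp_zero]
  refine { mono := h.mono, le := h.le, sm := ?_, vsm := fun i => stronglyMeasurable_condExp, int3 := ?_, mz := ?_, v0 := ?_, vg := ?_, c2 := ?_, c3 := ?_, tot := hac.ae_le h.A1, g0 := by positivity, g1 := hg, θ0 := by positivity, θ1 := by norm_num at hlg ⊢; linarith, δ0 := h.δ0, δ1 := h.δ1 }
  · intro i
    exact ((h.et_sm l i).measurable.sub ((tm_sm i).measurable.mono (h.mono (Nat.le_succ i)) le_rfl)).stronglyMeasurable
  · intro i
    rcases lt_or_ge i n with hi | hi
    · exact (h.beh_aux hl hlg hi).1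
    · have e : ∀ ω, et X l i ω - tm P F X l i ω = 0 := congrFun (hz i hi).1
      simp [e]
  · intro i
    rcases lt_or_ge i n with hi | hi
    · exact (h.beh_aux hl hlg hi).2.1
    · rw [(hz i hi).1, condExp_zero]
  · intro i
    filter_upwards [hac.ae_le (h.basic i)] with ω hω using hω.1
  · intro i
    filter_upwards [hac.ae_le (h.basic i)] with ω hω
    exact hω.2.2.2.trans (by gcongr; linarith)
  · intro i
    rcases lt_or_ge i n with hi | hi
    · exact (h.beh_aux hl hlg hi).2.2.1
    · have e : ∀ ω, et X l i ω - tm P F X l i ω = 0 := congrFun (hz i hi).1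
      have e2 : (fun ω' => (et X l i ω' - tm P F X l i ω') ^ 2) = 0 := by funext ω; simp [e]
      simp only [e2, (hz i hi).2, condExp_zero]; simp
  · intro i
    rcases lt_or_ge i n with hi | hi
    · exact (h.beh_aux hl hlg hi).2.2.2
    · have e : ∀ ω, et X l i ω - tm P F X l i ω = 0 := congrFun (hz i hi).1
      have e2 : (fun ω' => |et X l i ω' - tm P F X l i ω'| ^ 3) = 0 := by funext ω; simp [e]
      simp only [e2, (hz i hi).2, condExp_zero]; simp

end NH
end SN

namespace SN
set_option linter.unusedSectionVars false
set_option linter.deprecated false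

/-- quadratic variation -/
def qv {Ω : Type} (X : ℕ → Ω → ℝ) (n : ℕ) (ω : Ω) : ℝ := ∑ i ∈ Finset.range n, X i ω ^ 2

/-- self-normalised sum -/
noncomputable def sn {Ω : Type} (X : ℕ → Ω → ℝ) (n : ℕ) (ω : Ω) : ℝ := ps X n ω / Real.sqrt (qv X n ω)

lemma qv_nonneg {Ω : Type} (X : ℕ → Ω → ℝ) (n : ℕ) (ω : Ω) : 0 ≤ qv X n ω :=
  Finset.sum_nonneg fun i _ => sq_nonneg _

lemma contain {Ω : Type} (X : ℕ → Ω → ℝ) (n : ℕ) (ω : Ω) {x l : ℝ} (hx : 0 ≤ x) (hl : 0 < l)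
    (h : x ^ 2 / 2 ≤ l * ps X n ω - l ^ 2 * qv X n ω / 2) : x ≤ sn X n ω := by
  unfold sn
  have hV := qv_nonneg X n ω
  rcases hV.eq_or_lt with h0 | h0
  · have hz : ∀ i ∈ Finset.range n, X i ω ^ 2 = 0 :=
      (Finset.sum_eq_zero_iff_of_nonneg fun i _ => sq_nonneg _).1 h0.symm
    have hs : ps X n ω = 0 := Finset.sum_eq_zero fun i hi => by simpa using hz i hi
    rw [← h0, hs] at h
    rw [← h0, hs]
    have : x = 0 := by nlinarith
    simp [this]
  · have hr := Real.sqrt_pos.2 h0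
    have hr2 := Real.sq_sqrt hV
    rw [le_div_iff₀ hr]
    set r := Real.sqrt (qv X n ω)
    rw [← hr2] at h
    have : l * (x * r) ≤ l * ps X n ω := by nlinarith [sq_nonneg (x - l * r)]
    exact le_of_mul_le_mul_left this hl

lemma prod_wt {Ω : Type} (X : ℕ → Ω → ℝ) (n : ℕ) (l j : ℝ) (ω : Ω) :
    ∏ i ∈ Finset.range n, wt X l j i ω = Real.exp (j * (l * ps X n ω - l ^ 2 * qv X n ω / 2)) := by
  unfold wt ps qv
  rw [← Real.exp_sum, ← Finset.mul_sum, Finset.sum_sub_distrib, ← Finset.mul_sum, ← Finset.sum_div, Finset.mul_sum (a := l ^ 2)]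
  simp only [mul_pow]

namespace NH
variable {Ω : Type} [mΩ : MeasurableSpace Ω] {P : Measure Ω} [IsProbabilityMeasure P]
  {F : ℕ → MeasurableSpace Ω} {X : ℕ → Ω → ℝ} {n : ℕ} {γ ε δ l j x : ℝ}

lemma ps_meas (h : NH P F X n γ ε δ) : Measurable (ps X n) := by
  have : ps X n = fun ω => ∑ i ∈ Finset.range n, X i ω := rfl
  rw [this]
  exact Finset.measurable_fun_sum _ fun i _ => h.X_meas i

lemma qv_meas (h : NH P F X n γ ε δ) : Measurable (qv X n) := by
  have : qv X n = fun ω => ∑ i ∈ Finset.range n, X i ω ^ 2 := rfl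
  rw [this]
  exact Finset.measurable_fun_sum _ fun i _ => (h.X_meas i).pow_const 2

/-- the exponential functional -/
noncomputable def ZZ {Ω : Type} (X : ℕ → Ω → ℝ) (n : ℕ) (l : ℝ) (ω : Ω) : ℝ :=
  Real.exp (l * ps X n ω - l ^ 2 * qv X n ω / 2)

lemma ZZ_meas (h : NH P F X n γ ε δ) (l : ℝ) : Measurable (ZZ X n l) := by
  have h1 := h.ps_meas
  have h2 := h.qv_meas
  have : ZZ X n l = fun ω => Real.exp (l * ps X n ω - l ^ 2 * qv X n ω / 2) := rfl
  rw [this]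
  fun_prop

lemma ZZ_pow (l : ℝ) (k : ℕ) (ω : Ω) : ZZ X n l ω ^ k = ∏ i ∈ Finset.range n, wt X l k i ω := by
  rw [prod_wt, ZZ, ← Real.exp_nat_mul]

lemma ZZ_eq (h : NH P F X n γ ε δ) (hl : 0 ≤ l) (hlg : l * γ ≤ 1 / 10 ^ 6) (k : ℕ) (hk1 : 1 ≤ k) (hk4 : k ≤ 4) :
    Integrable (fun ω => ZZ X n l ω ^ k) P ∧
    Integrable (fun ω => ∏ i ∈ Finset.range n, tq P F (wt X l k) i ω) (tQ P F (wt X l k) n) ∧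
    ∫ ω, ZZ X n l ω ^ k ∂P = ∫ ω, ∏ i ∈ Finset.range n, tq P F (wt X l k) i ω ∂(tQ P F (wt X l k) n) := by
  have ht := h.tilt hl hlg (j := k) (by exact_mod_cast hk1) (by exact_mod_cast hk4)
  have e : ∀ ω, tM P F (wt X l k) n ω * ∏ i ∈ Finset.range n, tq P F (wt X l k) i ω = ZZ X n l ω ^ k := by
    intro ω
    rw [ZZ_pow, tM, ← Finset.prod_mul_distrib]
    exact Finset.prod_congr rfl fun i _ => div_mul_cancel₀ _ (Tilt.q_pos i ω).ne'
  have hi : Integrable (fun ω => ZZ X n l ω ^ k) P := by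
    refine (integrable_const ((16:ℝ) ^ n)).mono' ((h.ZZ_meas l).pow_const k).aestronglyMeasurable (Eventually.of_forall fun ω => ?_)
    rw [Real.norm_eq_abs, ZZ_pow, abs_of_nonneg (Finset.prod_nonneg fun i _ => (ht.pos i ω).le)]
    calc _ ≤ ∏ i ∈ Finset.range n, (16:ℝ) := Finset.prod_le_prod (fun i _ => (ht.pos i ω).le) fun i _ => ht.bd i ω
      _ = _ := by simp
  refine ⟨hi, ht.Q_integrable n (by simpa only [e] using hi), ?_⟩
  rw [ht.Q_integral]
  simp only [e]

lemma ZZ_le (h : NH P F X n γ ε δ) (hl : 0 ≤ l) (hlg : l * γ ≤ 1 / 10 ^ 6) (k : ℕ) (hk1 : 1 ≤ k) (hk4 : k ≤ 4) :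
    ∫ ω, ZZ X n l ω ^ k ∂P ≤ Real.exp (k * (k - 1) / 2 * l ^ 2 * (1 + δ ^ 2) + 100000 * l ^ 3 * ε) := by
  have ht := h.tilt hl hlg (j := k) (by exact_mod_cast hk1) (by exact_mod_cast hk4)
  have hQ := ht.Q_prob n
  obtain ⟨-, h2, h3⟩ := h.ZZ_eq hl hlg k hk1 hk4
  rw [h3]
  have := integral_mono_ae h2 (integrable_const _)
    ((Tilt.Q_ac n).ae_le (h.prod_le hl hlg (j := k) (by exact_mod_cast hk1) (by exact_mod_cast hk4)))
  simpa using this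

lemma ZZ_ge2 (h : NH P F X n γ ε δ) (hl : 0 ≤ l) (hlg : l * γ ≤ 1 / 10 ^ 6) :
    Real.exp (7 / 10 * l ^ 2) ≤ ∫ ω, ZZ X n l ω ^ 2 ∂P := by
  have ht := h.tilt hl hlg (j := (2:ℕ)) (by norm_num) (by norm_num)
  have hQ := ht.Q_prob n
  obtain ⟨-, h2, h3⟩ := h.ZZ_eq hl hlg 2 (by norm_num) (by norm_num)
  rw [h3]
  have h4 := h.prod_ge2 hl hlg
  have := integral_mono_ae (integrable_const _) h2
    ((Tilt.Q_ac n).ae_le (by exact_mod_cast h4))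
  simpa using this

lemma int_comb {f0 f1 f2 f3 : Ω → ℝ} (h0 : Integrable f0 P) (h1 : Integrable f1 P) (h2 : Integrable f2 P) (h3 : Integrable f3 P)
    {a b c : ℝ} (hp : ∀ ω, f0 ω ≤ a * f1 ω + b * f2 ω + c * f3 ω) :
    ∫ ω, f0 ω ∂P ≤ a * ∫ ω, f1 ω ∂P + b * ∫ ω, f2 ω ∂P + c * ∫ ω, f3 ω ∂P := by
  rw [← integral_const_mul, ← integral_const_mul, ← integral_const_mul,
    ← integral_add (h1.const_mul _) (h2.const_mul _), ← integral_add ((h1.const_mul _).fun_add (h2.const_mul _)) (h3.const_mul _)]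
  exact integral_mono h0 (((h1.const_mul _).fun_add (h2.const_mul _)).fun_add (h3.const_mul _)) hp

set_option maxHeartbeats 800000 in
lemma crude (h : NH P F X n γ ε δ) (hx : 0 ≤ x) (hxg : x * γ ≤ 1 / 10 ^ 7) :
    Real.exp (-(200 * (1 + x ^ 2))) ≤ P.real {ω | x ≤ sn X n ω} := by
  set a : ℝ := 1 / 10 ^ 6 with ha
  have ha0 : 0 < a := by positivity
  set l := x + a with hl
  have hl0 : 0 < l := by positivity
  have hγ := h.γ0
  have hγ1 := h.γ1
  have hlg : l * γ ≤ 1 / 10 ^ 6 := by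
    rw [hl, ha, add_mul]; norm_num at hxg ⊢; linarith
  have hδ2 : δ ^ 2 ≤ 1 / 16 := by have := h.δ0; have := h.δ1; nlinarith
  have hle : 100000 * l ^ 3 * ε ≤ 2 / 10 * l ^ 2 := by
    have := h.εγ
    calc 100000 * l ^ 3 * ε ≤ 100000 * l ^ 3 * (2 * γ) := by gcongr
      _ = 200000 * (l * γ) * l ^ 2 := by ring
      _ ≤ 200000 * (1 / 10 ^ 6) * l ^ 2 := by gcongr
      _ = _ := by norm_num
  have hl2 := sq_nonneg l
  have E1 : ∫ ω, ZZ X n l ω ^ 1 ∂P ≤ Real.exp (2 / 10 * l ^ 2) := by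
    refine (h.ZZ_le hl0.le hlg 1 (by norm_num) (by norm_num)).trans (Real.exp_le_exp.2 ?_)
    norm_num; linarith
  have E4 : ∫ ω, ZZ X n l ω ^ 4 ∂P ≤ Real.exp (7 * l ^ 2) := by
    refine (h.ZZ_le hl0.le hlg 4 (by norm_num) (by norm_num)).trans (Real.exp_le_exp.2 ?_)
    norm_num; nlinarith
  have E2 := h.ZZ_ge2 hl0.le hlg
  set A := {ω | Real.exp (x ^ 2 / 2) ≤ ZZ X n l ω} with hA
  have hAm : MeasurableSet A := measurableSet_le measurable_const (h.ZZ_meas l)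
  have hAs : A ⊆ {ω | x ≤ sn X n ω} := by
    intro ω hω
    exact contain X n ω hx hl0 (Real.exp_le_exp.1 hω)
  have hPA : P.real A ≤ P.real {ω | x ≤ sn X n ω} := measureReal_mono hAs
  refine le_trans ?_ hPA
  set κ : ℝ := 1 - Real.exp (-(a ^ 2 / 2)) with hκ
  have hκ1 : 1 / 10 ^ 13 ≤ κ := by
    have : Real.exp (-(a ^ 2 / 2)) ≤ 1 - 1 / 10 ^ 13 := by
      rw [Real.exp_neg, inv_le_comm₀ (Real.exp_pos _) (by norm_num)]
      refine le_trans ?_ (Real.add_one_le_exp _)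
      rw [ha]; norm_num
    rw [hκ]; linarith
  have hκ0 : 0 < κ := lt_of_lt_of_le (by norm_num) hκ1
  set s := κ * Real.exp (-(63 / 10 * l ^ 2)) with hs
  have hs0 : 0 < s := by positivity
  have i1 := (h.ZZ_eq hl0.le hlg 1 (by norm_num) (by norm_num)).1
  have i2 := (h.ZZ_eq hl0.le hlg 2 (by norm_num) (by norm_num)).1
  have i4 := (h.ZZ_eq hl0.le hlg 4 (by norm_num) (by norm_num)).1
  have iA : Integrable (A.indicator (fun _ => (1:ℝ))) P := (integrable_const _).indicator hAm
  have hpt : ∀ ω, ZZ X n l ω ^ 2 ≤ Real.exp (x ^ 2 / 2) * ZZ X n l ω ^ 1 + s / 2 * ZZ X n l ω ^ 4 + 1 / (2 * s) * A.indicator (fun _ => (1:ℝ)) ω := by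
    intro ω
    have hz : 0 < ZZ X n l ω := Real.exp_pos _
    by_cases hω : ω ∈ A
    · rw [Set.indicator_of_mem hω]
      have e0 := Real.exp_pos (x ^ 2 / 2)
      have : ZZ X n l ω ^ 2 ≤ s / 2 * ZZ X n l ω ^ 4 + 1 / (2 * s) := by
        have e : s / 2 * ZZ X n l ω ^ 4 + 1 / (2 * s) - ZZ X n l ω ^ 2 = (s * ZZ X n l ω ^ 2 - 1) ^ 2 / (2 * s) := by
          field_simp; ring
        have : 0 ≤ (s * ZZ X n l ω ^ 2 - 1) ^ 2 / (2 * s) := by positivity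
        linarith
      have : 0 ≤ Real.exp (x ^ 2 / 2) * ZZ X n l ω ^ 1 := by positivity
      linarith
    · rw [Set.indicator_of_notMem hω]
      have : ZZ X n l ω < Real.exp (x ^ 2 / 2) := not_le.1 hω
      have h4 : 0 ≤ s / 2 * ZZ X n l ω ^ 4 := by positivity
      nlinarith
  have hInt2 : ∫ ω, ZZ X n l ω ^ 2 ∂P ≤ Real.exp (x ^ 2 / 2) * ∫ ω, ZZ X n l ω ^ 1 ∂P + s / 2 * ∫ ω, ZZ X n l ω ^ 4 ∂P + 1 / (2 * s) * P.real A := by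
    have := int_comb i2 i1 i4 iA hpt
    rw [integral_indicator hAm] at this
    simpa using this
  have h1 : Real.exp (x ^ 2 / 2) * ∫ ω, ZZ X n l ω ^ 1 ∂P ≤ (1 - κ) * Real.exp (7 / 10 * l ^ 2) := by
    calc _ ≤ Real.exp (x ^ 2 / 2) * Real.exp (2 / 10 * l ^ 2) := by gcongr
      _ ≤ Real.exp (-(a ^ 2 / 2)) * Real.exp (7 / 10 * l ^ 2) := by
          rw [← Real.exp_add, ← Real.exp_add]
          apply Real.exp_le_exp.2
          rw [hl]; nlinarith [mul_nonneg hx ha0.le]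
      _ = _ := by rw [hκ]; ring
  have h2 : s / 2 * ∫ ω, ZZ X n l ω ^ 4 ∂P ≤ κ / 2 * Real.exp (7 / 10 * l ^ 2) := by
    calc _ ≤ s / 2 * Real.exp (7 * l ^ 2) := by gcongr
      _ = κ / 2 * (Real.exp (-(63 / 10 * l ^ 2)) * Real.exp (7 * l ^ 2)) := by rw [hs]; ring
      _ = _ := by rw [← Real.exp_add]; congr 2; ring
  have h3 : κ / 2 * Real.exp (7 / 10 * l ^ 2) ≤ 1 / (2 * s) * P.real A := by linarith
  have h4 : s * κ * Real.exp (7 / 10 * l ^ 2) ≤ P.real A := by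
    have := mul_le_mul_of_nonneg_left h3 (by positivity : 0 ≤ 2 * s)
    have e : 2 * s * (1 / (2 * s) * P.real A) = P.real A := by field_simp
    linarith
  refine le_trans ?_ h4
  have h5 : (1 / 10 ^ 13 : ℝ) ^ 2 * (Real.exp (-(63 / 10 * l ^ 2)) * Real.exp (7 / 10 * l ^ 2)) ≤ s * κ * Real.exp (7 / 10 * l ^ 2) := by
    rw [hs]
    calc _ ≤ κ ^ 2 * (Real.exp (-(63 / 10 * l ^ 2)) * Real.exp (7 / 10 * l ^ 2)) := by gcongr
      _ = _ := by ring
  refine le_trans ?_ h5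
  have h6 : Real.exp (-100) ≤ (1 / 10 ^ 13 : ℝ) ^ 2 := by
    rw [Real.exp_neg, inv_le_comm₀ (Real.exp_pos _) (by norm_num)]
    have : (2:ℝ) ^ 100 ≤ Real.exp 1 ^ 100 := by
      have := Real.add_one_le_exp (1:ℝ)
      gcongr; linarith
    rw [← Real.exp_nat_mul] at this
    norm_num at this ⊢
    linarith
  calc Real.exp (-(200 * (1 + x ^ 2))) ≤ Real.exp (-100 + (-(63 / 10 * l ^ 2) + 7 / 10 * l ^ 2)) := by
        apply Real.exp_le_exp.2
        have : l ^ 2 ≤ 2 * x ^ 2 + 1 := by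
          rw [hl, ha]; nlinarith [sq_nonneg (x - 1 / 10 ^ 6)]
        nlinarith [sq_nonneg x]
    _ = Real.exp (-100) * (Real.exp (-(63 / 10 * l ^ 2)) * Real.exp (7 / 10 * l ^ 2)) := by
        rw [Real.exp_add, Real.exp_add]
    _ ≤ _ := by gcongr

end NH
end SN

namespace SN
set_option linter.unusedSectionVars false
set_option linter.deprecated false

lemma gauss_shift (l u : ℝ) : ∫ y in Set.Ioi u, Real.exp (-(l * y)) * phi y = Real.exp (l ^ 2 / 2) * (1 - Ph (l + u)) := by
  rw [one_sub_Ph, ← integral_indicator measurableSet_Ioi, ← integral_indicator measurableSet_Ioi, ← integral_const_mul]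
  have hsh := integral_add_right_eq_self (μ := volume) (fun t => Real.exp (l ^ 2 / 2) * (Set.Ioi (l + u)).indicator phi t) l
  rw [← hsh]
  refine integral_congr_ae (Eventually.of_forall fun y => ?_)
  simp only [Set.indicator, Set.mem_Ioi]
  by_cases hy : u < y
  · have : l + u < y + l := by linarith
    rw [if_pos hy, if_pos this]
    unfold phi
    have : Real.exp (-(l * y)) * Real.exp (-(y ^ 2) / 2) = Real.exp (l ^ 2 / 2) * Real.exp (-((y + l) ^ 2) / 2) := by
      rw [← Real.exp_add, ← Real.exp_add]; congr 1; ring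
    calc _ = (Real.sqrt (2 * Real.pi))⁻¹ * (Real.exp (-(l * y)) * Real.exp (-(y ^ 2) / 2)) := by ring
      _ = _ := by rw [this]; ring
  · have : ¬ (l + u < y + l) := by intro h; apply hy; linarith
    rw [if_neg hy, if_neg this, mul_zero]

section layer
variable {Ω : Type} [mΩ : MeasurableSpace Ω] {Q : Measure Ω} [IsProbabilityMeasure Q]

lemma Ph_sub_int {a b : ℝ} (hab : a ≤ b) : ∫ t in Set.Ioc a b, phi t = Ph b - Ph a := by
  rw [← intervalIntegral.integral_of_le hab]
  exact intervalIntegral.integral_eq_sub_of_hasDerivAt (fun x _ => Ph_hasDeriv x) (phi_cont.intervalIntegrable _ _)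

lemma valid_pos {Y : Ω → ℝ} {D : ℝ} (hY : Measurable Y) (hv : Valid Q Y D) (hD0 : 0 ≤ D) (hD : D ≤ 1 / 20) (c : ℝ) :
    Ph c - Ph (20 * D) ≤ Q.real {ω | 0 ≤ Y ω ∧ Y ω ≤ c} ∧ 1 - Ph (20 * D) ≤ Q.real {ω | 0 ≤ Y ω} := by
  have h1 := (hv 0).1
  have h2 := (hv c).2
  rw [Ph_zero] at h1
  have h3 := Ph_incr (u := 20 * D) (by linarith) (by linarith)
  refine ⟨?_, by linarith⟩
  have hA : MeasurableSet {ω | 0 ≤ Y ω} := measurableSet_le measurable_const hY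
  have h4 : Q.real {ω | Y ω ≤ c} ≤ Q.real ({ω | 0 ≤ Y ω ∧ Y ω ≤ c} ∪ {ω | 0 ≤ Y ω}ᶜ) := by
    refine measureReal_mono (fun ω hω => ?_) (measure_ne_top _ _)
    by_cases h : 0 ≤ Y ω
    · left; exact ⟨h, hω⟩
    · right; exact h
  have h5 := measureReal_union_le (μ := Q) {ω | 0 ≤ Y ω ∧ Y ω ≤ c} {ω | 0 ≤ Y ω}ᶜ
  have h6 := probReal_compl_eq_one_sub (μ := Q) hA
  linarith

lemma layer {Y : Ω → ℝ} {D l : ℝ} (hY : Measurable Y) (hv : Valid Q Y D) (hD0 : 0 ≤ D) (hD : D ≤ 1 / 20) (hl : 0 ≤ l) :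
    Real.exp (l ^ 2 / 2) * (1 - Ph (l + 20 * D)) ≤ ∫ ω, {ω | 0 ≤ Y ω}.indicator (fun ω => Real.exp (-(l * Y ω))) ω ∂Q := by
  have hA : MeasurableSet {ω | 0 ≤ Y ω} := measurableSet_le measurable_const hY
  rw [← gauss_shift, integral_indicator hA]
  set u := 20 * D with hu
  set ν : Measure ℝ := (volume.restrict (Set.Ioi u)).withDensity (fun t => ENNReal.ofReal (phi t)) with hν
  have hphm : Measurable phi := phi_cont.measurable
  have hl1 := lintegral_eq_lintegral_meas_le (Q.restrict {ω | 0 ≤ Y ω}) (f := fun ω => Real.exp (-(l * Y ω)))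
    (Eventually.of_forall fun ω => (Real.exp_pos _).le) (by fun_prop)
  have hl2 := lintegral_eq_lintegral_meas_le ν (f := fun y => Real.exp (-(l * y)))
    (Eventually.of_forall fun ω => (Real.exp_pos _).le) (by fun_prop)
  have hcmp : ∀ t : ℝ, 0 < t → ν {y | t ≤ Real.exp (-(l * y))} ≤ (Q.restrict {ω | 0 ≤ Y ω}) {ω | t ≤ Real.exp (-(l * Y ω))} := by
    intro t ht
    have hm1 : MeasurableSet {y : ℝ | t ≤ Real.exp (-(l * y))} := measurableSet_le measurable_const (by fun_prop)
    have hm2 : MeasurableSet {ω | t ≤ Real.exp (-(l * Y ω))} := measurableSet_le measurable_const (by fun_prop)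
    rw [Measure.restrict_apply hm2, hν, withDensity_apply _ hm1, Measure.restrict_restrict hm1,
      ← ofReal_integral_eq_lintegral_ofReal phi_integrable.restrict (Eventually.of_forall fun t => (phi_pos t).le),
      ← ofReal_measureReal]
    apply ENNReal.ofReal_le_ofReal
    rcases hl.eq_or_lt with h0 | h0
    · by_cases ht1 : t ≤ 1
      · have e1 : {y : ℝ | t ≤ Real.exp (-(l * y))} = Set.univ := by ext y; simp [← h0, ht1]
        have e2 : {ω | t ≤ Real.exp (-(l * Y ω))} = Set.univ := by ext y; simp [← h0, ht1]
        rw [e1, e2, Set.univ_inter, Set.univ_inter, ← one_sub_Ph]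
        exact (valid_pos hY hv hD0 hD 0).2
      · have e1 : {y : ℝ | t ≤ Real.exp (-(l * y))} = ∅ := by ext y; simpa [← h0] using ht1
        rw [e1, Set.empty_inter]; simp
    · set c := -(Real.log t) / l with hc
      have hiff : ∀ y, t ≤ Real.exp (-(l * y)) ↔ y ≤ c := by
        intro y
        rw [← Real.log_le_iff_le_exp ht, hc, le_div_iff₀ h0]
        constructor <;> intro h <;> linarith
      have e1 : {y : ℝ | t ≤ Real.exp (-(l * y))} ∩ Set.Ioi u = Set.Ioc u c := by
        ext y; simp only [Set.mem_inter_iff, Set.mem_setOf_eq, hiff, Set.mem_Ioi, Set.mem_Ioc]; tauto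
      have e2 : {ω | t ≤ Real.exp (-(l * Y ω))} ∩ {ω | 0 ≤ Y ω} = {ω | 0 ≤ Y ω ∧ Y ω ≤ c} := by
        ext y; simp only [Set.mem_inter_iff, Set.mem_setOf_eq, hiff]; tauto
      rw [e1, e2]
      rcases le_total u c with h1 | h1
      · rw [Ph_sub_int h1]
        exact (valid_pos hY hv hD0 hD c).1
      · rw [Set.Ioc_eq_empty (by simpa using h1)]; simp
  have hmain : ∫⁻ y, ENNReal.ofReal (Real.exp (-(l * y))) ∂ν ≤ ∫⁻ ω in {ω | 0 ≤ Y ω}, ENNReal.ofReal (Real.exp (-(l * Y ω))) ∂Q := by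
    rw [hl1, hl2]
    exact setLIntegral_mono' measurableSet_Ioi fun t ht => hcmp t ht
  have hbi : Integrable (fun ω => Real.exp (-(l * Y ω))) (Q.restrict {ω | 0 ≤ Y ω}) := by
    refine (integrable_const (1:ℝ)).mono' (by fun_prop) ((ae_restrict_iff' hA).2 (Eventually.of_forall fun ω hω => ?_))
    have hω' : 0 ≤ Y ω := hω
    rw [Real.norm_eq_abs, abs_of_pos (Real.exp_pos _)]
    exact Real.exp_le_one_iff.2 (by nlinarith)
  have hbi2 : Integrable (fun y => Real.exp (-(l * y)) * phi y) (volume.restrict (Set.Ioi u)) := by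
    refine (phi_integrable.restrict (s := Set.Ioi u)).mono' (by fun_prop) ((ae_restrict_iff' measurableSet_Ioi).2 (Eventually.of_forall fun y hy => ?_))
    have hy' : u < y := hy
    have hp := phi_pos y
    rw [Real.norm_eq_abs, abs_of_pos (by positivity)]
    have : Real.exp (-(l * y)) ≤ 1 := Real.exp_le_one_iff.2 (by
      have : 0 ≤ y := by linarith
      nlinarith)
    nlinarith
  rw [hν, lintegral_withDensity_eq_lintegral_mul _ (by fun_prop) (by fun_prop)] at hmain
  have e3 : ∫⁻ a, ((fun t => ENNReal.ofReal (phi t)) * fun y => ENNReal.ofReal (Real.exp (-(l * y)))) a ∂(volume.restrict (Set.Ioi u)) =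
      ∫⁻ y in Set.Ioi u, ENNReal.ofReal (Real.exp (-(l * y)) * phi y) := by
    refine lintegral_congr fun y => ?_
    rw [Pi.mul_apply, ← ENNReal.ofReal_mul (phi_pos y).le, mul_comm]
  rw [e3, ← ofReal_integral_eq_lintegral_ofReal hbi2 (Eventually.of_forall fun y => mul_nonneg (Real.exp_pos _).le (phi_pos y).le),
    ← ofReal_integral_eq_lintegral_ofReal hbi (Eventually.of_forall fun ω => (Real.exp_pos _).le)] at hmain
  exact (ENNReal.ofReal_le_ofReal_iff (integral_nonneg fun ω => (Real.exp_pos _).le)).1 hmain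

end layer
end SN

namespace SN
set_option linter.unusedSectionVars false
set_option linter.deprecated false
namespace NH
variable {Ω : Type} [mΩ : MeasurableSpace Ω] {P : Measure Ω} [IsProbabilityMeasure P]
  {F : ℕ → MeasurableSpace Ω} {X : ℕ → Ω → ℝ} {n : ℕ} {γ ε δ l j x : ℝ}

lemma sum_tm (h : NH P F X n γ ε δ) (hl : 0 ≤ l) (hlg : l * γ ≤ 1 / 10 ^ 6) :
    ∀ᵐ ω ∂P, l * (1 - δ ^ 2) / 2 - 300000 * l ^ 2 * ε ≤ ∑ i ∈ Finset.range n, tm P F X l i ω ∧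
      ∑ i ∈ Finset.range n, tm P F X l i ω ≤ l * (1 + δ ^ 2) / 2 + 300000 * l ^ 2 * ε := by
  filter_upwards [ae_all_iff.2 fun i => h.tm_bd hl hlg i, h.A1, h.A2] with ω h1 h2 h3
  change |∑ i ∈ Finset.range n, sg P F X i ω - 1| ≤ δ ^ 2 at h2
  change ∑ i ∈ Finset.range n, bt P F X i ω ≤ ε at h3
  have h4 : |∑ i ∈ Finset.range n, tm P F X l i ω - l * (∑ i ∈ Finset.range n, sg P F X i ω) / 2| ≤
      300000 * l ^ 2 * ∑ i ∈ Finset.range n, bt P F X i ω := by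
    rw [Finset.mul_sum, Finset.sum_div, ← Finset.sum_sub_distrib, Finset.mul_sum]
    exact (Finset.abs_sum_le_sum_abs _ _).trans (Finset.sum_le_sum fun i _ => (h1 i).1)
  have h5 : 300000 * l ^ 2 * ∑ i ∈ Finset.range n, bt P F X i ω ≤ 300000 * l ^ 2 * ε := by gcongr
  rw [abs_le] at h2 h4
  constructor <;> nlinarith

lemma sum_et (X : ℕ → Ω → ℝ) (n : ℕ) (l : ℝ) (ω : Ω) :
    ∑ i ∈ Finset.range n, et X l i ω = ps X n ω - l * qv X n ω / 2 := by
  unfold ps qv et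
  rw [Finset.mul_sum, Finset.sum_div, ← Finset.sum_sub_distrib]
  exact Finset.sum_congr rfl fun i _ => by ring

lemma cm (h : NH P F X n γ ε δ) (hl : 0 ≤ l) (hlg : l * γ ≤ 1 / 10 ^ 6) {Y : Ω → ℝ} (hY : Measurable Y)
    (hYe : ∀ ω, ps X n ω - l * qv X n ω / 2 = Y ω + ∑ i ∈ Finset.range n, tm P F X l i ω) :
    Real.exp (-(500000 * l ^ 3 * ε + l ^ 2 * (1 + δ ^ 2) / 2)) *
      ∫ ω, {ω | 0 ≤ Y ω}.indicator (fun ω => Real.exp (-(l * Y ω))) ω ∂(tQ P F (wt X l 1) n) ≤ P.real {ω | 0 ≤ Y ω} := by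
  have ht := h.tilt hl hlg (j := 1) (by norm_num) (by norm_num)
  have hQ := ht.Q_prob n
  have hac := Tilt.Q_ac (P := P) (F := F) (w := wt X l 1) n
  have hA : MeasurableSet {ω | 0 ≤ Y ω} := measurableSet_le measurable_const hY
  set T : Ω → ℝ := fun ω => ps X n ω - l * qv X n ω / 2 with hT
  set f : Ω → ℝ := fun ω => {ω | 0 ≤ Y ω}.indicator (fun ω => (∏ i ∈ Finset.range n, tq P F (wt X l 1) i ω) * Real.exp (-(l * T ω))) ω with hf
  have e : ∀ ω, tM P F (wt X l 1) n ω * f ω = {ω | 0 ≤ Y ω}.indicator (fun _ => (1:ℝ)) ω := by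
    intro ω
    simp only [hf, Set.indicator]
    split_ifs with h1
    · have e1 : tM P F (wt X l 1) n ω * ∏ i ∈ Finset.range n, tq P F (wt X l 1) i ω = Real.exp (1 * (l * ps X n ω - l ^ 2 * qv X n ω / 2)) := by
        rw [← prod_wt, tM, ← Finset.prod_mul_distrib]
        exact Finset.prod_congr rfl fun i _ => div_mul_cancel₀ _ (Tilt.q_pos i ω).ne'
      rw [← mul_assoc, e1, ← Real.exp_add, Real.exp_eq_one_iff]
      simp only [hT]; ring
    · simp
  have hInt0 : Integrable f (tQ P F (wt X l 1) n) := by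
    apply ht.Q_integrable
    simp_rw [e]
    exact (integrable_const (1:ℝ)).indicator hA
  have hPf : P.real {ω | 0 ≤ Y ω} = ∫ ω, f ω ∂(tQ P F (wt X l 1) n) := by
    rw [ht.Q_integral]
    simp_rw [e]
    rw [integral_indicator hA]; simp
  rw [hPf, ← integral_const_mul]
  have hg : Integrable (fun ω => {ω | 0 ≤ Y ω}.indicator (fun ω => Real.exp (-(l * Y ω))) ω) (tQ P F (wt X l 1) n) := by
    refine (integrable_const (1:ℝ)).mono' ?_ (Eventually.of_forall fun ω => ?_)
    · refine (Measurable.indicator (by fun_prop) hA).aestronglyMeasurable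
    · simp only [Set.indicator, Set.mem_setOf_eq]
      split_ifs with h1
      · rw [Real.norm_eq_abs, abs_of_pos (Real.exp_pos _)]
        exact Real.exp_le_one_iff.2 (by nlinarith)
      · simp
  refine integral_mono_ae (hg.const_mul _) hInt0 ?_
  filter_upwards [hac.ae_le (h.prod_ge1 hl hlg), hac.ae_le (h.sum_tm hl hlg)] with ω h1 h2
  simp only [hf, Set.indicator, Set.mem_setOf_eq]
  split_ifs with h3
  · have hTe : T ω = Y ω + ∑ i ∈ Finset.range n, tm P F X l i ω := hYe ω
    calc _ = Real.exp (-(200000 * l ^ 3 * ε)) * Real.exp (-(l * (Y ω + (l * (1 + δ ^ 2) / 2 + 300000 * l ^ 2 * ε)))) := by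
          rw [← Real.exp_add, ← Real.exp_add]; congr 1; ring
      _ ≤ (∏ i ∈ Finset.range n, tq P F (wt X l 1) i ω) * Real.exp (-(l * T ω)) := by
          have hT2 : Real.exp (-(l * (Y ω + (l * (1 + δ ^ 2) / 2 + 300000 * l ^ 2 * ε)))) ≤ Real.exp (-(l * T ω)) := by
            apply Real.exp_le_exp.2
            rw [hTe]
            apply neg_le_neg
            apply mul_le_mul_of_nonneg_left _ hl
            linarith [h2.2]
          exact mul_le_mul h1 hT2 (Real.exp_pos _).le ((Real.exp_pos _).le.trans h1)
  · simp

lemma num_k {d e k : ℝ} (hd : 0 ≤ d) (hd1 : d ≤ 1 / 16) (he : 0 ≤ e) (he1 : e ≤ 1 / 50) (hk : k = 1 + (d + 11 * e)) :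
    1 ≤ k ^ 2 * (1 - d) - 6 * k ^ 3 * e := by
  have hk1 : 1 ≤ k := by linarith
  have hk2 : k ≤ 13 / 10 := by linarith
  have h3 : k ^ 3 ≤ (13/10) ^ 3 := by gcongr
  have h2 : 1 + 2 * (d + 11 * e) ≤ k ^ 2 := by rw [hk]; nlinarith
  have h4 : (1 + 2 * (d + 11 * e)) * (1 - d) ≤ k ^ 2 * (1 - d) := by apply mul_le_mul_of_nonneg_right h2; linarith
  have h5 : 6 * k ^ 3 * e ≤ 6 * (13/10) ^ 3 * e := by gcongr
  nlinarith [mul_nonneg hd he]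

/-- Main regime -/
lemma main (h : NH P F X n γ ε δ) (hx : 0 ≤ x) (hxg : x * γ ≤ 1 / 10 ^ 7) (hg : 900000 * γ ≤ 1 / 4) {D y : ℝ}
    (hD : D = 4 * 10 ^ 9 * (900000 * γ * |Real.log (900000 * γ)| + 500000 * (((1 + y) * x) * γ) + δ)) (hD1 : D ≤ 1 / 20)
    (hy : y = δ ^ 2 + 1100000 * x * ε) :
    (1 - Ph x) * Real.exp (-(500000 * ((1 + y) * x) ^ 3 * ε + ((1 + y) * x) ^ 2 * δ ^ 2 / 2 +
      ((x + 1) * (x * y + 20 * D) + (x * y + 20 * D) ^ 2 / 2))) ≤ P.real {ω | x ≤ sn X n ω} := by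
  have hγ := h.γ0
  have hε := h.ε0
  have hδ := h.δ0
  have hd16 : δ ^ 2 ≤ 1 / 16 := by have := h.δ1; nlinarith
  have hxe : x * ε ≤ 2 / 10 ^ 7 := by
    calc x * ε ≤ x * (2 * γ) := by have := h.εγ; gcongr
      _ ≤ _ := by linarith
  have hxe0 : 0 ≤ x * ε := by positivity
  have hy0 : 0 ≤ y := by rw [hy]; nlinarith [sq_nonneg δ]
  have hy1 : y ≤ 3 / 10 := by rw [hy]; nlinarith
  set l := (1 + y) * x with hldef
  have hl : 0 ≤ l := by positivity
  have hlg : l * γ ≤ 1 / 10 ^ 6 := by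
    calc l * γ = (1 + y) * (x * γ) := by rw [hldef]; ring
      _ ≤ (1 + 3 / 10) * (1 / 10 ^ 7) := by gcongr
      _ ≤ _ := by norm_num
  have hD0 : 0 ≤ D := by rw [hD]; positivity
  have hb := h.beh hl hlg hg
  have ht := h.tilt hl hlg (j := 1) (by norm_num) (by norm_num)
  have hQ := ht.Q_prob n
  have hbe := hb.berry_esseen
  rw [← hD] at hbe
  set Y : Ω → ℝ := ps (fun i ω => et X l i ω - tm P F X l i ω) n with hYd
  have hY : Measurable Y := by
    have : Y = fun ω => ∑ i ∈ Finset.range n, (et X l i ω - tm P F X l i ω) := rfl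
    rw [this]
    exact Finset.measurable_fun_sum _ fun i _ => (h.et_meas l i).sub ((tm_sm i).mono (h.le i)).measurable
  have hYe : ∀ ω, ps X n ω - l * qv X n ω / 2 = Y ω + ∑ i ∈ Finset.range n, tm P F X l i ω := by
    intro ω
    have : Y ω = ∑ i ∈ Finset.range n, (et X l i ω - tm P F X l i ω) := rfl
    rw [this, Finset.sum_sub_distrib, sum_et]; ring
  have hlay := layer hY hbe hD0 hD1 hl
  have hcm := h.cm hl hlg hY hYe
  have hsub : P.real {ω | 0 ≤ Y ω} ≤ P.real {ω | x ≤ sn X n ω} := by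
    refine ENNReal.toReal_mono (measure_ne_top _ _) (measure_mono_ae ?_)
    filter_upwards [h.sum_tm hl hlg] with ω h1 h2
    have h2' : 0 ≤ Y ω := h2
    change x ≤ sn X n ω
    have h3 := hYe ω
    rcases hx.eq_or_lt with h0 | h0
    · have hl0 : l = 0 := by rw [hldef, ← h0]; ring
      rw [hl0] at h1 h3
      rw [← h0]
      apply div_nonneg _ (Real.sqrt_nonneg _)
      linarith [h1.1]
    · have hl0 : 0 < l := by rw [hldef]; positivity
      apply contain X n ω hx hl0
      have h4 : l * (l * (1 - δ ^ 2) / 2 - 300000 * l ^ 2 * ε) ≤ l * (ps X n ω - l * qv X n ω / 2) := by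
        apply mul_le_mul_of_nonneg_left _ hl
        linarith [h1.1]
      have h5 := num_k (d := δ ^ 2) (e := 100000 * (x * ε)) (k := 1 + y) (sq_nonneg _) hd16 (by linarith) (by linarith) (by rw [hy]; ring)
      have h6 : x ^ 2 / 2 * 1 ≤ x ^ 2 / 2 * ((1 + y) ^ 2 * (1 - δ ^ 2) - 6 * (1 + y) ^ 3 * (100000 * (x * ε))) := by gcongr
      have h7 : x ^ 2 / 2 * ((1 + y) ^ 2 * (1 - δ ^ 2) - 6 * (1 + y) ^ 3 * (100000 * (x * ε))) = l * (l * (1 - δ ^ 2) / 2 - 300000 * l ^ 2 * ε) := by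
        rw [hldef]; ring
      have h8 : l * (ps X n ω - l * qv X n ω / 2) = l * ps X n ω - l ^ 2 * qv X n ω / 2 := by ring
      linarith
  have hts := tail_shift (x := x) (h := x * y + 20 * D) hx (by positivity)
  have hadd : x + (x * y + 20 * D) = l + 20 * D := by rw [hldef]; ring
  rw [hadd] at hts
  calc _ = Real.exp (-(500000 * l ^ 3 * ε + l ^ 2 * (1 + δ ^ 2) / 2)) * (Real.exp (l ^ 2 / 2) *
        ((1 - Ph x) * Real.exp (-((x + 1) * (x * y + 20 * D) + (x * y + 20 * D) ^ 2 / 2)))) := by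
        rw [mul_left_comm (Real.exp (l ^ 2 / 2)), mul_left_comm, ← Real.exp_add, ← Real.exp_add]
        congr 2; ring
    _ ≤ Real.exp (-(500000 * l ^ 3 * ε + l ^ 2 * (1 + δ ^ 2) / 2)) * (Real.exp (l ^ 2 / 2) * (1 - Ph (l + 20 * D))) := by gcongr
    _ ≤ _ := by gcongr
    _ ≤ _ := hcm
    _ ≤ _ := hsub

end NH
end SN

namespace SN
set_option linter.unusedSectionVars false
set_option linter.deprecated false

/-- the remainder -/
noncomputable def RR (x ε γ δ : ℝ) : ℝ :=
  x ^ 3 * ε + x ^ 2 * δ ^ 2 + (1 + x) * (x * γ + γ * |Real.log γ| + δ)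

lemma gL_le {γ : ℝ} (h0 : 0 < γ) (h1 : γ ≤ 1 / 4) : (γ * |Real.log γ|) ^ 2 ≤ 4 * γ := by
  set s := Real.sqrt γ with hs
  have hs0 : 0 < s := Real.sqrt_pos.2 h0
  have hs2 : s ^ 2 = γ := Real.sq_sqrt h0.le
  have hle : |Real.log γ| ≤ 2 / s := by
    rw [abs_of_nonpos (Real.log_nonpos h0.le (by linarith)), ← hs2, Real.log_pow]
    have h3 := Real.log_le_sub_one_of_pos (inv_pos.2 hs0)
    rw [Real.log_inv] at h3
    have : 2 / s = 2 * s⁻¹ := by ring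
    rw [this]; push_cast; linarith
  have h4 : γ * |Real.log γ| ≤ 2 * s := by
    calc _ ≤ γ * (2 / s) := by gcongr
      _ = 2 * s := by rw [← hs2]; field_simp
  calc (γ * |Real.log γ|) ^ 2 ≤ (2 * s) ^ 2 := by gcongr
    _ = 4 * γ := by rw [← hs2]; ring

lemma other {x ε γ δ : ℝ} (hx : 0 ≤ x) (hxg : x * γ ≤ 1 / 10 ^ 17) (hγ : 0 < γ) (hγ1 : γ ≤ 1 / 4) (hε : 0 ≤ ε) (hδ : 0 ≤ δ)
    (hc : 1 / 10 ^ 18 ≤ γ * |Real.log γ| ∨ 1 / 10 ^ 18 ≤ δ) : 200 * (1 + x ^ 2) ≤ 10 ^ 60 * RR x ε γ δ := by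
  have hL : 0 ≤ γ * |Real.log γ| := by positivity
  unfold RR
  rcases hc with hc | hc
  · have h1 := gL_le hγ hγ1
    have h2 : (1 / 10 ^ 18 : ℝ) ^ 2 ≤ (γ * |Real.log γ|) ^ 2 := by gcongr
    have h3 : 1 / 10 ^ 37 ≤ γ := by norm_num at h2 ⊢; linarith
    have h4 : x ≤ 10 ^ 20 := by
      have : x * (1 / 10 ^ 37) ≤ 1 / 10 ^ 17 := (mul_le_mul_of_nonneg_left h3 hx).trans hxg
      norm_num at this ⊢; linarith
    have h5 : (1 + x) * (1 / 10 ^ 18) ≤ (1 + x) * (x * γ + γ * |Real.log γ| + δ) := by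
      gcongr
      have : 0 ≤ x * γ := by positivity
      linarith
    have h6 : 0 ≤ x ^ 3 * ε + x ^ 2 * δ ^ 2 := by positivity
    have h7 : x ^ 2 ≤ 10 ^ 20 * x := by nlinarith
    norm_num at h5 h7 ⊢
    linarith
  · have h1 : (1 / 10 ^ 18 : ℝ) ^ 2 ≤ δ ^ 2 := by gcongr
    have h2 : x ^ 2 * (1 / 10 ^ 18 : ℝ) ^ 2 ≤ x ^ 2 * δ ^ 2 := by gcongr
    have h3 : 1 * (1 / 10 ^ 18) ≤ (1 + x) * (x * γ + γ * |Real.log γ| + δ) := by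
      gcongr
      · linarith
      · have : 0 ≤ x * γ := by positivity
        linarith
    have h6 : 0 ≤ x ^ 3 * ε := by positivity
    have h7 := sq_nonneg x
    norm_num at h2 h3 ⊢
    linarith

lemma mainbd {x ε γ δ y D : ℝ} (hx : 0 ≤ x) (hxg : x * γ ≤ 1 / 10 ^ 17) (hγ : 0 < γ) (hγ1 : γ ≤ 1 / 4) (hε : 0 ≤ ε)
    (hεγ : ε ≤ 2 * γ) (hδ : 0 ≤ δ) (hδ1 : δ ≤ 1 / 4) (hy0 : 0 ≤ y) (hy1 : y ≤ 3 / 10) (hy : y = δ ^ 2 + 1100000 * x * ε)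
    (hD0 : 0 ≤ D) (hD1 : D ≤ 1 / 20) (hD : D ≤ 10 ^ 20 * (x * γ + γ * |Real.log γ| + δ)) :
    500000 * ((1 + y) * x) ^ 3 * ε + ((1 + y) * x) ^ 2 * δ ^ 2 / 2 +
      ((x + 1) * (x * y + 20 * D) + (x * y + 20 * D) ^ 2 / 2) ≤ 10 ^ 60 * RR x ε γ δ := by
  unfold RR
  have hL : 0 ≤ γ * |Real.log γ| := by positivity
  set g := γ * |Real.log γ| with hgdef
  have a1 : 500000 * ((1 + y) * x) ^ 3 * ε ≤ 500000 * ((1 + 3/10) * x) ^ 3 * ε := by gcongr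
  have a2 : ((1 + y) * x) ^ 2 * δ ^ 2 / 2 ≤ ((1 + 3/10) * x) ^ 2 * δ ^ 2 / 2 := by gcongr
  set h := x * y + 20 * D with hh
  have hh0 : 0 ≤ h := by positivity
  have hh1 : h ≤ 1 + x := by
    have : x * y ≤ x * (3/10) := by gcongr
    linarith
  have a3 : h ^ 2 / 2 ≤ (x + 1) * h := by nlinarith
  have a4 : (x + 1) * h = x ^ 2 * δ ^ 2 + x * δ ^ 2 + 1100000 * (x ^ 3 * ε) + 1100000 * (x ^ 2 * ε) + 20 * ((1 + x) * D) := by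
    rw [hh, hy]; ring
  have a5 : (1 + x) * D ≤ (1 + x) * (10 ^ 20 * (x * γ + g + δ)) := by gcongr
  have a6 : x ^ 2 * ε ≤ x ^ 2 * (2 * γ) := by gcongr
  have a7 : x * δ ^ 2 ≤ x * δ := by gcongr; nlinarith
  have b1 : 0 ≤ x ^ 3 * ε := by positivity
  have b2 : 0 ≤ x ^ 2 * δ ^ 2 := by positivity
  have b3 : 0 ≤ x * g := by positivity
  have b4 : 0 ≤ x * γ := by positivity
  have b5 : 0 ≤ x * δ := by positivity
  have b6 : 0 ≤ x ^ 2 * γ := by positivity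
  have e1 : (1 + x) * (10 ^ 20 * (x * γ + g + δ)) = 10 ^ 20 * (x * γ + g + δ + x ^ 2 * γ + x * g + x * δ) := by ring
  have e2 : (1 + x) * (x * γ + g + δ) = x * γ + g + δ + x ^ 2 * γ + x * g + x * δ := by ring
  have e3 : 500000 * ((1 + 3/10) * x) ^ 3 * ε = 500000 * (13/10)^3 * (x ^ 3 * ε) := by ring
  have e4 : ((1 + 3/10) * x) ^ 2 * δ ^ 2 / 2 = (13/10)^2 / 2 * (x ^ 2 * δ ^ 2) := by ring
  rw [e1] at a5
  rw [e3] at a1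
  rw [e4] at a2
  rw [e2]
  norm_num at a1 a2 a5 ⊢
  linarith

namespace NH
variable {Ω : Type} [mΩ : MeasurableSpace Ω] {P : Measure Ω} [IsProbabilityMeasure P]
  {F : ℕ → MeasurableSpace Ω} {X : ℕ → Ω → ℝ} {n : ℕ} {γ ε δ l j x : ℝ}

lemma final (h : NH P F X n γ ε δ) (hx : 0 ≤ x) (hxg : x * γ ≤ 1 / 10 ^ 17) :
    (1 - Ph x) * Real.exp (-(10 ^ 60 * RR x ε γ δ)) ≤ P.real {ω | x ≤ sn X n ω} := by
  have hγ := h.γ0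
  have hε := h.ε0
  have hδ := h.δ0
  have hxg7 : x * γ ≤ 1 / 10 ^ 7 := hxg.trans (by norm_num)
  have hL : 0 ≤ γ * |Real.log γ| := by positivity
  by_cases hc : 1 / 10 ^ 18 ≤ γ * |Real.log γ| ∨ 1 / 10 ^ 18 ≤ δ
  · have h1 := other hx hxg hγ h.γ1 hε hδ hc
    have h2 := h.crude hx hxg7
    have h3 := tail_pos x
    have h4 := Ph_nonneg x
    calc _ ≤ 1 * Real.exp (-(200 * (1 + x ^ 2))) := by gcongr; linarith
      _ ≤ _ := by rw [one_mul]; exact h2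
  · push Not at hc
    obtain ⟨hc1, hc2⟩ := hc
    have hL1 := (BEH.log_g hγ h.γ1).2
    have hg : 900000 * γ ≤ 1 / 4 := by
      have : γ * 1 ≤ γ * |Real.log γ| := by gcongr
      norm_num at hc1; linarith
    have hLg : |Real.log (900000 * γ)| ≤ |Real.log γ| := by
      rw [abs_of_nonpos (Real.log_nonpos (by positivity) (by linarith)), abs_of_nonpos (Real.log_nonpos hγ.le (by linarith))]
      apply neg_le_neg
      exact Real.log_le_log hγ (by linarith)
    set y := δ ^ 2 + 1100000 * x * ε with hy
    have hxe : x * ε ≤ 2 / 10 ^ 7 := by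
      calc x * ε ≤ x * (2 * γ) := by have := h.εγ; gcongr
        _ ≤ _ := by linarith
    have hxe0 : 0 ≤ x * ε := by positivity
    have hy0 : 0 ≤ y := by rw [hy]; nlinarith [sq_nonneg δ]
    have hy1 : y ≤ 3 / 10 := by
      have := h.δ1
      rw [hy]; nlinarith
    set D := 4 * 10 ^ 9 * (900000 * γ * |Real.log (900000 * γ)| + 500000 * (((1 + y) * x) * γ) + δ) with hD
    have hxg0 : 0 ≤ x * γ := by positivity
    have hD2 : D ≤ 4 * 10 ^ 9 * (900000 * (γ * |Real.log γ|) + 650000 * (x * γ) + δ) := by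
      rw [hD]
      have e1 : 900000 * γ * |Real.log (900000 * γ)| ≤ 900000 * γ * |Real.log γ| := by gcongr
      have e2 : (1 + y) * (x * γ) ≤ (1 + 3/10) * (x * γ) := by gcongr
      nlinarith
    have hD0 : 0 ≤ D := by rw [hD]; positivity
    have hD1 : D ≤ 1 / 20 := by
      norm_num at hD2 hc1 hc2 hxg ⊢; linarith
    have hm := h.main hx hxg7 hg hD hD1 hy
    have hb := mainbd hx hxg hγ h.γ1 hε h.εγ hδ h.δ1 hy0 hy1 hy hD0 hD1 (by norm_num at hD2 ⊢; linarith)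
    have h3 := tail_pos x
    refine le_trans ?_ hm
    gcongr

end NH
end SN

namespace SN
set_option linter.unusedSectionVars false
set_option linter.deprecated false

lemma sum_Icc_range (f : ℕ → ℝ) (n : ℕ) : ∑ i ∈ Finset.Icc 1 n, f i = ∑ i ∈ Finset.range n, f (i + 1) := by
  induction n with
  | zero => simp
  | succ k ih => rw [Finset.sum_Icc_succ_top (by omega), Finset.sum_range_succ, ih]

lemma rpow_three (t : ℝ) : t ^ (2 + 1 : ℝ) = t ^ 3 := by
  rw [show (2 + 1 : ℝ) = ((3 : ℕ) : ℝ) by norm_num, Real.rpow_natCast]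

section asm
variable {Ω : Type} [mΩ : MeasurableSpace Ω] {P : Measure Ω} [IsProbabilityMeasure P]

/-- normalised differences -/
noncomputable def nX (A : MDS Ω P) (a : ℝ) (i : ℕ) (ω : Ω) : ℝ := if i < A.n then a * A.X (i + 1) ω else 0

lemma Bsq_pos (A : MDS Ω P) : 0 < A.Bsq := by
  unfold MDS.Bsq
  apply Finset.sum_pos
  · intro i hi
    rw [Finset.mem_Icc] at hi
    exact A.var_pos i hi.1 hi.2
  · exact ⟨1, Finset.mem_Icc.2 ⟨le_rfl, A.npos⟩⟩

lemma nX_lt (A : MDS Ω P) (a : ℝ) {i : ℕ} (hi : i < A.n) : nX A a i = fun ω => a * A.X (i + 1) ω := by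
  ext ω; simp [nX, hi]

lemma nX_ge (A : MDS Ω P) (a : ℝ) {i : ℕ} (hi : ¬ i < A.n) : nX A a i = 0 := by
  ext ω; simp [nX, hi]

lemma nX_sq (A : MDS Ω P) (a : ℝ) {i : ℕ} (hi : i < A.n) :
    P[fun ω => nX A a i ω ^ 2|A.F i] =ᵐ[P] fun ω => a ^ 2 * (P[fun ω' => A.X (i + 1) ω' ^ 2|A.F i]) ω := by
  have e : (fun ω => nX A a i ω ^ 2) = a ^ 2 • fun ω' => A.X (i + 1) ω' ^ 2 := by
    ext ω; rw [nX_lt A a hi]; simp [mul_pow]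
  rw [e]
  exact condExp_smul _ _ _

lemma nX_cu (A : MDS Ω P) (a : ℝ) {i : ℕ} (hi : i < A.n) :
    P[fun ω => |nX A a i ω| ^ 3|A.F i] =ᵐ[P] fun ω => |a| ^ 3 * (P[fun ω' => |A.X (i + 1) ω'| ^ 3|A.F i]) ω := by
  have e : (fun ω => |nX A a i ω| ^ 3) = |a| ^ 3 • fun ω' => |A.X (i + 1) ω'| ^ 3 := by
    ext ω; rw [nX_lt A a hi]; simp [mul_pow, abs_mul]
  rw [e]
  exact condExp_smul _ _ _

lemma nh (A : MDS Ω P) {δ ε γ a : ℝ} (h1 : A.CondA1 δ) (h2 : A.CondA2 1 ε) (h4 : A.CondA4 1 γ)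
    (ha : |a| = (Real.sqrt A.Bsq)⁻¹) : NH P A.F (nX A a) A.n γ (min ε (17 / 16 * γ)) δ := by
  obtain ⟨d0, d1, hA1⟩ := h1
  obtain ⟨e0, e1, hi3, hA2⟩ := h2
  obtain ⟨g0, g1, _, hA4⟩ := h4
  have hB := Bsq_pos A
  set B := Real.sqrt A.Bsq with hBd
  have hB0 : 0 < B := Real.sqrt_pos.2 hB
  have hB2 : A.Bsq = B ^ 2 := (Real.sq_sqrt hB.le).symm
  have ha2 : a ^ 2 = (B ^ 2)⁻¹ := by rw [← sq_abs, ha, inv_pow]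
  have ha3 : |a| ^ 3 = (B ^ 3)⁻¹ := by rw [ha, inv_pow]
  have hB3 : A.Bsq ^ ((2 + 1 : ℝ) / 2) = B ^ 3 := by
    rw [hBd, Real.sqrt_eq_rpow, ← Real.rpow_natCast, ← Real.rpow_mul hB.le]; norm_num
  simp only [rpow_three, Real.rpow_one] at hi3 hA2 hA4
  rw [hB3] at hA2
  have hsq : ∀ᵐ ω ∂P, ∀ i, i < A.n → (P[fun ω => nX A a i ω ^ 2|A.F i]) ω = (B ^ 2)⁻¹ * (P[fun ω' => A.X (i + 1) ω' ^ 2|A.F i]) ω := by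
    rw [ae_all_iff]; intro i
    by_cases hi : i < A.n
    · filter_upwards [nX_sq A a hi] with ω h _
      rw [h, ha2]
    · exact Eventually.of_forall fun ω h => absurd h hi
  have hcu : ∀ᵐ ω ∂P, ∀ i, i < A.n → (P[fun ω => |nX A a i ω| ^ 3|A.F i]) ω = (B ^ 3)⁻¹ * (P[fun ω' => |A.X (i + 1) ω'| ^ 3|A.F i]) ω := by
    rw [ae_all_iff]; intro i
    by_cases hi : i < A.n
    · filter_upwards [nX_cu A a hi] with ω h _
      rw [h, ha3]
    · exact Eventually.of_forall fun ω h => absurd h hi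
  have hA1' : ∀ᵐ ω ∂P, |∑ i ∈ Finset.range A.n, (P[fun ω' => nX A a i ω' ^ 2|A.F i]) ω - 1| ≤ δ ^ 2 := by
    filter_upwards [hsq, hA1] with ω h h'
    rw [Finset.sum_congr rfl fun i hi => h i (Finset.mem_range.1 hi), ← Finset.mul_sum]
    unfold MDS.CV at h'
    rw [sum_Icc_range (fun i => (P[fun ω' => A.X i ω' ^ 2|A.F (i - 1)]) ω), hB2] at h'
    simp only [Nat.add_sub_cancel] at h'
    set s := ∑ i ∈ Finset.range A.n, (P[fun ω' => A.X (i + 1) ω' ^ 2|A.F i]) ω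
    have e : (B ^ 2)⁻¹ * s - 1 = (B ^ 2)⁻¹ * (s - B ^ 2) := by field_simp
    rw [e, abs_mul, abs_of_pos (by positivity : 0 < (B ^ 2)⁻¹)]
    calc _ ≤ (B ^ 2)⁻¹ * (δ ^ 2 * B ^ 2) := by gcongr
      _ = _ := by field_simp
  have hA4' : ∀ i, ∀ᵐ ω ∂P, (P[fun ω' => |nX A a i ω'| ^ 3|A.F i]) ω ≤ γ * (P[fun ω' => nX A a i ω' ^ 2|A.F i]) ω := by
    intro i
    by_cases hi : i < A.n
    · filter_upwards [hsq, hcu, hA4 (i + 1) (by omega) (by omega)] with ω k1 k2 k3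
      rw [k1 i hi, k2 i hi]
      rw [Nat.add_sub_cancel] at k3
      calc _ ≤ (B ^ 3)⁻¹ * (γ * B * (P[fun ω' => A.X (i + 1) ω' ^ 2|A.F i]) ω) := by gcongr
        _ = _ := by field_simp
    · have z1 : (fun ω' => |nX A a i ω'| ^ 3) = (0 : Ω → ℝ) := by rw [nX_ge A a hi]; ext; simp
      have z2 : (fun ω' => nX A a i ω' ^ 2) = (0 : Ω → ℝ) := by rw [nX_ge A a hi]; ext; simp
      rw [z1, z2, condExp_zero]
      exact Eventually.of_forall fun ω => by simp
  refine ⟨A.F_mono, A.F_le, ?_, ?_, ?_, ?_, hA1', ?_, hA4', g0, g1, by positivity, ?_, d0, d1⟩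
  · intro i
    by_cases hi : i < A.n
    · rw [nX_lt A a hi]
      exact (A.meas (i + 1) (by omega) (by omega)).const_mul a
    · rw [nX_ge A a hi]; exact stronglyMeasurable_zero
  · intro i hi
    exact nX_ge A a (by omega)
  · intro i
    by_cases hi : i < A.n
    · have e : (fun ω => |nX A a i ω| ^ 3) = fun ω' => |a| ^ 3 * |A.X (i + 1) ω'| ^ 3 := by
        ext ω; rw [nX_lt A a hi]; simp [mul_pow, abs_mul]
      rw [e]
      exact (hi3 (i + 1) (by omega) (by omega)).const_mul _
    · rw [nX_ge A a hi]; simp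
  · intro i
    by_cases hi : i < A.n
    · have e : nX A a i = a • A.X (i + 1) := by rw [nX_lt A a hi]; rfl
      have hm := A.mean_zero (i + 1) (by omega) (by omega)
      rw [Nat.add_sub_cancel] at hm
      rw [e]
      filter_upwards [condExp_smul (μ := P) a (A.X (i + 1)) (A.F i), hm] with ω k1 k2
      rw [k1, Pi.smul_apply, k2]; simp
    · rw [nX_ge A a hi, condExp_zero]
  · filter_upwards [hsq, hcu, hA1', hA2, ae_all_iff.2 hA4'] with ω k1 k2 k3 k4 k5
    apply le_min
    · rw [Finset.sum_congr rfl fun i hi => k2 i (Finset.mem_range.1 hi), ← Finset.mul_sum]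
      rw [sum_Icc_range (fun i => (P[fun ω' => |A.X i ω'| ^ 3|A.F (i - 1)]) ω)] at k4
      simp only [Nat.add_sub_cancel] at k4
      calc _ ≤ (B ^ 3)⁻¹ * (ε * B ^ 3) := by gcongr
        _ = _ := by field_simp
    · calc _ ≤ ∑ i ∈ Finset.range A.n, γ * (P[fun ω' => nX A a i ω' ^ 2|A.F i]) ω := Finset.sum_le_sum fun i _ => k5 i
        _ = γ * ∑ i ∈ Finset.range A.n, (P[fun ω' => nX A a i ω' ^ 2|A.F i]) ω := by rw [Finset.mul_sum]
        _ ≤ γ * (17 / 16) := by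
          gcongr
          rw [abs_le] at k3
          nlinarith
        _ = _ := by ring
  · have := min_le_right ε (17 / 16 * γ)
    linarith

lemma sn_nX (A : MDS Ω P) {a s : ℝ} (ha : a = s * (Real.sqrt A.Bsq)⁻¹) (hs : |s| = 1) (ω : Ω) :
    sn (nX A a) A.n ω = s * A.W ω := by
  have hB0 : 0 < Real.sqrt A.Bsq := Real.sqrt_pos.2 (Bsq_pos A)
  have e1 : ps (nX A a) A.n ω = a * A.S ω := by
    unfold ps MDS.S
    rw [sum_Icc_range (fun i => A.X i ω), Finset.mul_sum]
    exact Finset.sum_congr rfl fun i hi => by rw [nX_lt A a (Finset.mem_range.1 hi)]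
  have e2 : qv (nX A a) A.n ω = a ^ 2 * A.QV ω := by
    unfold qv MDS.QV
    rw [sum_Icc_range (fun i => A.X i ω ^ 2), Finset.mul_sum]
    exact Finset.sum_congr rfl fun i hi => by rw [nX_lt A a (Finset.mem_range.1 hi), mul_pow]
  unfold sn MDS.W
  rw [e1, e2, Real.sqrt_mul (sq_nonneg a), Real.sqrt_sq_eq_abs]
  have e3 : |a| = (Real.sqrt A.Bsq)⁻¹ := by
    rw [ha, abs_mul, hs, one_mul, abs_of_pos (inv_pos.2 hB0)]
  rw [e3, ha]
  set B := Real.sqrt A.Bsq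
  rw [mul_comm s, mul_assoc, mul_div_mul_left _ _ (inv_pos.2 hB0).ne', mul_div_assoc]

lemma oneside (A : MDS Ω P) {δ ε γ x s : ℝ} (h1 : A.CondA1 δ) (h2 : A.CondA2 1 ε) (h4 : A.CondA4 1 γ)
    (hx : 0 ≤ x) (hxg : x * γ ≤ 1 / 10 ^ 17) (hs : |s| = 1) :
    Real.exp (-(10 ^ 60 * RR x ε γ δ)) ≤ P.real {ω | x ≤ s * A.W ω} / (1 - Ph x) := by
  have hB0 : 0 < Real.sqrt A.Bsq := Real.sqrt_pos.2 (Bsq_pos A)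
  have hn := nh A (a := s * (Real.sqrt A.Bsq)⁻¹) h1 h2 h4 (by rw [abs_mul, hs, one_mul, abs_of_pos (inv_pos.2 hB0)])
  have hf := hn.final hx hxg
  simp_rw [sn_nX A rfl hs] at hf
  rw [le_div_iff₀ (tail_pos x), mul_comm]
  refine le_trans ?_ hf
  have ht := tail_pos x
  have hm := min_le_left ε (17 / 16 * γ)
  have hR : RR x (min ε (17 / 16 * γ)) γ δ ≤ RR x ε γ δ := by unfold RR; gcongr
  gcongr

end asm
end SN

/-- Theorem 2.2 [ii]: lower bound under (A1), (A2), (A4), for `ρ = 1`. -/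
theorem lower_bound_A1A2A4_rho_eq_one :
    ∃ c : ℝ, 0 < c ∧
      ∀ (Ω : Type) [MeasurableSpace Ω] (P : Measure Ω), IsProbabilityMeasure P →
        ∀ (A : ℕ → MDS Ω P) (δ ε γ x : ℕ → ℝ),
          (∀ n, (A n).CondA1 (δ n)) →
          (∀ n, (A n).CondA2 1 (ε n)) →
          (∀ n, (A n).CondA4 1 (γ n)) →
          (∀ n, 0 ≤ x n) →
          Tendsto (fun n => x n * γ n) atTop (nhds 0) →
          ∀ᶠ n in atTop,
            Real.exp (-(c * (x n ^ 3 * ε n + x n ^ 2 * δ n ^ 2 + (1 + x n) * (x n * γ n + γ n * |Real.log (γ n)| + δ n)))) ≤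
                (P {ω | x n ≤ (A n).W ω}).toReal / (1 - stdNormalCDF (x n)) ∧
              Real.exp (-(c * (x n ^ 3 * ε n + x n ^ 2 * δ n ^ 2 + (1 + x n) * (x n * γ n + γ n * |Real.log (γ n)| + δ n)))) ≤
                (P {ω | (A n).W ω ≤ -x n}).toReal / stdNormalCDF (-x n) := by
  refine ⟨10 ^ 60, by norm_num, ?_⟩
  intro Ω _ P hP A δ ε γ x h1 h2 h4 hx ht
  have hev : ∀ᶠ n in atTop, x n * γ n < 1 / 10 ^ 17 := ht.eventually (gt_mem_nhds (by norm_num))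
  filter_upwards [hev] with n hn
  refine ⟨?_, ?_⟩
  · have h := SN.oneside (A n) (s := 1) (h1 n) (h2 n) (h4 n) (hx n) hn.le (by simp)
    simp only [one_mul] at h
    exact h
  · have h := SN.oneside (A n) (s := -1) (h1 n) (h2 n) (h4 n) (hx n) hn.le (by simp)
    have e : {ω | x n ≤ -1 * (A n).W ω} = {ω | (A n).W ω ≤ -x n} := by
      ext ω
      simp only [Set.mem_setOf_eq]
      constructor <;> intro h <;> linarith
    rw [e, ← SN.Ph_neg] at h
    exact h
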